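/- There exist constants C > 0 and K ≥ 2 such that for all κ > 0, t > 0, x ∈ ℝ³, k ∈ ℤ and p ∈ ℤ with p ≤ 0, the oscillatory integral I = ∫_{ℝ³} e^{i(t·Σ_κ(ξ) + x·ξ)}·φ(2⁻ᵏ|ξ|)·φ(2^{−k−p}|ξ_h|) dξ satisfies: |I| ≤ C·t^{−3/2}·κ·2^{(5/2)k − p} whenever κ2ᵏ ≥ K; |I| ≤ C·t^{−3/2}·2^{(3/2)k − p} whenever K⁻¹ ≤ κ2ᵏ ≤ K; and |I| ≤ C·t^{−3/2}·κ^{−5/2}·2^{−k−p} whenever κ2ᵏ ≤ K⁻¹. (This is the convolution-kernel form of the t^{−3/2} dispersive decay estimate for the Σ half-wave e^{itΣ_κ}P_{k,p}.) -/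

import Mathlib

noncomputable section

open MeasureTheory

/-- `ℝ³` with the Euclidean norm. -/
abbrev E3 : Type := EuclideanSpace ℝ (Fin 3)

/-- `d₁(ξ)`, the distance from `ξ` to `(0,0,κ⁻¹)`. -/
def d1 (κ : ℝ) (ξ : E3) : ℝ := Real.sqrt ((ξ 0) ^ 2 + (ξ 1) ^ 2 + (ξ 2 - κ⁻¹) ^ 2)

/-- `d₂(ξ)`, the distance from `ξ` to `(0,0,−κ⁻¹)`. -/
def d2 (κ : ℝ) (ξ : E3) : ℝ := Real.sqrt ((ξ 0) ^ 2 + (ξ 1) ^ 2 + (ξ 2 + κ⁻¹) ^ 2)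

/-- `Σ_κ(ξ) = (d₂(ξ) + d₁(ξ))/2`, the sound wave dispersion relation. -/
def Sig (κ : ℝ) (ξ : E3) : ℝ := (d2 κ ξ + d1 κ ξ) / 2

/-- `Ω_κ(ξ) = (d₂(ξ) − d₁(ξ))/2`, the inertial wave dispersion relation. -/
def Om (κ : ℝ) (ξ : E3) : ℝ := (d2 κ ξ - d1 κ ξ) / 2

/-- The horizontal norm `|ξ_h| = √(ξ₁² + ξ₂²)`. -/
def nrmh (ξ : E3) : ℝ := Real.sqrt ((ξ 0) ^ 2 + (ξ 1) ^ 2)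

/-- `x·ξ`, the Euclidean dot product on `ℝ³`. -/
def dot3 (x ξ : E3) : ℝ := x 0 * ξ 0 + x 1 * ξ 1 + x 2 * ξ 2

/-- The Littlewood–Paley bump `φ(x) = ψ(x/2) − ψ(x)` built from the cutoff `ψ`. -/
def lpBump (ψ : ℝ → ℝ) (y : ℝ) : ℝ := ψ (y / 2) - ψ y

/-- The hypotheses on the cutoff function `ψ`: smooth, `0 ≤ ψ ≤ 1`, supported in `[−2,2]`
and equal to `1` on `[−1,1]`. -/
def IsCutoff (ψ : ℝ → ℝ) : Prop :=
  ContDiff ℝ (⊤ : ℕ∞) ψ ∧ (∀ y, 0 ≤ ψ y ∧ ψ y ≤ 1) ∧ (∀ y, 2 < |y| → ψ y = 0) ∧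
    (∀ y, |y| ≤ 1 → ψ y = 1)

/-- `IsSymbol s Z ℓ n α f`: on `s` the function `f` has derivatives up to order `n`, the `m`-th one
bounded by `α * ℓ⁻ᵐ`, and all of them vanish on `Z`. -/
def IsSymbol (s Z : Set ℝ) (ℓ : ℝ) : ℕ → ℝ → (ℝ → ℝ) → Prop
  | 0, α, f => ContinuousOn f s ∧ (∀ x ∈ s, |f x| ≤ α) ∧ ∀ x ∈ Z, f x = 0
  | n + 1, α, f => (∀ x ∈ s, |f x| ≤ α) ∧ (∀ x ∈ Z, f x = 0) ∧
      ∃ f' : ℝ → ℝ, (∀ x ∈ s, HasDerivAt f (f' x) x) ∧ IsSymbol s Z ℓ n (α / ℓ) f'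

namespace IsSymbol

variable {s Z : Set ℝ} {ℓ α β : ℝ} {n : ℕ} {f g : ℝ → ℝ}

lemma bound (h : IsSymbol s Z ℓ n α f) : ∀ x ∈ s, |f x| ≤ α := by
  cases n with
  | zero => exact h.2.1
  | succ n => exact h.1

lemma vanish (h : IsSymbol s Z ℓ n α f) : ∀ x ∈ Z, f x = 0 := by
  cases n with
  | zero => exact h.2.2
  | succ n => exact h.2.1

lemma continuousOn (h : IsSymbol s Z ℓ n α f) : ContinuousOn f s := by
  cases n with
  | zero => exact h.1
  | succ n =>
    obtain ⟨_, _, f', h1, _⟩ := h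
    exact fun x hx => (h1 x hx).continuousAt.continuousWithinAt

lemma mono (hℓ : 0 < ℓ) (h : IsSymbol s Z ℓ n α f) (hab : α ≤ β) : IsSymbol s Z ℓ n β f := by
  induction n generalizing α β f with
  | zero => exact ⟨h.1, fun x hx => (h.2.1 x hx).trans hab, h.2.2⟩
  | succ n ih =>
    obtain ⟨h0, hz, f', h1, h2⟩ := h
    exact ⟨fun x hx => (h0 x hx).trans hab, hz, f', h1, ih h2 (by gcongr)⟩

lemma weaken (h : IsSymbol s Z ℓ n α f) : IsSymbol s ∅ ℓ n α f := by
  induction n generalizing α f with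
  | zero => exact ⟨h.1, h.2.1, by simp⟩
  | succ n ih =>
    obtain ⟨h0, hz, f', h1, h2⟩ := h
    exact ⟨h0, by simp, f', h1, ih h2⟩

lemma of_succ (h : IsSymbol s Z ℓ (n + 1) α f) : IsSymbol s Z ℓ n α f := by
  induction n generalizing α f with
  | zero => exact ⟨h.continuousOn, h.1, h.2.1⟩
  | succ n ih =>
    obtain ⟨h0, hz, f', h1, h2⟩ := h
    exact ⟨h0, hz, f', h1, ih h2⟩

lemma add (hf : IsSymbol s Z ℓ n α f) (hg : IsSymbol s Z ℓ n β g) :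
    IsSymbol s Z ℓ n (α + β) (fun x => f x + g x) := by
  induction n generalizing α β f g with
  | zero =>
    exact ⟨hf.1.add hg.1, fun x hx => (abs_add_le _ _).trans (add_le_add (hf.2.1 x hx) (hg.2.1 x hx)),
      fun x hx => by simp [hf.2.2 x hx, hg.2.2 x hx]⟩
  | succ n ih =>
    obtain ⟨h0, hz, f', h1, h2⟩ := hf
    obtain ⟨k0, kz, g', k1, k2⟩ := hg
    refine ⟨fun x hx => (abs_add_le _ _).trans (add_le_add (h0 x hx) (k0 x hx)),
      fun x hx => by simp [hz x hx, kz x hx], fun x => f' x + g' x,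
      fun x hx => (h1 x hx).add (k1 x hx), ?_⟩
    rw [add_div]
    exact ih h2 k2

lemma nonneg (h : IsSymbol s Z ℓ n α f) (hs : s.Nonempty) : 0 ≤ α := by
  obtain ⟨x, hx⟩ := hs
  exact (abs_nonneg _).trans (h.bound x hx)

lemma mul (hs : s.Nonempty) (hf : IsSymbol s Z ℓ n α f) (hg : IsSymbol s ∅ ℓ n β g) :
    IsSymbol s Z ℓ n (2 ^ n * (α * β)) (fun x => f x * g x) := by
  have base : ∀ {α β : ℝ} {f g : ℝ → ℝ} {Y Z : Set ℝ} {n : ℕ},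
      IsSymbol s Z ℓ n α f → IsSymbol s Y ℓ n β g → ∀ x ∈ s, |f x * g x| ≤ α * β := by
    intro α β f g Y Z n hf hg x hx
    rw [abs_mul]
    exact mul_le_mul (hf.bound x hx) (hg.bound x hx) (abs_nonneg _) (hf.nonneg hs)
  induction n generalizing α β f g with
  | zero =>
    refine ⟨hf.1.mul hg.1, fun x hx => ?_, fun x hx => by simp [hf.2.2 x hx]⟩
    simpa using base hf hg x hx
  | succ n ih =>
    have hf0 := hf
    have hg0 := hg
    obtain ⟨h0, hz, f', h1, h2⟩ := hf
    obtain ⟨k0, kz, g', k1, k2⟩ := hg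
    have hαβ : 0 ≤ α * β := mul_nonneg (hf0.nonneg hs) (hg0.nonneg hs)
    refine ⟨fun x hx => (base hf0 hg0 x hx).trans ?_, fun x hx => by simp [hz x hx],
      fun x => f' x * g x + f x * g' x, fun x hx => (h1 x hx).mul (k1 x hx), ?_⟩
    · have : (1 : ℝ) ≤ 2 ^ (n + 1) := one_le_pow₀ (by norm_num)
      nlinarith
    · have := (ih h2 hg0.of_succ).add (ih hf0.of_succ k2)
      convert this using 1
      ring

lemma const (hℓ : 0 < ℓ) (a : ℝ) : IsSymbol s ∅ ℓ n |a| (fun _ => a) := by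
  induction n generalizing a with
  | zero => exact ⟨continuousOn_const, fun _ _ => le_rfl, by simp⟩
  | succ n ih =>
    refine ⟨fun _ _ => le_rfl, by simp, fun _ => 0, fun x _ => hasDerivAt_const x a, ?_⟩
    exact (ih 0).mono hℓ (by simp only [abs_zero]; positivity)

lemma const_mul (a : ℝ) (hf : IsSymbol s Z ℓ n α f) :
    IsSymbol s Z ℓ n (|a| * α) (fun x => a * f x) := by
  induction n generalizing α f with
  | zero =>
    refine ⟨continuousOn_const.mul hf.1, fun x hx => ?_, fun x hx => by simp [hf.2.2 x hx]⟩
    rw [abs_mul]; exact mul_le_mul_of_nonneg_left (hf.2.1 x hx) (abs_nonneg _)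
  | succ n ih =>
    obtain ⟨h0, hz, f', h1, h2⟩ := hf
    refine ⟨fun x hx => ?_, fun x hx => by simp [hz x hx], fun x => a * f' x,
      fun x hx => (h1 x hx).const_mul a, ?_⟩
    · rw [abs_mul]; exact mul_le_mul_of_nonneg_left (h0 x hx) (abs_nonneg _)
    · rw [mul_div_assoc]; exact ih h2

lemma id (hℓ : 0 < ℓ) (h : ∀ x ∈ s, |x| ≤ α) (hα : ℓ ≤ α) : IsSymbol s ∅ ℓ n α (fun x => x) := by
  cases n with
  | zero => exact ⟨continuousOn_id, h, by simp⟩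
  | succ n =>
    refine ⟨h, by simp, fun _ => 1, fun x _ => hasDerivAt_id x, ?_⟩
    refine (const hℓ 1).mono hℓ ?_
    rw [le_div_iff₀ hℓ]; simpa using hα

lemma inv (n : ℕ) (A : ℝ) : ∃ C > 0, ∀ (s : Set ℝ) (ℓ m : ℝ) (f : ℝ → ℝ), s.Nonempty → 0 < ℓ → 0 < m →
    (∀ x ∈ s, m ≤ f x) → IsSymbol s ∅ ℓ n (A * m) f →
      IsSymbol s ∅ ℓ n (C * m⁻¹) (fun x => (f x)⁻¹) := by
  induction n with
  | zero =>
    refine ⟨1, one_pos, fun s ℓ m f _ hℓ hm hf h => ⟨?_, fun x hx => ?_, by simp⟩⟩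
    · exact h.1.inv₀ fun x hx => (hm.trans_le (hf x hx)).ne'
    · have := hf x hx
      rw [abs_inv, abs_of_pos (hm.trans_le this), one_mul]
      gcongr
  | succ n ih =>
    obtain ⟨C, hC, H⟩ := ih
    refine ⟨max 1 (2 ^ n * ((2 ^ n * (A * C)) * C)), by positivity, ?_⟩
    intro s ℓ m f hs hℓ hm hf h
    have hr := H s ℓ m f hs hℓ hm hf h.of_succ
    obtain ⟨h0, -, f', h1, h2⟩ := h
    refine ⟨fun x hx => ?_, by simp, fun x => -1 * (f' x * (f x)⁻¹ * (f x)⁻¹), fun x hx => ?_, ?_⟩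
    · have := hf x hx
      rw [abs_inv, abs_of_pos (hm.trans_le this)]
      calc (f x)⁻¹ ≤ m⁻¹ := by gcongr
        _ = 1 * m⁻¹ := by ring
        _ ≤ _ := by gcongr; exact le_max_left _ _
    · have := hf x hx
      refine ((h1 x hx).fun_inv (hm.trans_le this).ne').congr_deriv ?_
      rw [pow_two, div_eq_mul_inv, mul_inv]
      ring
    · refine (((h2.mul hs hr).mul hs hr).const_mul (-1)).mono hℓ ?_
      have e : |(-1 : ℝ)| * (2 ^ n * (2 ^ n * (A * m / ℓ * (C * m⁻¹)) * (C * m⁻¹))) =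
          (2 ^ n * ((2 ^ n * (A * C)) * C)) * m⁻¹ / ℓ := by
        rw [abs_neg, abs_one]; field_simp
      rw [e]
      gcongr
      exact le_max_right _ _

lemma sqrt (n : ℕ) (A : ℝ) (hA : 0 ≤ A) : ∃ C > 0, ∀ (s : Set ℝ) (ℓ m : ℝ) (f : ℝ → ℝ), s.Nonempty →
    0 < ℓ → 0 < m → (∀ x ∈ s, m ^ 2 ≤ f x) → IsSymbol s ∅ ℓ n (A * m ^ 2) f →
      IsSymbol s ∅ ℓ n (C * m) (fun x => √(f x)) := by
  have base : ∀ {A m y : ℝ}, 0 ≤ A → 0 < m → |y| ≤ A * m ^ 2 → |√y| ≤ √A * m := by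
    intro A m y hA hm h
    rw [abs_of_nonneg (Real.sqrt_nonneg _)]
    calc √y ≤ √(A * m ^ 2) := Real.sqrt_le_sqrt ((le_abs_self _).trans h)
      _ = √A * m := by rw [Real.sqrt_mul hA, Real.sqrt_sq hm.le]
  induction n with
  | zero =>
    refine ⟨√A + 1, by positivity, fun s ℓ m f _ hℓ hm hf h => ⟨h.1.sqrt, fun x hx => ?_, by simp⟩⟩
    exact (base hA hm (h.2.1 x hx)).trans (by nlinarith [Real.sqrt_nonneg A])
  | succ n ih =>
    obtain ⟨C, hC, H⟩ := ih
    obtain ⟨C', hC', H'⟩ := inv n C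
    refine ⟨max (√A + 1) (2⁻¹ * (2 ^ n * (A * C'))), by positivity, ?_⟩
    intro s ℓ m f hs hℓ hm hf h
    have hr := H s ℓ m f hs hℓ hm hf h.of_succ
    have hlow : ∀ x ∈ s, m ≤ √(f x) := fun x hx => Real.le_sqrt_of_sq_le (hf x hx)
    have hi := H' s ℓ m _ hs hℓ hm hlow hr
    obtain ⟨h0, -, f', h1, h2⟩ := h
    refine ⟨fun x hx => ?_, by simp, fun x => 2⁻¹ * (f' x * (√(f x))⁻¹), fun x hx => ?_, ?_⟩
    · calc |√(f x)| ≤ √A * m := base hA hm (h0 x hx)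
        _ ≤ (√A + 1) * m := by gcongr; linarith
        _ ≤ _ := by gcongr; exact le_max_left _ _
    · have h3 : 0 < f x := lt_of_lt_of_le (by positivity) (hf x hx)
      convert (h1 x hx).sqrt h3.ne' using 1
      field_simp
    · refine ((h2.mul hs hi).const_mul 2⁻¹).mono hℓ ?_
      have e : |(2⁻¹ : ℝ)| * (2 ^ n * (A * m ^ 2 / ℓ * (C' * m⁻¹))) =
          (2⁻¹ * (2 ^ n * (A * C'))) * m / ℓ := by
        rw [abs_of_pos (by norm_num)]; field_simp
      rw [e]
      gcongr
      exact le_max_right _ _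

lemma comp (n : ℕ) (A : ℝ) (F : ℝ → ℝ) (hF : ContDiff ℝ (⊤ : ℕ∞) F) (hc : HasCompactSupport F) :
    ∃ C > 0, ∀ (s Z : Set ℝ) (ℓ : ℝ) (f : ℝ → ℝ), s.Nonempty → 0 < ℓ →
      (∀ x ∈ Z, F =ᶠ[nhds (f x)] 0) → IsSymbol s ∅ ℓ n A f →
        IsSymbol s Z ℓ n C (fun x => F (f x)) := by
  have bd : ∀ F : ℝ → ℝ, ContDiff ℝ (⊤ : ℕ∞) F → HasCompactSupport F → ∃ C > 0, ∀ y, |F y| ≤ C := by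
    intro F hF hc
    obtain ⟨C, hC⟩ := hF.continuous.bounded_above_of_compact_support hc
    exact ⟨max C 1, by positivity, fun y => (hC y).trans (le_max_left _ _)⟩
  induction n generalizing F with
  | zero =>
    obtain ⟨C, hC, h⟩ := bd F hF hc
    exact ⟨C, hC, fun s Z ℓ f _ hℓ hz hf => ⟨hF.continuous.comp_continuousOn hf.1, fun x _ => h _,
      fun x hx => (hz x hx).self_of_nhds⟩⟩
  | succ n ih =>
    obtain ⟨C, hC, h⟩ := bd F hF hc
    obtain ⟨C', hC', H'⟩ := ih (deriv F) (contDiff_infty_iff_deriv.mp hF).2 hc.deriv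
    refine ⟨max C (2 ^ n * (C' * |A|)), by positivity, ?_⟩
    intro s Z ℓ f hs hℓ hz hf
    have hz' : ∀ x ∈ Z, deriv F =ᶠ[nhds (f x)] 0 := fun x hx => by
      have := (hz x hx).deriv
      refine this.trans ?_
      filter_upwards with y
      simp
    have h3 := H' s Z ℓ f hs hℓ hz' hf.of_succ
    obtain ⟨h0, -, f', h1, h2⟩ := hf
    refine ⟨fun x _ => (h _).trans (le_max_left _ _), fun x hx => (hz x hx).self_of_nhds,
      fun x => deriv F (f x) * f' x, fun x hx => ?_, ?_⟩
    · exact ((hF.differentiable (by simp)).differentiableAt.hasDerivAt).comp x (h1 x hx)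
    · refine (h3.mul hs h2).mono hℓ ?_
      have : 2 ^ n * (C' * (A / ℓ)) = 2 ^ n * (C' * A) / ℓ := by ring
      rw [this]
      gcongr
      refine le_trans ?_ (le_max_right _ _)
      gcongr
      exact le_abs_self _

end IsSymbol

lemma norm_cexp_I_mul_ofReal (y : ℝ) : ‖Complex.exp (Complex.I * (y : ℂ))‖ = 1 := by
  rw [mul_comm]; exact Complex.norm_exp_ofReal_mul_I y

lemma hasDerivAt_cexp_I_mul {P : ℝ → ℝ} {p' x : ℝ} (h : HasDerivAt P p' x) :
    HasDerivAt (fun x => Complex.exp (Complex.I * (P x : ℂ)))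
      (Complex.exp (Complex.I * (P x : ℂ)) * (Complex.I * (p' : ℂ))) x :=
  ((h.ofReal_comp).const_mul Complex.I).cexp

/-- Repeated integration by parts against a phase without stationary points. -/
theorem norm_integral_nonstationary_le (N : ℕ) (B : ℝ) : ∃ C > 0, ∀ (a b ℓ l α : ℝ) (P p A : ℝ → ℝ),
    a ≤ b → b - a ≤ B * ℓ → 0 < ℓ → 0 < l →
    (∀ x ∈ Set.Icc a b, HasDerivAt P (p x) x) → IsSymbol (Set.Icc a b) ∅ ℓ N (B * l) p →
    (∀ x ∈ Set.Icc a b, l ≤ p x) → IsSymbol (Set.Icc a b) {a, b} ℓ N α A →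
    ‖∫ x in a..b, Complex.exp (Complex.I * (P x : ℂ)) * (A x : ℂ)‖ ≤ C * α * ℓ * ((l * ℓ) ^ N)⁻¹ := by
  induction N with
  | zero =>
    refine ⟨|B| + 1, by positivity, ?_⟩
    intro a b ℓ l α P p A hab hB hℓ hl hP hp hlow hA
    have hα : 0 ≤ α := hA.nonneg ⟨a, Set.left_mem_Icc.2 hab⟩
    have : ‖∫ x in a..b, Complex.exp (Complex.I * (P x : ℂ)) * (A x : ℂ)‖ ≤ α * |b - a| := by
      refine intervalIntegral.norm_integral_le_of_norm_le_const fun x hx => ?_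
      rw [Set.uIoc_of_le hab] at hx
      rw [norm_mul, norm_cexp_I_mul_ofReal, one_mul, Complex.norm_real]
      exact hA.bound x ⟨hx.1.le, hx.2⟩
    refine this.trans ?_
    rw [abs_of_nonneg (by linarith)]
    have h1 : b - a ≤ (|B| + 1) * ℓ := hB.trans (by gcongr; linarith [le_abs_self B])
    calc α * (b - a) ≤ α * ((|B| + 1) * ℓ) := by gcongr
      _ = _ := by simp; ring
  | succ N ih =>
    obtain ⟨C, hC, H⟩ := ih
    obtain ⟨C', hC', H'⟩ := IsSymbol.inv (N + 1) B
    refine ⟨C * (2 ^ (N + 1) * C'), by positivity, ?_⟩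
    intro a b ℓ l α P p A hab hB hℓ hl hP hp hlow hA
    have hs : (Set.Icc a b).Nonempty := ⟨a, Set.left_mem_Icc.2 hab⟩
    have hR := H' _ ℓ l p hs hℓ hl hlow hp
    have hG := hA.mul hs hR
    have hGz := hG.vanish
    have hGc := hG.continuousOn
    obtain ⟨-, -, G', hG', hG2⟩ := hG
    have key := H a b ℓ l _ P p G' hab hB hℓ hl hP hp.of_succ hlow hG2
    have hcP : ContinuousOn (fun x => Complex.exp (Complex.I * (P x : ℂ))) (Set.uIcc a b) := by
      rw [Set.uIcc_of_le hab]
      exact fun x hx => (hasDerivAt_cexp_I_mul (hP x hx)).continuousAt.continuousWithinAt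
    have hcp : ContinuousOn (fun x => (p x : ℂ)) (Set.uIcc a b) := by
      rw [Set.uIcc_of_le hab]
      exact Complex.continuous_ofReal.comp_continuousOn hp.continuousOn
    have hcG' : ContinuousOn (fun x => (G' x : ℂ)) (Set.uIcc a b) := by
      rw [Set.uIcc_of_le hab]
      exact Complex.continuous_ofReal.comp_continuousOn hG2.continuousOn
    have ibp := intervalIntegral.integral_mul_deriv_eq_deriv_mul (a := a) (b := b)
      (u := fun x => ((A x * (p x)⁻¹ : ℝ) : ℂ)) (u' := fun x => (G' x : ℂ))
      (v := fun x => Complex.exp (Complex.I * (P x : ℂ)))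
      (v' := fun x => Complex.exp (Complex.I * (P x : ℂ)) * (Complex.I * (p x : ℂ)))
      (fun x hx => (hG' x (by rwa [Set.uIcc_of_le hab] at hx)).ofReal_comp)
      (fun x hx => hasDerivAt_cexp_I_mul (hP x (by rwa [Set.uIcc_of_le hab] at hx)))
      hcG'.intervalIntegrable
      ((hcP.mul (continuousOn_const.mul hcp)).intervalIntegrable)
    have za : A a * (p a)⁻¹ = 0 := hGz a (by simp)
    have zb : A b * (p b)⁻¹ = 0 := hGz b (by simp)
    simp only [za, zb, Complex.ofReal_zero, zero_mul, sub_zero, zero_sub] at ibp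
    have e1 : ∫ x in a..b, ((A x * (p x)⁻¹ : ℝ) : ℂ) *
        (Complex.exp (Complex.I * (P x : ℂ)) * (Complex.I * (p x : ℂ))) =
        Complex.I * ∫ x in a..b, Complex.exp (Complex.I * (P x : ℂ)) * (A x : ℂ) := by
      rw [← intervalIntegral.integral_const_mul]
      refine intervalIntegral.integral_congr fun x hx => ?_
      rw [Set.uIcc_of_le hab] at hx
      have : (p x : ℂ) ≠ 0 := by exact_mod_cast (hl.trans_le (hlow x hx)).ne'
      push_cast
      field_simp
    have e2 : ∫ x in a..b, (G' x : ℂ) * Complex.exp (Complex.I * (P x : ℂ)) =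
        ∫ x in a..b, Complex.exp (Complex.I * (P x : ℂ)) * (G' x : ℂ) := by
      simp only [mul_comm]
    rw [e1, e2] at ibp
    have : ‖∫ x in a..b, Complex.exp (Complex.I * (P x : ℂ)) * (A x : ℂ)‖ =
        ‖∫ x in a..b, Complex.exp (Complex.I * (P x : ℂ)) * (G' x : ℂ)‖ := by
      have := congrArg norm ibp
      rwa [norm_mul, Complex.norm_I, one_mul, norm_neg] at this
    rw [this]
    refine key.trans (le_of_eq ?_)
    field_simp
    ring

/-- First derivative test for a phase with monotone derivative. -/
lemma norm_integral_cexp_le_of_le_abs_deriv {a b δ : ℝ} {P p q : ℝ → ℝ} (hab : a ≤ b) (hδ : 0 < δ)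
    (hP : ∀ x ∈ Set.Icc a b, HasDerivAt P (p x) x) (hp : ∀ x ∈ Set.Icc a b, HasDerivAt p (q x) x)
    (hqc : ContinuousOn q (Set.Icc a b)) (hq : ∀ x ∈ Set.Icc a b, 0 ≤ q x)
    (hδp : ∀ x ∈ Set.Icc a b, δ ≤ |p x|) :
    ‖∫ x in a..b, Complex.exp (Complex.I * (P x : ℂ))‖ ≤ 4 / δ := by
  rw [← Set.uIcc_of_le hab] at hP hp hqc hq hδp
  have hp0 : ∀ x ∈ Set.uIcc a b, p x ≠ 0 := fun x hx => abs_pos.1 (hδ.trans_le (hδp x hx))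
  have hpc : ContinuousOn p (Set.uIcc a b) := fun x hx => (hp x hx).continuousAt.continuousWithinAt
  have hcP : ContinuousOn (fun x => Complex.exp (Complex.I * (P x : ℂ))) (Set.uIcc a b) :=
    fun x hx => (hasDerivAt_cexp_I_mul (hP x hx)).continuousAt.continuousWithinAt
  have hinv : ∀ x ∈ Set.uIcc a b, HasDerivAt (fun x => (p x)⁻¹) (-q x / p x ^ 2) x :=
    fun x hx => (hp x hx).fun_inv (hp0 x hx)
  have hc1 : ContinuousOn (fun x => -q x / p x ^ 2) (Set.uIcc a b) :=
    hqc.neg.div (hpc.pow 2) fun x hx => pow_ne_zero 2 (hp0 x hx)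
  have ibp := intervalIntegral.integral_mul_deriv_eq_deriv_mul (a := a) (b := b)
      (u := fun x => (((p x)⁻¹ : ℝ) : ℂ)) (u' := fun x => ((-q x / p x ^ 2 : ℝ) : ℂ))
      (v := fun x => Complex.exp (Complex.I * (P x : ℂ)))
      (v' := fun x => Complex.exp (Complex.I * (P x : ℂ)) * (Complex.I * (p x : ℂ)))
      (fun x hx => (hinv x hx).ofReal_comp)
      (fun x hx => hasDerivAt_cexp_I_mul (hP x hx))
      (Complex.continuous_ofReal.comp_continuousOn hc1).intervalIntegrable
      ((hcP.mul (continuousOn_const.mul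
        (Complex.continuous_ofReal.comp_continuousOn hpc))).intervalIntegrable)
  have e1 : ∫ x in a..b, (((p x)⁻¹ : ℝ) : ℂ) *
        (Complex.exp (Complex.I * (P x : ℂ)) * (Complex.I * (p x : ℂ))) =
        Complex.I * ∫ x in a..b, Complex.exp (Complex.I * (P x : ℂ)) := by
    rw [← intervalIntegral.integral_const_mul]
    refine intervalIntegral.integral_congr fun x hx => ?_
    have : (p x : ℂ) ≠ 0 := by exact_mod_cast hp0 x hx
    push_cast
    field_simp
  rw [e1] at ibp
  have hb : ∀ x ∈ Set.uIcc a b, |(p x)⁻¹| ≤ 1 / δ := fun x hx => by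
    rw [abs_inv, ← one_div]; exact one_div_le_one_div_of_le hδ (hδp x hx)
  have hint : ‖∫ x in a..b, ((-q x / p x ^ 2 : ℝ) : ℂ) * Complex.exp (Complex.I * (P x : ℂ))‖ ≤
      2 / δ := by
    calc _ ≤ ∫ x in a..b, q x / p x ^ 2 := by
          refine intervalIntegral.norm_integral_le_of_norm_le hab ?_ ?_
          · refine Filter.Eventually.of_forall fun x hx => ?_
            have hx' : x ∈ Set.uIcc a b := Set.uIcc_of_le hab ▸ ⟨hx.1.le, hx.2⟩
            rw [norm_mul, norm_cexp_I_mul_ofReal, mul_one, Complex.norm_real, Real.norm_eq_abs,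
              neg_div, abs_neg, abs_of_nonneg (div_nonneg (hq x hx') (sq_nonneg _))]
          · exact (hqc.div (hpc.pow 2) fun x hx => pow_ne_zero 2 (hp0 x hx)).intervalIntegrable
      _ = (p a)⁻¹ - (p b)⁻¹ := by
          have := intervalIntegral.integral_eq_sub_of_hasDerivAt hinv hc1.intervalIntegrable
          have h2 : ∫ x in a..b, -q x / p x ^ 2 = -∫ x in a..b, q x / p x ^ 2 := by
            rw [← intervalIntegral.integral_neg]; simp only [neg_div]
          linarith
      _ ≤ 2 / δ := by
          have h1 := hb a (by simp)
          have h2 := hb b (by simp)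
          rw [abs_le] at h1 h2
          have : 2 / δ = 1 / δ + 1 / δ := by ring
          linarith
  have hI : ‖∫ x in a..b, Complex.exp (Complex.I * (P x : ℂ))‖ =
      ‖Complex.I * ∫ x in a..b, Complex.exp (Complex.I * (P x : ℂ))‖ := by
    rw [norm_mul, Complex.norm_I, one_mul]
  rw [hI, ibp]
  refine (norm_sub_le _ _).trans ?_
  have h1 := hb a (by simp)
  have h2 := hb b (by simp)
  have h3 : ‖(((p b)⁻¹ : ℝ) : ℂ) * Complex.exp (Complex.I * (P b : ℂ)) -
      (((p a)⁻¹ : ℝ) : ℂ) * Complex.exp (Complex.I * (P a : ℂ))‖ ≤ 1 / δ + 1 / δ := by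
    refine (norm_sub_le _ _).trans ?_
    rw [norm_mul, norm_mul, norm_cexp_I_mul_ofReal, norm_cexp_I_mul_ofReal, mul_one, mul_one,
      Complex.norm_real, Complex.norm_real]
    exact add_le_add h2 h1
  have : 4 / δ = 1 / δ + 1 / δ + 2 / δ := by ring
  linarith

/-- Van der Corput's second derivative test. -/
lemma norm_integral_cexp_le_of_le_deriv2 {a b l : ℝ} {P p q : ℝ → ℝ} (hab : a ≤ b) (hl : 0 < l)
    (hP : ∀ x ∈ Set.Icc a b, HasDerivAt P (p x) x) (hp : ∀ x ∈ Set.Icc a b, HasDerivAt p (q x) x)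
    (hqc : ContinuousOn q (Set.Icc a b)) (hq : ∀ x ∈ Set.Icc a b, l ≤ q x) :
    ‖∫ x in a..b, Complex.exp (Complex.I * (P x : ℂ))‖ ≤ 10 / √l := by
  have hpc : ContinuousOn p (Set.Icc a b) := fun x hx => (hp x hx).continuousAt.continuousWithinAt
  have hPc : ContinuousOn (fun x => Complex.exp (Complex.I * (P x : ℂ))) (Set.Icc a b) :=
    fun x hx => (hasDerivAt_cexp_I_mul (hP x hx)).continuousAt.continuousWithinAt
  -- the derivative grows at rate at least `l`
  have growth : ∀ x ∈ Set.Icc a b, ∀ y ∈ Set.Icc a b, x ≤ y → l * (y - x) ≤ p y - p x := by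
    refine (convex_Icc a b).mul_sub_le_image_sub_of_le_deriv hpc ?_ ?_
    · exact fun x hx => (hp x (interior_subset hx)).differentiableAt.differentiableWithinAt
    · intro x hx
      rw [(hp x (interior_subset hx)).deriv]
      exact hq x (interior_subset hx)
  obtain ⟨c, hc, hr, hle⟩ : ∃ c ∈ Set.Icc a b, (∀ x ∈ Set.Icc a b, c < x → 0 ≤ p c) ∧
      (∀ x ∈ Set.Icc a b, x < c → p c ≤ 0) := by
    by_cases h1 : 0 ≤ p a
    · exact ⟨a, Set.left_mem_Icc.2 hab, fun _ _ _ => h1, fun x hx h => absurd hx.1 (by linarith)⟩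
    by_cases h2 : p b ≤ 0
    · exact ⟨b, Set.right_mem_Icc.2 hab, fun x hx h => absurd hx.2 (by linarith), fun _ _ _ => h2⟩
    obtain ⟨c, hc, h0⟩ := intermediate_value_Icc hab hpc (show (0 : ℝ) ∈ Set.Icc (p a) (p b) from
      ⟨(not_le.1 h1).le, (not_le.1 h2).le⟩)
    exact ⟨c, hc, fun _ _ _ => h0.ge, fun _ _ _ => h0.le⟩
  set η := (√l)⁻¹ with hη
  have hsl : 0 < √l := Real.sqrt_pos.2 hl
  have hη0 : 0 < η := inv_pos.2 hsl
  have hlη : l * η = √l := by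
    rw [hη]; nth_rewrite 1 [← Real.mul_self_sqrt hl.le]; field_simp
  set u := max a (c - η)
  set v := min b (c + η)
  have hau : a ≤ u := le_max_left _ _
  have huc : u ≤ c := max_le hc.1 (by linarith)
  have hcv : c ≤ v := le_min hc.2 (by linarith)
  have hvb : v ≤ b := min_le_left _ _
  have sub : ∀ {x y : ℝ}, a ≤ x → x ≤ y → y ≤ b → IntervalIntegrable
      (fun x => Complex.exp (Complex.I * (P x : ℂ))) volume x y := fun h1 h2 h3 =>
    (hPc.mono (by rw [Set.uIcc_of_le h2]; exact Set.Icc_subset_Icc h1 h3)).intervalIntegrable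
  have i1 : ‖∫ x in a..u, Complex.exp (Complex.I * (P x : ℂ))‖ ≤ 4 / √l := by
    rcases le_total a (c - η) with h | h
    · have hu : u = c - η := max_eq_right h
      have hs : Set.Icc a u ⊆ Set.Icc a b := Set.Icc_subset_Icc_right (by linarith)
      refine norm_integral_cexp_le_of_le_abs_deriv hau hsl (fun x hx => hP x (hs hx))
        (fun x hx => hp x (hs hx)) (hqc.mono hs) (fun x hx => hl.le.trans (hq x (hs hx))) ?_
      intro x hx
      have hxc : x ≤ c - η := hx.2.trans hu.le
      have := growth x (hs hx) c hc (by linarith)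
      have h2 := hle x (hs hx) (by linarith)
      have h3 : l * η ≤ l * (c - x) := by gcongr; linarith
      rw [abs_of_nonpos (by nlinarith)]
      linarith
    · have hu : u = a := max_eq_left h
      rw [hu, intervalIntegral.integral_same, norm_zero]; positivity
  have i3 : ‖∫ x in v..b, Complex.exp (Complex.I * (P x : ℂ))‖ ≤ 4 / √l := by
    rcases le_total b (c + η) with h | h
    · have hu : v = b := min_eq_left h
      rw [hu, intervalIntegral.integral_same, norm_zero]; positivity
    · have hu : v = c + η := min_eq_right h
      have hs : Set.Icc v b ⊆ Set.Icc a b := Set.Icc_subset_Icc_left (by linarith)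
      refine norm_integral_cexp_le_of_le_abs_deriv hvb hsl (fun x hx => hP x (hs hx))
        (fun x hx => hp x (hs hx)) (hqc.mono hs) (fun x hx => hl.le.trans (hq x (hs hx))) ?_
      intro x hx
      have hxc : c + η ≤ x := hu.ge.trans hx.1
      have := growth c hc x (hs hx) (by linarith)
      have h2 := hr x (hs hx) (by linarith)
      have h3 : l * η ≤ l * (x - c) := by gcongr; linarith
      rw [abs_of_nonneg (by nlinarith)]
      linarith
  have i2 : ‖∫ x in u..v, Complex.exp (Complex.I * (P x : ℂ))‖ ≤ 2 / √l := by
    have := intervalIntegral.norm_integral_le_of_norm_le_const (a := u) (b := v) (C := 1)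
      (f := fun x => Complex.exp (Complex.I * (P x : ℂ)))
      fun x _ => (norm_cexp_I_mul_ofReal (P x)).le
    refine this.trans ?_
    rw [one_mul, abs_of_nonneg (by linarith)]
    have h1 : c - η ≤ u := le_max_right _ _
    have h2 : v ≤ c + η := min_le_right _ _
    have : 2 / √l = 2 * η := by rw [hη]; ring
    linarith
  rw [← intervalIntegral.integral_add_adjacent_intervals (sub le_rfl hau (by linarith))
    (sub hau (by linarith) le_rfl),
    ← intervalIntegral.integral_add_adjacent_intervals (sub hau (by linarith) hvb)
    (sub (by linarith) hvb le_rfl)]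
  refine (norm_add_le _ _).trans ?_
  have := norm_add_le (∫ x in u..v, Complex.exp (Complex.I * (P x : ℂ)))
    (∫ x in v..b, Complex.exp (Complex.I * (P x : ℂ)))
  have e : 10 / √l = 4 / √l + (2 / √l + 4 / √l) := by ring
  linarith

/-- Second derivative test with an amplitude. -/
lemma norm_integral_cexp_mul_le {a b l ℓ B α : ℝ} {P p q A : ℝ → ℝ} (hab : a ≤ b) (hl : 0 < l)
    (hℓ : 0 < ℓ) (hB : b - a ≤ B * ℓ)
    (hP : ∀ x ∈ Set.Icc a b, HasDerivAt P (p x) x) (hp : ∀ x ∈ Set.Icc a b, HasDerivAt p (q x) x)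
    (hqc : ContinuousOn q (Set.Icc a b))
    (hq : (∀ x ∈ Set.Icc a b, l ≤ q x) ∨ ∀ x ∈ Set.Icc a b, q x ≤ -l)
    (hA : IsSymbol (Set.Icc a b) ∅ ℓ 1 α A) :
    ‖∫ x in a..b, Complex.exp (Complex.I * (P x : ℂ)) * (A x : ℂ)‖ ≤ 10 * (1 + B) * α / √l := by
  wlog hq' : ∀ x ∈ Set.Icc a b, l ≤ q x generalizing P p q
  · have h2 := hq.resolve_left hq'
    have := this (P := fun x => -P x) (p := fun x => -p x) (q := fun x => -q x)
      (fun x hx => (hP x hx).neg) (fun x hx => (hp x hx).neg) hqc.neg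
      (Or.inl fun x hx => by linarith [h2 x hx]) (fun x hx => by linarith [h2 x hx])
    refine le_trans (le_of_eq ?_) this
    rw [← RCLike.norm_conj, intervalIntegral.integral_of_le hab, ← integral_conj,
      intervalIntegral.integral_of_le hab]
    congr 1
    refine integral_congr_ae (Filter.Eventually.of_forall fun x => ?_)
    simp [← Complex.exp_conj]
  have hα := hA.nonneg ⟨a, Set.left_mem_Icc.2 hab⟩
  have hcA := hA.continuousOn
  obtain ⟨h0, -, A', h1, h2⟩ := hA
  have hPc : ContinuousOn (fun x => Complex.exp (Complex.I * (P x : ℂ))) (Set.Icc a b) :=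
    fun x hx => (hasDerivAt_cexp_I_mul (hP x hx)).continuousAt.continuousWithinAt
  set F : ℝ → ℂ := fun y => ∫ x in a..y, Complex.exp (Complex.I * (P x : ℂ)) with hF
  have hFb : ∀ y ∈ Set.Icc a b, ‖F y‖ ≤ 10 / √l := fun y hy => by
    have hs : Set.Icc a y ⊆ Set.Icc a b := Set.Icc_subset_Icc_right hy.2
    exact norm_integral_cexp_le_of_le_deriv2 hy.1 hl (fun x hx => hP x (hs hx))
      (fun x hx => hp x (hs hx)) (hqc.mono hs) fun x hx => hq' x (hs hx)
  have hii : IntervalIntegrable (fun x => Complex.exp (Complex.I * (P x : ℂ))) volume a b :=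
    (by rwa [Set.uIcc_of_le hab] : ContinuousOn _ (Set.uIcc a b)).intervalIntegrable
  have hFc : ContinuousOn F (Set.uIcc a b) :=
    intervalIntegral.continuousOn_primitive_interval'  hii (by simp)
  have ibp := intervalIntegral.integral_mul_deriv_eq_deriv_mul_of_hasDerivAt (a := a) (b := b)
      (u := fun x => (A x : ℂ)) (u' := fun x => (A' x : ℂ)) (v := F)
      (v' := fun x => Complex.exp (Complex.I * (P x : ℂ)))
      (by rw [Set.uIcc_of_le hab]; exact Complex.continuous_ofReal.comp_continuousOn hcA)
      hFc
      (fun x hx => (h1 x (by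
        rw [min_eq_left hab, max_eq_right hab] at hx; exact ⟨hx.1.le, hx.2.le⟩)).ofReal_comp)
      (fun x hx => by
        rw [min_eq_left hab, max_eq_right hab] at hx
        have hnb : Set.Icc a b ∈ nhds x := Icc_mem_nhds hx.1 hx.2
        refine intervalIntegral.integral_hasDerivAt_right (hii.mono_set ?_) ?_ ?_
        · rw [Set.uIcc_of_le hab, Set.uIcc_of_le hx.1.le]; exact Set.Icc_subset_Icc_right hx.2.le
        · exact (hPc.mono Set.Ioo_subset_Icc_self).stronglyMeasurableAtFilter isOpen_Ioo x hx
        · exact hPc.continuousAt hnb)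
      (by
        apply ContinuousOn.intervalIntegrable
        rw [Set.uIcc_of_le hab]; exact Complex.continuous_ofReal.comp_continuousOn h2.continuousOn)
      hii
  have hFa : F a = 0 := intervalIntegral.integral_same
  rw [hFa, mul_zero, sub_zero] at ibp
  have : ∫ x in a..b, Complex.exp (Complex.I * (P x : ℂ)) * (A x : ℂ) =
      ∫ x in a..b, (A x : ℂ) * Complex.exp (Complex.I * (P x : ℂ)) := by simp only [mul_comm]
  rw [this, ibp]
  have n1 : ‖(A b : ℂ) * F b‖ ≤ α * (10 / √l) := by
    rw [norm_mul, Complex.norm_real]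
    exact mul_le_mul (h0 b ⟨hab, le_rfl⟩) (hFb b ⟨hab, le_rfl⟩) (norm_nonneg _) hα
  have n2 : ‖∫ x in a..b, (A' x : ℂ) * F x‖ ≤ (α / ℓ * (10 / √l)) * |b - a| := by
    refine intervalIntegral.norm_integral_le_of_norm_le_const fun x hx => ?_
    rw [Set.uIoc_of_le hab] at hx
    have hx' : x ∈ Set.Icc a b := ⟨hx.1.le, hx.2⟩
    rw [norm_mul, Complex.norm_real]
    exact mul_le_mul (h2.bound x hx') (hFb x hx') (norm_nonneg _) (by positivity)
  refine (norm_sub_le _ _).trans ?_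
  rw [abs_of_nonneg (by linarith)] at n2
  have n3 : (α / ℓ * (10 / √l)) * (b - a) ≤ (α / ℓ * (10 / √l)) * (B * ℓ) := by gcongr
  have n4 : (α / ℓ * (10 / √l)) * (B * ℓ) = α * (10 / √l) * B := by field_simp
  have : 10 * (1 + B) * α / √l = α * (10 / √l) + α * (10 / √l) * B := by ring
  linarith

/-- Half the sum of the distances to the two foci, as a function of `s = |ξ_h|²` and `z = ξ₃`. -/
def halfSum (c s z : ℝ) : ℝ := (√(s + (z + c) ^ 2) + √(s + (z - c) ^ 2)) / 2

/-- The product of the distances to the two foci. -/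
def focalProd (c s z : ℝ) : ℝ := √(s + (z + c) ^ 2) * √(s + (z - c) ^ 2)

/-- The squared minor semiaxis of the confocal ellipsoid through a point. -/
def minorSq (c s z : ℝ) : ℝ := halfSum c s z ^ 2 - c ^ 2

section Geometry

variable {c s z : ℝ}

lemma halfSum_nonneg : 0 ≤ halfSum c s z := by unfold halfSum; positivity

lemma focalProd_nonneg : 0 ≤ focalProd c s z := by unfold focalProd; positivity

lemma le_halfSum (hs : 0 ≤ s) : c ≤ halfSum c s z := by
  have h1 : z + c ≤ √(s + (z + c) ^ 2) := Real.le_sqrt_of_sq_le (by linarith)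
  have h2 : -(z - c) ≤ √(s + (z - c) ^ 2) := Real.le_sqrt_of_sq_le (by nlinarith)
  unfold halfSum; linarith

lemma minorSq_add_sq : minorSq c s z + c ^ 2 = halfSum c s z ^ 2 := by unfold minorSq; ring

lemma focalProd_eq (hs : 0 ≤ s) :
    focalProd c s z = 2 * minorSq c s z - (s + z ^ 2 - c ^ 2) := by
  have h1 := Real.sq_sqrt (show 0 ≤ s + (z + c) ^ 2 by positivity)
  have h2 := Real.sq_sqrt (show 0 ≤ s + (z - c) ^ 2 by positivity)
  unfold focalProd minorSq halfSum
  linear_combination (-1/2) * h1 - (1/2) * h2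

lemma focalProd_sq (hs : 0 ≤ s) : focalProd c s z ^ 2 = (s + z ^ 2 - c ^ 2) ^ 2 + 4 * c ^ 2 * s := by
  unfold focalProd
  rw [mul_pow, Real.sq_sqrt (by positivity), Real.sq_sqrt (by positivity)]
  ring

lemma minorSq_nonneg (hc : 0 ≤ c) (hs : 0 ≤ s) : 0 ≤ minorSq c s z := by
  have := le_halfSum (c := c) (z := z) hs
  unfold minorSq; nlinarith

lemma minorSq_le_focalProd (hs : 0 ≤ s) : minorSq c s z ≤ focalProd c s z := by
  have h1 := focalProd_eq (c := c) (z := z) hs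
  have h2 := focalProd_sq (c := c) (z := z) hs
  have h3 : s + z ^ 2 - c ^ 2 ≤ focalProd c s z :=
    abs_le_of_sq_le_sq' (by nlinarith [mul_nonneg (sq_nonneg c) hs]) focalProd_nonneg |>.2
  linarith

/-- The quadratic equation satisfied by the squared minor semiaxis. -/
lemma minorSq_mul_focalProd_sub (hs : 0 ≤ s) :
    minorSq c s z * (focalProd c s z - minorSq c s z) = c ^ 2 * s := by
  have h1 := focalProd_eq (c := c) (z := z) hs
  have h2 := focalProd_sq (c := c) (z := z) hs
  have h3 : minorSq c s z = (focalProd c s z + (s + z ^ 2 - c ^ 2)) / 2 := by linarith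
  rw [h3]; linear_combination (1 / 4) * h2

lemma le_minorSq (hs : 0 ≤ s) : s + z ^ 2 - c ^ 2 ≤ minorSq c s z := by
  have h1 := focalProd_eq (c := c) (z := z) hs
  have h2 := minorSq_le_focalProd (c := c) (z := z) hs
  linarith

lemma minorSq_eq (hs : 0 ≤ s) (V : ℝ) :
    V * (V + c ^ 2) - s * (V + c ^ 2) - z ^ 2 * V =
      (V - minorSq c s z) * (V + (focalProd c s z - minorSq c s z)) := by
  have h1 := focalProd_eq (c := c) (z := z) hs
  have h2 := minorSq_mul_focalProd_sub (c := c) (z := z) hs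
  linear_combination h2 - V * h1

lemma minorSq_ge_radial (hs : 0 ≤ s) (hc : 0 ≤ c) : s ≤ minorSq c s z := by
  have h := minorSq_eq (c := c) (z := z) hs s
  have h1 := minorSq_le_focalProd (c := c) (z := z) hs
  by_contra! h2
  have : 0 ≤ minorSq c s z := minorSq_nonneg hc hs
  nlinarith [mul_pos (sub_pos.2 h2) (show 0 < s + (focalProd c s z - minorSq c s z) by linarith),
    mul_nonneg (sq_nonneg z) hs]

lemma minorSq_lt_iff (hs : 0 ≤ s) {V : ℝ} (hV : 0 < V) :
    minorSq c s z < V ↔ s / V + z ^ 2 / (V + c ^ 2) < 1 := by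
  have h := minorSq_eq (c := c) (z := z) hs V
  have h1 := minorSq_le_focalProd (c := c) (z := z) hs
  have h2 : 0 < V + (focalProd c s z - minorSq c s z) := by linarith
  have h3 : 0 < V + c ^ 2 := by positivity
  rw [div_add_div _ _ hV.ne' h3.ne', div_lt_one (by positivity)]
  constructor
  · intro h4
    nlinarith [mul_pos (sub_pos.2 h4) h2]
  · intro h4
    have : 0 < (V - minorSq c s z) * (V + (focalProd c s z - minorSq c s z)) := by
      rw [← h]; nlinarith
    linarith [pos_of_mul_pos_left this h2.le]

lemma minorSq_le (hs : 0 ≤ s) (hc : 0 ≤ c) : minorSq c s z ≤ s + z ^ 2 := by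
  have h := minorSq_eq (c := c) (z := z) hs (s + z ^ 2)
  have h1 := minorSq_le_focalProd (c := c) (z := z) hs
  have h2 := minorSq_nonneg (c := c) (z := z) hc hs
  by_contra! h3
  have h4 : 0 < s + z ^ 2 + (focalProd c s z - minorSq c s z) := by
    rcases (by positivity : 0 ≤ s + z ^ 2).eq_or_lt with h5 | h5
    · have := focalProd_eq (c := c) (z := z) hs
      nlinarith [sq_nonneg z, sq_nonneg c]
    · linarith
  nlinarith [mul_pos (sub_pos.2 h3) h4, mul_nonneg (sq_nonneg z) (sq_nonneg c), mul_nonneg (sq_nonneg c) (sq_nonneg z)]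

lemma halfSum_lt_iff (hs : 0 ≤ s) (hc : 0 ≤ c) {u : ℝ} (hu : c < u) :
    halfSum c s z < u ↔ s / (u ^ 2 - c ^ 2) + z ^ 2 / u ^ 2 < 1 := by
  have hV : 0 < u ^ 2 - c ^ 2 := by nlinarith
  have := minorSq_lt_iff (c := c) (z := z) hs hV
  rw [sub_add_cancel] at this
  rw [← this]
  unfold minorSq
  rw [sub_lt_sub_iff_right, sq_lt_sq₀ halfSum_nonneg (by linarith)]

end Geometry

/-- Coordinates `((ξ₁, ξ₂), ξ₃)` on `ℝ³`. -/
def ofCoords (q : (ℝ × ℝ) × ℝ) : E3 := !₂[q.1.1, q.1.2, q.2]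

@[simp] lemma ofCoords_zero (q : (ℝ × ℝ) × ℝ) : ofCoords q 0 = q.1.1 := rfl
@[simp] lemma ofCoords_one (q : (ℝ × ℝ) × ℝ) : ofCoords q 1 = q.1.2 := rfl
@[simp] lemma ofCoords_two (q : (ℝ × ℝ) × ℝ) : ofCoords q 2 = q.2 := rfl

/-- `ofCoords` as a measurable equivalence. -/
def coordsEquiv : (ℝ × ℝ) × ℝ ≃ᵐ E3 :=
  (((MeasurableEquiv.prodCongr (MeasurableEquiv.finTwoArrow (α := ℝ)) (MeasurableEquiv.refl ℝ)).symm.trans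
    MeasurableEquiv.prodComm).trans (MeasurableEquiv.piFinSuccAbove (fun _ : Fin 3 => ℝ) 2).symm).trans
      (MeasurableEquiv.toLp 2 (Fin 3 → ℝ))

lemma coordsEquiv_apply (q : (ℝ × ℝ) × ℝ) : coordsEquiv q = ofCoords q := by
  ext i
  fin_cases i <;> rfl

lemma measurePreserving_ofCoords : MeasurePreserving ofCoords volume volume := by
  have h1 := ((volume_preserving_finTwoArrow ℝ).symm).prod (MeasurePreserving.id (volume : Measure ℝ))
  have h2 := Measure.measurePreserving_swap (μ := (volume : Measure (Fin 2 → ℝ))) (ν := (volume : Measure ℝ))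
  have h3 := (volume_preserving_piFinSuccAbove (fun _ : Fin 3 => ℝ) 2).symm
  have h4 := PiLp.volume_preserving_toLp (Fin 3)
  have := h4.comp (h3.comp (h2.comp h1))
  have e : ofCoords = ⇑coordsEquiv := funext fun q => (coordsEquiv_apply q).symm
  rw [e]
  exact this

lemma measurableEmbedding_ofCoords : MeasurableEmbedding ofCoords := by
  have e : ofCoords = ⇑coordsEquiv := funext fun q => (coordsEquiv_apply q).symm
  rw [e]
  exact coordsEquiv.measurableEmbedding

lemma integral_ofCoords {F : Type*} [NormedAddCommGroup F] [NormedSpace ℝ F] (f : E3 → F) :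
    ∫ q, f (ofCoords q) = ∫ ξ, f ξ :=
  measurePreserving_ofCoords.integral_comp measurableEmbedding_ofCoords f

lemma dot3_eq_inner (x ξ : E3) : dot3 x ξ = inner ℝ x ξ := by
  rw [PiLp.inner_apply, Fin.sum_univ_three]
  simp only [dot3, RCLike.inner_apply, conj_trivial]
  ring

lemma norm_sq_eq (ξ : E3) : ‖ξ‖ ^ 2 = ξ 0 ^ 2 + ξ 1 ^ 2 + ξ 2 ^ 2 := by
  rw [EuclideanSpace.norm_sq_eq, Fin.sum_univ_three]; simp

/-- The Fourier transform of the unit ball of `ℝ³` at frequency `Q`. -/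
def ballFT (Q : ℝ) : ℂ :=
  ∫ z in (-1)..1, Complex.exp (Complex.I * ((Q * z : ℝ) : ℂ)) * ((Real.pi * (1 - z ^ 2) : ℝ) : ℂ)

lemma volume_real_disc (R : ℝ) :
    volume.real {p : ℝ × ℝ | p.1 ^ 2 + p.2 ^ 2 < R} = Real.pi * max R 0 := by
  have h := Complex.volume_preserving_equiv_real_prod.measure_preimage_equiv
    {p : ℝ × ℝ | p.1 ^ 2 + p.2 ^ 2 < R}
  have e : Complex.measurableEquivRealProd ⁻¹' {p : ℝ × ℝ | p.1 ^ 2 + p.2 ^ 2 < R} =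
      Metric.ball 0 (√R) := by
    ext w
    simp only [Set.mem_preimage, Complex.measurableEquivRealProd_apply, Set.mem_ofPred_eq,
      mem_ball_zero_iff]
    rw [Real.lt_sqrt (norm_nonneg _), ← Complex.normSq_eq_norm_sq, Complex.normSq_apply]
    simp [sq]
  rw [measureReal_def, ← h, e, Complex.volume_ball]
  simp only [ENNReal.toReal_mul, ENNReal.toReal_pow, ENNReal.toReal_ofReal (Real.sqrt_nonneg _)]
  rcases le_total 0 R with hR | hR
  · rw [Real.sq_sqrt hR, max_eq_left hR, mul_comm]; simp
  · rw [Real.sqrt_eq_zero_of_nonpos hR, max_eq_right hR]; simp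

lemma continuous_dot3 (x : E3) : Continuous (dot3 x) := by
  unfold dot3; fun_prop

lemma mem_ball_ofCoords (q : (ℝ × ℝ) × ℝ) :
    ofCoords q ∈ Metric.ball (0 : E3) 1 ↔ q.1.1 ^ 2 + q.1.2 ^ 2 < 1 - q.2 ^ 2 := by
  rw [mem_ball_zero_iff, ← sq_lt_one_iff₀ (norm_nonneg _), norm_sq_eq]
  simp only [ofCoords_zero, ofCoords_one, ofCoords_two]
  exact lt_sub_iff_add_lt.symm

lemma integral_ball_vertical (Q : ℝ) :
    ∫ η : E3, (Metric.ball (0 : E3) 1).indicator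
      (fun η => Complex.exp (Complex.I * ((Q * η 2 : ℝ) : ℂ))) η = ballFT Q := by
  have hint : Integrable ((Metric.ball (0 : E3) 1).indicator
      (fun η => Complex.exp (Complex.I * ((Q * η 2 : ℝ) : ℂ)))) := by
    rw [integrable_indicator_iff measurableSet_ball]
    refine Integrable.mono' (g := fun _ => 1) ?_ (by fun_prop) ?_
    · exact integrableOn_const measure_ball_lt_top.ne
    · exact Filter.Eventually.of_forall fun η => (norm_cexp_I_mul_ofReal _).le
  rw [← integral_ofCoords, Measure.volume_eq_prod, integral_prod_symm]
  · have h1 : ∀ z : ℝ, (∫ p : ℝ × ℝ, (Metric.ball (0 : E3) 1).indicator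
        (fun η => Complex.exp (Complex.I * ((Q * η 2 : ℝ) : ℂ))) (ofCoords (p, z))) =
        (Set.Ioc (-1 : ℝ) 1).indicator (fun z => Complex.exp (Complex.I * ((Q * z : ℝ) : ℂ)) *
          ((Real.pi * (1 - z ^ 2) : ℝ) : ℂ)) z := fun z => by
      have e : ∀ p : ℝ × ℝ, (Metric.ball (0 : E3) 1).indicator
          (fun η => Complex.exp (Complex.I * ((Q * η 2 : ℝ) : ℂ))) (ofCoords (p, z)) =
          {p : ℝ × ℝ | p.1 ^ 2 + p.2 ^ 2 < 1 - z ^ 2}.indicator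
            (fun _ => Complex.exp (Complex.I * ((Q * z : ℝ) : ℂ))) p := fun p => by
        simp only [Set.indicator, mem_ball_ofCoords, ofCoords_two, Set.mem_ofPred_eq]
      simp only [e]
      have hm : MeasurableSet {p : ℝ × ℝ | p.1 ^ 2 + p.2 ^ 2 < 1 - z ^ 2} :=
        measurableSet_lt (by fun_prop) (by fun_prop)
      rw [integral_indicator hm, setIntegral_const, volume_real_disc, Complex.real_smul, mul_comm]
      by_cases hz : z ∈ Set.Ioc (-1 : ℝ) 1
      · rw [Set.indicator_of_mem hz, max_eq_left (by nlinarith [hz.1, hz.2])]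
      · rw [Set.indicator_of_notMem hz, max_eq_right]
        · simp
        · by_contra! h
          exact hz ⟨by nlinarith, by nlinarith⟩
    simp only [h1]
    rw [integral_indicator measurableSet_Ioc, ballFT,
      intervalIntegral.integral_of_le (by norm_num)]
  · exact (measurePreserving_ofCoords.integrable_comp_emb measurableEmbedding_ofCoords).2 hint

lemma integral_ball (w : E3) :
    ∫ η : E3, (Metric.ball (0 : E3) 1).indicator
      (fun η => Complex.exp (Complex.I * (dot3 w η : ℂ))) η = ballFT ‖w‖ := by
  set v : E3 := ‖w‖ • EuclideanSpace.single 2 (1 : ℝ) with hv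
  have hn : ‖w‖ = ‖v‖ := by simp [hv, norm_smul]
  have hr := Submodule.reflection_sub hn
  set R := (ℝ ∙ (w - v))ᗮ.reflection with hR
  rw [← integral_ball_vertical, ← R.measurePreserving.integral_comp R.toHomeomorph.measurableEmbedding]
  congr 1
  ext η
  have h1 : dot3 w (R η) = ‖w‖ * η 2 := by
    have : w = R v := by rw [← hr]; exact ((ℝ ∙ (w - v))ᗮ.reflection_reflection w).symm
    rw [dot3_eq_inner]
    nth_rewrite 1 [this]
    rw [R.inner_map_map, hv, ← dot3_eq_inner]
    simp [dot3]
  simp only [Set.indicator, mem_ball_zero_iff, R.norm_map, h1]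

lemma integral_ellipsoid {α γ : ℝ} (hα : 0 < α) (hγ : 0 < γ) (y : E3) :
    ∫ ξ : E3, {ξ : E3 | (ξ 0 ^ 2 + ξ 1 ^ 2) / α ^ 2 + ξ 2 ^ 2 / γ ^ 2 < 1}.indicator
      (fun ξ => Complex.exp (Complex.I * (dot3 y ξ : ℂ))) ξ =
    (α ^ 2 * γ : ℝ) * ballFT (√(α ^ 2 * (y 0 ^ 2 + y 1 ^ 2) + γ ^ 2 * y 2 ^ 2)) := by
  set w : E3 := !₂[α * y 0, α * y 1, γ * y 2] with hw
  have hwn : ‖w‖ = √(α ^ 2 * (y 0 ^ 2 + y 1 ^ 2) + γ ^ 2 * y 2 ^ 2) := by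
    rw [← Real.sqrt_sq (norm_nonneg w), norm_sq_eq]
    congr 1
    simp [hw]; ring
  set L : E3 →ₗ[ℝ] E3 := Matrix.toLpLin 2 2 (Matrix.diagonal ![α⁻¹, α⁻¹, γ⁻¹]) with hL
  have hLi : ∀ (ξ : E3) i, L ξ i = ![α⁻¹, α⁻¹, γ⁻¹] i * ξ i := fun ξ i => by
    simp [hL, Matrix.toLpLin_apply, Matrix.mulVec_diagonal]
  have hdet : LinearMap.det L = (α ^ 2 * γ)⁻¹ := by
    rw [hL, Matrix.toLpLin_eq_toLin, LinearMap.det_toLin, Matrix.det_diagonal,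
      Fin.prod_univ_three]
    simp; ring
  have hd0 : LinearMap.det L ≠ 0 := by rw [hdet]; positivity
  have hmap := Measure.map_linearMap_addHaar_eq_smul_addHaar (volume : Measure E3) hd0
  rw [← hwn, ← integral_ball]
  have hemb : MeasurableEmbedding L :=
    (L.equivOfDetNeZero hd0).toContinuousLinearEquiv.toHomeomorph.measurableEmbedding
  have h2 := hemb.integral_map (μ := volume) ((Metric.ball (0 : E3) 1).indicator
      (fun η => Complex.exp (Complex.I * (dot3 w η : ℂ))))
  rw [hmap, integral_smul_measure, hdet, inv_inv, ENNReal.toReal_ofReal (abs_nonneg _),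
    abs_of_pos (by positivity), Complex.real_smul] at h2
  rw [h2]
  congr 1
  ext ξ
  have h3 : dot3 w (L ξ) = dot3 y ξ := by
    simp only [dot3, hLi, hw]
    simp
    field_simp
  have h4 : L ξ ∈ Metric.ball (0 : E3) 1 ↔ (ξ 0 ^ 2 + ξ 1 ^ 2) / α ^ 2 + ξ 2 ^ 2 / γ ^ 2 < 1 := by
    rw [mem_ball_zero_iff, ← sq_lt_one_iff₀ (norm_nonneg _), norm_sq_eq]
    simp only [hLi]
    simp
    rw [show (ξ 0 ^ 2 + ξ 1 ^ 2) / α ^ 2 + ξ 2 ^ 2 / γ ^ 2 = (α⁻¹ * ξ 0) ^ 2 + (α⁻¹ * ξ 1) ^ 2 +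
      (γ⁻¹ * ξ 2) ^ 2 by field_simp]
  simp only [Set.indicator, h4, h3, Set.mem_ofPred_eq]

lemma continuous_halfSum_apply (c : ℝ) :
    Continuous fun ξ : E3 => halfSum c (ξ 0 ^ 2 + ξ 1 ^ 2) (ξ 2) := by
  unfold halfSum; fun_prop

lemma integral_sublevel_halfSum {c u : ℝ} (hc : 0 ≤ c) (hu : c < u) (y : E3) :
    ∫ ξ : E3, {ξ : E3 | halfSum c (ξ 0 ^ 2 + ξ 1 ^ 2) (ξ 2) < u}.indicator
      (fun ξ => Complex.exp (Complex.I * (dot3 y ξ : ℂ))) ξ =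
    (u * (u ^ 2 - c ^ 2) : ℝ) *
      ballFT (√(‖y‖ ^ 2 * u ^ 2 - c ^ 2 * (y 0 ^ 2 + y 1 ^ 2))) := by
  have hV : 0 < u ^ 2 - c ^ 2 := by nlinarith
  have h := integral_ellipsoid (Real.sqrt_pos.2 hV) (hc.trans_lt hu) y
  rw [Real.sq_sqrt hV.le] at h
  have e : {ξ : E3 | halfSum c (ξ 0 ^ 2 + ξ 1 ^ 2) (ξ 2) < u} =
      {ξ : E3 | (ξ 0 ^ 2 + ξ 1 ^ 2) / (u ^ 2 - c ^ 2) + ξ 2 ^ 2 / u ^ 2 < 1} := by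
    ext ξ; exact halfSum_lt_iff (by positivity) hc hu
  rw [e, h, norm_sq_eq]
  congr 2
  · ring
  · congr 1; ring

/-- Layer-cake representation of an oscillatory integral over a shell of confocal ellipsoids. -/
theorem integral_shell_eq {c ua ub t : ℝ} {Θ Θ' : ℝ → ℝ} (hc : 0 ≤ c) (hca : c < ua) (hab : ua ≤ ub)
    (hΘ : ∀ u, HasDerivAt Θ (Θ' u) u) (hΘ' : Continuous Θ') (hza : ∀ u, c ≤ u → u ≤ ua → Θ u = 0)
    (hzb : ∀ u, ub ≤ u → Θ u = 0) (x : E3) :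
    ∫ ξ : E3, Complex.exp (Complex.I *
      ((t * halfSum c (ξ 0 ^ 2 + ξ 1 ^ 2) (ξ 2) + dot3 x ξ : ℝ) : ℂ)) *
        (Θ (halfSum c (ξ 0 ^ 2 + ξ 1 ^ 2) (ξ 2)) : ℂ) =
    -∫ u in ua..ub, Complex.exp (Complex.I * ((t * u : ℝ) : ℂ)) * (Complex.I * t * Θ u + Θ' u) *
      ((u * (u ^ 2 - c ^ 2) : ℝ) *
        ballFT (√(‖x‖ ^ 2 * u ^ 2 - c ^ 2 * (x 0 ^ 2 + x 1 ^ 2)))) := by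
  set sg : E3 → ℝ := fun ξ => halfSum c (ξ 0 ^ 2 + ξ 1 ^ 2) (ξ 2) with hsg
  have hsgc : Continuous sg := continuous_halfSum_apply c
  set g : ℝ → ℂ := fun u => Complex.exp (Complex.I * ((t * u : ℝ) : ℂ)) * (Θ u : ℂ) with hg
  set g' : ℝ → ℂ := fun u => Complex.exp (Complex.I * ((t * u : ℝ) : ℂ)) *
    (Complex.I * t * Θ u + Θ' u) with hg'
  have hΘc : Continuous Θ := continuous_iff_continuousAt.2 fun u => (hΘ u).continuousAt
  have hg'c : Continuous g' := by fun_prop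
  have hd : ∀ u, HasDerivAt g (g' u) u := fun u => by
    have h1 := hasDerivAt_cexp_I_mul (P := fun u => t * u) ((hasDerivAt_id u).const_mul t)
    have := h1.mul (hΘ u).ofReal_comp
    refine this.congr_deriv ?_
    simp only [hg', mul_one]
    ring
  have hcs : ∀ ξ, c ≤ sg ξ := fun ξ => le_halfSum (by positivity)
  have hpt : ∀ ξ, g (sg ξ) = -∫ u in ua..ub, (Set.Ioi (sg ξ)).indicator g' u := fun ξ => by
    have ii : ∀ p q : ℝ, IntervalIntegrable g' volume p q := fun p q => hg'c.intervalIntegrable p q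
    rw [intervalIntegral.integral_of_le hab, setIntegral_indicator measurableSet_Ioi,
      Set.Ioc_inter_Ioi]
    rcases le_total (max ua (sg ξ)) ub with h | h
    · rw [← intervalIntegral.integral_of_le h,
        intervalIntegral.integral_eq_sub_of_hasDerivAt (fun u _ => hd u) (ii _ _)]
      have z1 : g ub = 0 := by simp [hg, hzb ub le_rfl]
      rw [z1, zero_sub, neg_neg]
      rcases le_total ua (sg ξ) with h2 | h2
      · rw [max_eq_right h2]
      · rw [max_eq_left h2]; simp [hg, hza _ (hcs ξ) h2, hza _ hca.le le_rfl]
    · rw [Set.Ioc_eq_empty_of_le h, setIntegral_empty, neg_zero]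
      rcases le_total ua (sg ξ) with h2 | h2
      · rw [max_eq_right h2] at h; simp [hg, hzb _ h]
      · simp [hg, hza _ (hcs ξ) h2]
  obtain ⟨M, hM⟩ := isCompact_Icc.exists_bound_of_continuousOn (s := Set.Icc ua ub) hg'c.continuousOn
  have hsgb : ∀ ξ : E3, sg ξ ≤ ub → ‖ξ‖ ≤ ub := fun ξ h => by
    have h1 := le_minorSq (c := c) (s := ξ 0 ^ 2 + ξ 1 ^ 2) (z := ξ 2) (by positivity)
    have h2 : 0 ≤ sg ξ := halfSum_nonneg
    refine abs_le_of_sq_le_sq' ?_ (h2.trans h) |>.2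
    rw [norm_sq_eq]
    unfold minorSq at h1
    change _ ≤ sg ξ ^ 2 - c ^ 2 at h1
    nlinarith
  set H : E3 × ℝ → ℂ := {q : E3 × ℝ | sg q.1 < q.2}.indicator
    fun q => g' q.2 * Complex.exp (Complex.I * (dot3 x q.1 : ℂ)) with hH
  have hHint : Integrable H (volume.prod (volume.restrict (Set.Ioc ua ub))) := by
    have hdom : Integrable (fun q : E3 × ℝ => (Metric.closedBall (0 : E3) ub).indicator (fun _ => (1 : ℝ)) q.1 *
        (fun _ => M) q.2) (volume.prod (volume.restrict (Set.Ioc ua ub))) := by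
      refine Integrable.mul_prod ?_ (integrable_const M)
      exact (integrable_indicator_iff measurableSet_closedBall).2
        (integrableOn_const measure_closedBall_lt_top.ne)
    refine hdom.mono' ?_ ?_
    · refine Measurable.aestronglyMeasurable ?_
      refine Measurable.indicator ?_ (measurableSet_lt (by fun_prop) (by fun_prop))
      have := (continuous_dot3 x).measurable
      have := hg'c.measurable
      fun_prop
    · have : ∀ᵐ q : E3 × ℝ ∂(volume.prod (volume.restrict (Set.Ioc ua ub))), q.2 ∈ Set.Ioc ua ub :=
        Measure.quasiMeasurePreserving_snd.ae (ae_restrict_mem measurableSet_Ioc)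
      filter_upwards [this] with q hq
      by_cases h : sg q.1 < q.2
      · rw [hH, Set.indicator_of_mem (show q ∈ {q : E3 × ℝ | sg q.1 < q.2} from h),
          Set.indicator_of_mem (by simpa using hsgb _ (h.le.trans hq.2)), norm_mul,
          norm_cexp_I_mul_ofReal, mul_one, one_mul]
        exact hM _ ⟨hq.1.le, hq.2⟩
      · rw [hH, Set.indicator_of_notMem (show q ∉ {q : E3 × ℝ | sg q.1 < q.2} from h), norm_zero]
        have : 0 ≤ M := (norm_nonneg _).trans (hM ua ⟨le_rfl, hab⟩)
        refine mul_nonneg (Set.indicator_nonneg (fun _ _ => zero_le_one) _) this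
  have hswap := integral_integral_swap (f := fun ξ u => H (ξ, u)) hHint
  calc _ = ∫ ξ : E3, -∫ u in Set.Ioc ua ub, H (ξ, u) := by
        refine integral_congr_ae (Filter.Eventually.of_forall fun ξ => ?_)
        have e1 : Complex.exp (Complex.I * ((t * sg ξ + dot3 x ξ : ℝ) : ℂ)) * (Θ (sg ξ) : ℂ) =
            Complex.exp (Complex.I * (dot3 x ξ : ℂ)) * g (sg ξ) := by
          simp only [hg]
          rw [← mul_assoc, ← Complex.exp_add]
          congr 2
          push_cast; ring
        change Complex.exp (Complex.I * ((t * sg ξ + dot3 x ξ : ℝ) : ℂ)) * (Θ (sg ξ) : ℂ) = _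
        rw [e1, hpt, mul_neg, intervalIntegral.integral_of_le hab, ← integral_const_mul]
        congr 2
        ext u
        simp only [hH, Set.indicator, Set.mem_Ioi, Set.mem_ofPred_eq]
        split_ifs <;> ring
    _ = -∫ u in Set.Ioc ua ub, ∫ ξ : E3, H (ξ, u) := by rw [integral_neg, hswap]
    _ = _ := by
        rw [intervalIntegral.integral_of_le hab]
        congr 1
        refine setIntegral_congr_fun measurableSet_Ioc fun u hu => ?_
        simp only
        rw [← integral_sublevel_halfSum hc (hca.trans hu.1), ← integral_const_mul]
        congr 1
        ext ξ
        simp only [hH, Set.indicator, Set.mem_ofPred_eq]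
        change _ = g' u * (if sg ξ < u then _ else _)
        split_ifs <;> simp

section Shell

variable {c β U : ℝ}

lemma shell_mem (hc : 0 < c) (hβ : 0 < β) (hU : 0 < U) (hUc : U ^ 2 = c ^ 2 + β) {u : ℝ}
    (hu : u ∈ Set.Icc (√(c ^ 2 + β / 2)) (√(c ^ 2 + 5 * β))) :
    U / 2 ≤ u ∧ u ≤ 3 * U ∧ β / 2 ≤ u ^ 2 - c ^ 2 ∧ u ^ 2 - c ^ 2 ≤ 5 * β ∧ c < u := by
  have h0 : 0 ≤ u := (Real.sqrt_nonneg _).trans hu.1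
  have h1 := (Real.sqrt_le_left h0).1 hu.1
  have h2 := (Real.le_sqrt h0 (by positivity)).1 hu.2
  refine ⟨?_, ?_, by linarith, by linarith, ?_⟩
  · nlinarith
  · nlinarith
  · nlinarith

lemma shell_length (hc : 0 < c) (hβ : 0 < β) (hU : 0 < U) (hUc : U ^ 2 = c ^ 2 + β) :
    √(c ^ 2 + 5 * β) - √(c ^ 2 + β / 2) ≤ 5 * (β / U) := by
  have h1 := Real.sq_sqrt (show 0 ≤ c ^ 2 + 5 * β by positivity)
  have h2 := Real.sq_sqrt (show 0 ≤ c ^ 2 + β / 2 by positivity)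
  have h3 : U ≤ √(c ^ 2 + 5 * β) := Real.le_sqrt_of_sq_le (by linarith)
  have h4 := Real.sqrt_nonneg (c ^ 2 + β / 2)
  have h5 : √(c ^ 2 + β / 2) ≤ √(c ^ 2 + 5 * β) := Real.sqrt_le_sqrt (by linarith)
  rw [← mul_div_assoc, le_div_iff₀ hU]
  nlinarith

lemma isSymbol_shell_quadratic {a e : ℝ} (hc : 0 < c) (hβ : 0 < β) (hU : 0 < U)
    (hUc : U ^ 2 = c ^ 2 + β) (ha : 0 ≤ a) (he : 0 ≤ e) (n : ℕ) :
    IsSymbol (Set.Icc (√(c ^ 2 + β / 2)) (√(c ^ 2 + 5 * β))) ∅ (β / U) n (20 * (a * β + e))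
      (fun u => a * (u ^ 2 - c ^ 2) + e) := by
  have hb : ∀ u ∈ Set.Icc (√(c ^ 2 + β / 2)) (√(c ^ 2 + 5 * β)),
      |a * (u ^ 2 - c ^ 2) + e| ≤ 20 * (a * β + e) := fun u hu => by
    obtain ⟨-, -, h3, h4, -⟩ := shell_mem hc hβ hU hUc hu
    have h5 := mul_le_mul_of_nonneg_left h4 ha
    have h6 := mul_nonneg ha hβ.le
    have h7 := mul_nonneg ha (show 0 ≤ u ^ 2 - c ^ 2 by linarith)
    rw [abs_of_nonneg (by positivity)]
    linarith
  have hℓ : 0 < β / U := by positivity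
  have hℓU : β / U ≤ 3 * U := by
    rw [div_le_iff₀ hU]; nlinarith
  cases n with
  | zero => exact ⟨by fun_prop, hb, by simp⟩
  | succ n =>
    refine ⟨hb, by simp, fun u => (2 * a) * u, fun u _ => ?_, ?_⟩
    · have := ((((hasDerivAt_id u).pow 2).sub_const (c ^ 2)).const_mul a).add_const e
      refine this.congr_deriv ?_
      simp; ring
    · refine IsSymbol.mono hℓ (IsSymbol.const_mul (2 * a) (IsSymbol.id (α := 3 * U) hℓ (fun u hu => ?_) hℓU)) ?_
      · obtain ⟨h1, h2, -⟩ := shell_mem hc hβ hU hUc hu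
        rw [abs_of_nonneg (by linarith)]; exact h2
      · rw [abs_of_nonneg (by positivity), le_div_iff₀ hℓ]
        have : 2 * a * (3 * U) * (β / U) = 6 * (a * β) := by field_simp; ring
        rw [this]
        have := mul_nonneg ha hβ.le
        linarith

lemma isSymbol_shell_id (hc : 0 < c) (hβ : 0 < β) (hU : 0 < U)
    (hUc : U ^ 2 = c ^ 2 + β) (n : ℕ) :
    IsSymbol (Set.Icc (√(c ^ 2 + β / 2)) (√(c ^ 2 + 5 * β))) ∅ (β / U) n (3 * U) (fun u => u) := by
  have hℓ : 0 < β / U := by positivity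
  refine IsSymbol.id hℓ (fun u hu => ?_) ?_
  · obtain ⟨h1, h2, -⟩ := shell_mem hc hβ hU hUc hu
    rw [abs_of_nonneg (by linarith)]; exact h2
  · rw [div_le_iff₀ hU]; nlinarith

lemma shell_nonempty (hβ : 0 < β) : (Set.Icc (√(c ^ 2 + β / 2)) (√(c ^ 2 + 5 * β))).Nonempty :=
  Set.nonempty_Icc.2 (Real.sqrt_le_sqrt (by linarith))

/-- Symbol bounds for the radial phase `Q` and its inverse on a shell. -/
lemma isSymbol_shell_phase (n : ℕ) : ∃ C > 0, ∀ c β U a e m : ℝ, 0 < c → 0 < β → 0 < U →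
    U ^ 2 = c ^ 2 + β → 0 ≤ a → 0 ≤ e → 0 < m → m ^ 2 = a * β + e →
    IsSymbol (Set.Icc (√(c ^ 2 + β / 2)) (√(c ^ 2 + 5 * β))) ∅ (β / U) n (C * m⁻¹)
      (fun u => (√(a * (u ^ 2 - c ^ 2) + e))⁻¹) ∧
    ∀ u ∈ Set.Icc (√(c ^ 2 + β / 2)) (√(c ^ 2 + 5 * β)),
      m / 2 ≤ √(a * (u ^ 2 - c ^ 2) + e) ∧ √(a * (u ^ 2 - c ^ 2) + e) ≤ 3 * m := by
  obtain ⟨C1, hC1, H1⟩ := IsSymbol.sqrt n 80 (by norm_num)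
  obtain ⟨C2, hC2, H2⟩ := IsSymbol.inv n C1
  refine ⟨C2 * 2, by positivity, fun c β U a e m hc hβ hU hUc ha he hm hme => ?_⟩
  have hℓ : 0 < β / U := by positivity
  have hlow : ∀ u ∈ Set.Icc (√(c ^ 2 + β / 2)) (√(c ^ 2 + 5 * β)),
      (m / 2) ^ 2 ≤ a * (u ^ 2 - c ^ 2) + e := fun u hu => by
    obtain ⟨-, -, h3, h4, -⟩ := shell_mem hc hβ hU hUc hu
    have h5 := mul_le_mul_of_nonneg_left h3 ha
    nlinarith [mul_nonneg ha hβ.le]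
  have hlow' : ∀ u ∈ Set.Icc (√(c ^ 2 + β / 2)) (√(c ^ 2 + 5 * β)),
      m / 2 ≤ √(a * (u ^ 2 - c ^ 2) + e) := fun u hu => Real.le_sqrt_of_sq_le (hlow u hu)
  have h1 := H1 _ (β / U) (m / 2) _ (shell_nonempty hβ) hℓ (by positivity) hlow
    (IsSymbol.mono hℓ (isSymbol_shell_quadratic hc hβ hU hUc ha he n) (by rw [← hme]; apply le_of_eq; ring))
  have h2 := H2 _ (β / U) (m / 2) _ (shell_nonempty hβ) hℓ (by positivity) hlow' h1
  refine ⟨IsSymbol.mono hℓ h2 (le_of_eq (by field_simp)), fun u hu => ⟨hlow' u hu, ?_⟩⟩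
  obtain ⟨-, -, h3, h4, -⟩ := shell_mem hc hβ hU hUc hu
  rw [Real.sqrt_le_left (by positivity)]
  have h5 := mul_le_mul_of_nonneg_left h4 ha
  nlinarith [mul_nonneg ha hβ.le]

/-- Symbol bounds for the cutoff in the shell variable and its derivative. -/
lemma isSymbol_shell_cutoff (n : ℕ) {θ : ℝ → ℝ} (hθ : ContDiff ℝ (⊤ : ℕ∞) θ)
    (h1 : ∀ y, y < 1 → -1 < y → θ y = 0) (h4 : ∀ y, 4 < y → θ y = 0) (hcs : HasCompactSupport θ) :
    ∃ C > 0, ∀ c β U : ℝ, 0 < c → 0 < β → 0 < U → U ^ 2 = c ^ 2 + β →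
    IsSymbol (Set.Icc (√(c ^ 2 + β / 2)) (√(c ^ 2 + 5 * β)))
      {√(c ^ 2 + β / 2), √(c ^ 2 + 5 * β)} (β / U) n C (fun u => θ ((u ^ 2 - c ^ 2) / β)) ∧
    IsSymbol (Set.Icc (√(c ^ 2 + β / 2)) (√(c ^ 2 + 5 * β)))
      {√(c ^ 2 + β / 2), √(c ^ 2 + 5 * β)} (β / U) n (C * (β / U)⁻¹)
        (fun u => deriv θ ((u ^ 2 - c ^ 2) / β) * (2 * u / β)) := by
  obtain ⟨C1, hC1, H1⟩ := IsSymbol.comp n 20 θ hθ hcs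
  obtain ⟨C2, hC2, H2⟩ := IsSymbol.comp n 20 (deriv θ) (by
    have := (contDiff_infty_iff_deriv.1 hθ).2
    exact this) hcs.deriv
  refine ⟨C1 + 2 ^ n * (C2 * 6), by positivity, fun c β U hc hβ hU hUc => ?_⟩
  have hℓ : 0 < β / U := by positivity
  have hz : ∀ x ∈ ({√(c ^ 2 + β / 2), √(c ^ 2 + 5 * β)} : Set ℝ),
      θ =ᶠ[nhds ((x ^ 2 - c ^ 2) / β)] 0 := fun x hx => by
    simp only [Set.mem_insert_iff, Set.mem_singleton_iff] at hx
    rcases hx with rfl | rfl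
    · rw [Real.sq_sqrt (by positivity), add_sub_cancel_left,
        show β / 2 / β = 1 / 2 by field_simp]
      filter_upwards [Ioo_mem_nhds (show (-1 : ℝ) < 1 / 2 by norm_num) (show (1 / 2 : ℝ) < 1 by norm_num)]
        with y hy using h1 y hy.2 hy.1
    · rw [Real.sq_sqrt (by positivity), add_sub_cancel_left,
        show 5 * β / β = 5 by field_simp]
      filter_upwards [Ioi_mem_nhds (show (4 : ℝ) < 5 by norm_num)] with y hy using h4 y hy
  have hf : IsSymbol (Set.Icc (√(c ^ 2 + β / 2)) (√(c ^ 2 + 5 * β))) ∅ (β / U) n 20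
      (fun u => (u ^ 2 - c ^ 2) / β) := by
    have := isSymbol_shell_quadratic (a := β⁻¹) (e := 0) hc hβ hU hUc (by positivity) le_rfl n
    rw [inv_mul_cancel₀ hβ.ne', add_zero, mul_one] at this
    have e : (fun u => β⁻¹ * (u ^ 2 - c ^ 2) + 0) = fun u => (u ^ 2 - c ^ 2) / β := by
      ext u; ring
    rwa [e] at this
  refine ⟨IsSymbol.mono hℓ (H1 _ _ _ _ (shell_nonempty hβ) hℓ hz hf) (le_add_of_nonneg_right (by positivity)), ?_⟩
  have k1 := H2 _ {√(c ^ 2 + β / 2), √(c ^ 2 + 5 * β)} _ _ (shell_nonempty hβ) hℓ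
    (fun x hx => by
      have := (hz x hx).deriv
      simpa using this) hf
  have k2 := IsSymbol.const_mul (2 / β) (isSymbol_shell_id hc hβ hU hUc n)
  have k3 := IsSymbol.mul (shell_nonempty hβ) k1 k2
  have e : (fun u => deriv θ ((u ^ 2 - c ^ 2) / β) * (2 / β * u)) =
      fun u => deriv θ ((u ^ 2 - c ^ 2) / β) * (2 * u / β) := by
    ext u; ring
  rw [e] at k3
  refine IsSymbol.mono hℓ k3 ?_
  rw [abs_of_pos (by positivity), inv_div, add_mul]
  have : 2 ^ n * (C2 * (2 / β * (3 * U))) = 2 ^ n * (C2 * 6) * (U / β) := by field_simp; ring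
  rw [this]
  exact le_add_of_nonneg_left (by positivity)

end Shell

lemma hasDerivAt_cexp_I_mul_const (Q z : ℝ) :
    HasDerivAt (fun z : ℝ => Complex.exp (Complex.I * ((Q * z : ℝ) : ℂ)))
      (Complex.exp (Complex.I * ((Q * z : ℝ) : ℂ)) * (Complex.I * Q)) z := by
  have := hasDerivAt_cexp_I_mul (P := fun z => Q * z) ((hasDerivAt_id z).const_mul Q)
  simpa using this

lemma ballFT_eq {Q : ℝ} (hQ : Q ≠ 0) :
    ballFT Q = Complex.exp (Complex.I * (Q : ℂ)) *
        (-(2 * Real.pi) * (((Q⁻¹) ^ 2 : ℝ) : ℂ) - 2 * Real.pi * Complex.I * (((Q⁻¹) ^ 3 : ℝ) : ℂ)) +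
      Complex.exp (Complex.I * ((-Q : ℝ) : ℂ)) *
        (-(2 * Real.pi) * (((Q⁻¹) ^ 2 : ℝ) : ℂ) + 2 * Real.pi * Complex.I * (((Q⁻¹) ^ 3 : ℝ) : ℂ)) := by
  have hQ' : (Q : ℂ) ≠ 0 := by exact_mod_cast hQ
  have hI := Complex.I_sq
  set F : ℝ → ℂ := fun z => Complex.exp (Complex.I * ((Q * z : ℝ) : ℂ)) *
    (-Complex.I * Real.pi * (1 - z ^ 2) / Q - 2 * Real.pi * z / Q ^ 2 - 2 * Real.pi * Complex.I / Q ^ 3) with hF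
  have hd : ∀ z : ℝ, HasDerivAt F (Complex.exp (Complex.I * ((Q * z : ℝ) : ℂ)) *
      ((Real.pi * (1 - z ^ 2) : ℝ) : ℂ)) z := fun z => by
    have h1 := hasDerivAt_cexp_I_mul_const Q z
    have h2 : HasDerivAt (fun z : ℝ => -Complex.I * Real.pi * (1 - (z : ℂ) ^ 2) / Q -
        2 * Real.pi * z / Q ^ 2 - 2 * Real.pi * Complex.I / Q ^ 3)
        (-Complex.I * Real.pi * (-(2 * z)) / Q - 2 * Real.pi / Q ^ 2) z := by
      have hz : HasDerivAt (fun z : ℝ => (z : ℂ)) 1 z := Complex.ofRealCLM.hasDerivAt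
      have a1 := ((((hz.pow 2).const_sub 1).const_mul (-Complex.I * Real.pi)).div_const (Q : ℂ)).sub
        ((hz.const_mul (2 * (Real.pi : ℂ))).div_const ((Q : ℂ) ^ 2))
      refine (a1.sub_const (2 * Real.pi * Complex.I / (Q : ℂ) ^ 3)).congr_deriv ?_
      simp
    refine (h1.mul h2).congr_deriv ?_
    push_cast
    field_simp
    linear_combination (-((Q : ℂ) ^ 2 * (1 - (z : ℂ) ^ 2)) - 2) * hI
  have hcont : Continuous fun z : ℝ => Complex.exp (Complex.I * ((Q * z : ℝ) : ℂ)) *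
      ((Real.pi * (1 - z ^ 2) : ℝ) : ℂ) := by fun_prop
  rw [ballFT, intervalIntegral.integral_eq_sub_of_hasDerivAt (fun z _ => hd z)
    (hcont.intervalIntegrable _ _)]
  simp only [hF]
  push_cast
  rw [mul_neg_one, mul_one]
  field_simp
  ring

section Amplitude

/-- The two real amplitudes of the shell integrand, arising from differentiating the oscillating
factor and the cutoff. -/
def shellAmp₁ (θ : ℝ → ℝ) (c β t u : ℝ) : ℝ := t * (θ ((u ^ 2 - c ^ 2) / β) * (u * (u ^ 2 - c ^ 2)))

/-- See `shellAmp₁`. -/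
def shellAmp₂ (θ : ℝ → ℝ) (c β u : ℝ) : ℝ :=
  deriv θ ((u ^ 2 - c ^ 2) / β) * (2 * u / β) * (u * (u ^ 2 - c ^ 2))

/-- A profile suitable for localising to a dyadic shell. -/
structure IsShellCutoff (θ : ℝ → ℝ) : Prop where
  contDiff : ContDiff ℝ (⊤ : ℕ∞) θ
  zero_of_lt : ∀ y, y < 1 → -1 < y → θ y = 0
  zero_of_gt : ∀ y, 4 < y → θ y = 0
  hasCompactSupport : HasCompactSupport θ

variable {θ : ℝ → ℝ}

lemma isSymbol_shellAmp (hθ : IsShellCutoff θ) (n : ℕ) : ∃ C > 0, ∀ c β U t : ℝ, 0 < c → 0 < β → 0 < U →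
    U ^ 2 = c ^ 2 + β → 0 < t → 1 / 4 ≤ t * (β / U) →
    IsSymbol (Set.Icc (√(c ^ 2 + β / 2)) (√(c ^ 2 + 5 * β)))
      {√(c ^ 2 + β / 2), √(c ^ 2 + 5 * β)} (β / U) n (C * (t * U * β)) (shellAmp₁ θ c β t) ∧
    IsSymbol (Set.Icc (√(c ^ 2 + β / 2)) (√(c ^ 2 + 5 * β)))
      {√(c ^ 2 + β / 2), √(c ^ 2 + 5 * β)} (β / U) n (C * (t * U * β)) (shellAmp₂ θ c β) := by
  obtain ⟨C, hC, H⟩ := isSymbol_shell_cutoff n hθ.contDiff hθ.zero_of_lt hθ.zero_of_gt hθ.hasCompactSupport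
  refine ⟨2 ^ n * 2 ^ n * (C * 240), by positivity, fun c β U t hc hβ hU hUc ht hT => ?_⟩
  have hℓ : 0 < β / U := by positivity
  obtain ⟨h1, h2⟩ := H c β U hc hβ hU hUc
  have h3 := isSymbol_shell_quadratic (a := 1) (e := 0) hc hβ hU hUc zero_le_one le_rfl n
  have h4 := IsSymbol.mul (shell_nonempty hβ) (isSymbol_shell_id hc hβ hU hUc n) h3
  have e : (fun u => u * (1 * (u ^ 2 - c ^ 2) + 0)) = fun u => u * (u ^ 2 - c ^ 2) := by ext u; ring
  rw [e] at h4
  constructor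
  · refine IsSymbol.mono hℓ (IsSymbol.const_mul t (IsSymbol.mul (shell_nonempty hβ) h1 h4)) ?_
    rw [abs_of_pos ht]
    have : 0 < C * (t * U * β) * 2 ^ n * 2 ^ n := by positivity
    nlinarith
  · refine IsSymbol.mono hℓ (IsSymbol.mul (shell_nonempty hβ) h2 h4) ?_
    have h5 : (β / U)⁻¹ ≤ 4 * t := by
      rw [inv_le_iff_one_le_mul₀ hℓ]; linarith
    calc 2 ^ n * (C * (β / U)⁻¹ * (2 ^ n * (3 * U * (20 * (1 * β + 0)))))
        = 2 ^ n * 2 ^ n * C * 60 * U * β * (β / U)⁻¹ := by ring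
      _ ≤ 2 ^ n * 2 ^ n * C * 60 * U * β * (4 * t) := by gcongr
      _ = _ := by ring

end Amplitude

lemma intervalIntegral_swap {a b a' b' : ℝ} (hab : a ≤ b) (hab' : a' ≤ b') {f : ℝ → ℝ → ℂ}
    (hf : Continuous (Function.uncurry f)) :
    ∫ x in a..b, ∫ y in a'..b', f x y = ∫ y in a'..b', ∫ x in a..b, f x y := by
  simp only [intervalIntegral.integral_of_le hab, intervalIntegral.integral_of_le hab']
  refine integral_integral_swap ?_
  rw [Measure.prod_restrict, ← Measure.volume_eq_prod]
  exact (hf.continuousOn.integrableOn_compact (isCompact_Icc.prod isCompact_Icc)).mono_set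
    (Set.prod_mono Set.Ioc_subset_Icc_self Set.Ioc_subset_Icc_self)

lemma hasDerivAt_shell_phase {a e c u : ℝ} (h : 0 < √(a * (u ^ 2 - c ^ 2) + e)) :
    HasDerivAt (fun u => √(a * (u ^ 2 - c ^ 2) + e)) (a * (u * (√(a * (u ^ 2 - c ^ 2) + e))⁻¹)) u := by
  have h1 : HasDerivAt (fun u => a * (u ^ 2 - c ^ 2) + e) (a * (2 * u)) u := by
    refine (((((hasDerivAt_id u).pow 2).sub_const (c ^ 2)).const_mul a).add_const e).congr_deriv ?_
    simp
  refine (h1.sqrt (Real.sqrt_pos.1 h).ne').congr_deriv ?_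
  field_simp

lemma hasDerivAt_shell_phase_deriv {a e c u : ℝ} (h : 0 < √(a * (u ^ 2 - c ^ 2) + e)) :
    HasDerivAt (fun u => a * (u * (√(a * (u ^ 2 - c ^ 2) + e))⁻¹))
      (-(a * (a * c ^ 2 - e)) * (√(a * (u ^ 2 - c ^ 2) + e))⁻¹ ^ 3) u := by
  have h1 := (((hasDerivAt_id u).mul ((hasDerivAt_shell_phase h).inv h.ne')).const_mul a)
  refine h1.congr_deriv ?_
  have h2 := Real.sq_sqrt (Real.sqrt_pos.1 h).le
  set Q := √(a * (u ^ 2 - c ^ 2) + e) with hQ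
  simp only [id, Pi.inv_apply, ← hQ]
  field_simp
  linear_combination a * h2

/-- The derivative of the radial phase on a shell. -/
lemma exists_shell_phase_deriv (n : ℕ) : ∃ C > 0, ∀ c β U b a e : ℝ, 0 < c → 0 < β → 0 < U →
    U ^ 2 = c ^ 2 + β → 0 < b → b ^ 2 = β → 0 ≤ a → 0 ≤ e → ∃ q : ℝ → ℝ,
    (∀ u ∈ Set.Icc (√(c ^ 2 + β / 2)) (√(c ^ 2 + 5 * β)),
      HasDerivAt (fun u => √(a * (u ^ 2 - c ^ 2) + e)) (q u) u) ∧
    (∀ u ∈ Set.Icc (√(c ^ 2 + β / 2)) (√(c ^ 2 + 5 * β)), |q u| ≤ 6 * (√a * U / b)) ∧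
    IsSymbol (Set.Icc (√(c ^ 2 + β / 2)) (√(c ^ 2 + 5 * β))) ∅ (β / U) n (C * (√a * U / b)) q := by
  obtain ⟨C, hC, H⟩ := isSymbol_shell_phase n
  refine ⟨2 ^ n * C * 3, by positivity, fun c β U b a e hc hβ hU hUc hb hbβ ha he => ?_⟩
  have hℓ : 0 < β / U := by positivity
  rcases ha.eq_or_lt with rfl | ha
  · refine ⟨fun _ => 0, fun u _ => ?_, fun u _ => by simp, ?_⟩
    · simpa using hasDerivAt_const u (√e)
    · refine (IsSymbol.const hℓ 0).mono hℓ ?_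
      simp
  have hm : 0 < √(a * β + e) := Real.sqrt_pos.2 (by positivity)
  have hme := Real.sq_sqrt (show 0 ≤ a * β + e by positivity)
  set m := √(a * β + e) with hmdef
  have hmb : √a * b ≤ m := Real.le_sqrt_of_sq_le (by
    rw [mul_pow, Real.sq_sqrt ha.le, hbβ]; linarith)
  obtain ⟨h1, h2⟩ := H c β U a e m hc hβ hU hUc ha.le he hm hme
  have hsa := Real.sq_sqrt ha.le
  have hsa' := Real.sqrt_pos.2 ha
  have key : a * (U * m⁻¹) ≤ √a * U / b := by
    rw [le_div_iff₀ hb]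
    calc a * (U * m⁻¹) * b = √a * U * (√a * b * m⁻¹) := by nth_rewrite 1 [← hsa]; ring
      _ ≤ √a * U * 1 := by
          gcongr
          rw [← div_eq_mul_inv, div_le_one hm]; exact hmb
      _ = _ := by ring
  refine ⟨fun u => a * (u * (√(a * (u ^ 2 - c ^ 2) + e))⁻¹), fun u hu => ?_, fun u hu => ?_, ?_⟩
  · exact hasDerivAt_shell_phase ((half_pos hm).trans_le (h2 u hu).1)
  · obtain ⟨k1, k2, -⟩ := shell_mem hc hβ hU hUc hu
    have hQ := (half_pos hm).trans_le (h2 u hu).1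
    have hu0 : 0 < u := by linarith
    rw [abs_of_pos (by positivity)]
    calc a * (u * (√(a * (u ^ 2 - c ^ 2) + e))⁻¹) ≤ a * ((3 * U) * (m / 2)⁻¹) := by
          gcongr; exact (h2 u hu).1
      _ = 6 * (a * (U * m⁻¹)) := by field_simp; ring
      _ ≤ _ := by gcongr
  · refine IsSymbol.mono hℓ (IsSymbol.const_mul a (IsSymbol.mul (shell_nonempty hβ)
      (isSymbol_shell_id hc hβ hU hUc n) h1)) ?_
    rw [abs_of_pos ha]
    calc a * (2 ^ n * (3 * U * (C * m⁻¹))) = 2 ^ n * C * 3 * (a * (U * m⁻¹)) := by ring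
      _ ≤ _ := by gcongr

lemma continuous_shellAmp₁ {θ : ℝ → ℝ} (hθ : IsShellCutoff θ) (c β t : ℝ) :
    Continuous (shellAmp₁ θ c β t) := by
  have := hθ.contDiff.continuous
  unfold shellAmp₁; fun_prop

lemma continuous_shellAmp₂ {θ : ℝ → ℝ} (hθ : IsShellCutoff θ) (c β : ℝ) :
    Continuous (shellAmp₂ θ c β) := by
  have := (contDiff_infty_iff_deriv.1 hθ.contDiff).2.continuous
  unfold shellAmp₂; fun_prop

/-- Non-stationary regime for the shell integral. -/
theorem norm_shell_integral_near {θ : ℝ → ℝ} (hθ : IsShellCutoff θ) : ∃ C > 0, ∀ c β U b t a e : ℝ,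
    0 < c → 0 < β → 0 < U → U ^ 2 = c ^ 2 + β → 0 < b → b ^ 2 = β → 0 ≤ a → 0 ≤ e → 0 < t →
    1 / 4 ≤ t * (β / U) → √a * U / b ≤ t / 12 →
    ‖∫ u in (√(c ^ 2 + β / 2))..(√(c ^ 2 + 5 * β)), Complex.exp (Complex.I * ((t * u : ℝ) : ℂ)) *
      (Complex.I * shellAmp₁ θ c β t u + shellAmp₂ θ c β u) *
        ballFT (√(a * (u ^ 2 - c ^ 2) + e))‖ ≤ C * (U * β) * ((t * (β / U)) ^ 2)⁻¹ := by
  obtain ⟨C1, hC1, H1⟩ := exists_shell_phase_deriv 3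
  obtain ⟨C2, hC2, H2⟩ := isSymbol_shellAmp hθ 3
  obtain ⟨C3, hC3, H3⟩ := norm_integral_nonstationary_le 3 (5 + 2 * (1 + C1))
  refine ⟨2 * (Real.pi * (2 * (C3 * C2 * 8))), by positivity, fun c β U b t a e hc hβ hU hUc hb hbβ ha he ht hT hat => ?_⟩
  have hℓ : 0 < β / U := by positivity
  set ua := √(c ^ 2 + β / 2) with hua
  set ub := √(c ^ 2 + 5 * β) with hub
  have hab : ua ≤ ub := Real.sqrt_le_sqrt (by linarith)
  obtain ⟨q, hq1, hq2, hq3⟩ := H1 c β U b a e hc hβ hU hUc hb hbβ ha he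
  obtain ⟨hA1, hA2⟩ := H2 c β U t hc hβ hU hUc ht hT
  have hcA1 := continuous_shellAmp₁ hθ c β t
  have hcA2 := continuous_shellAmp₂ hθ c β
  set A₁ := shellAmp₁ θ c β t
  set A₂ := shellAmp₂ θ c β
  set Q : ℝ → ℝ := fun u => √(a * (u ^ 2 - c ^ 2) + e) with hQ
  have hQc : Continuous Q := by fun_prop
  have inner : ∀ z ∈ Set.Icc (-1 : ℝ) 1, ∀ A : ℝ → ℝ,
      IsSymbol (Set.Icc ua ub) {ua, ub} (β / U) 3 (C2 * (t * U * β)) A →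
      ‖∫ u in ua..ub, Complex.exp (Complex.I * ((t * u + z * Q u : ℝ) : ℂ)) * (A u : ℂ)‖ ≤
        C3 * C2 * 8 * ((U * β) * ((t * (β / U)) ^ 2)⁻¹) := fun z hz A hA => by
    have hz' : |z| ≤ 1 := abs_le.2 hz
    refine (H3 ua ub (β / U) (t / 2) _ (fun u => t * u + z * Q u) (fun u => t + z * q u) A hab ?_ hℓ
      (by positivity) (fun u hu => ?_) ?_ (fun u hu => ?_) hA).trans (le_of_eq ?_)
    · refine (shell_length hc hβ hU hUc).trans ?_
      gcongr; linarith
    · refine (((hasDerivAt_id u).const_mul t).add ((hq1 u hu).const_mul z)).congr_deriv ?_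
      simp
    · refine IsSymbol.mono hℓ (IsSymbol.add (IsSymbol.const hℓ t) (IsSymbol.const_mul z hq3)) ?_
      rw [abs_of_pos ht]
      have : |z| * (C1 * (√a * U / b)) ≤ 1 * (C1 * (t / 12)) := by gcongr
      nlinarith
    · have h1 : |z * q u| ≤ 1 * (6 * (t / 12)) := by
        rw [abs_mul]
        exact mul_le_mul hz' ((hq2 u hu).trans (by gcongr)) (abs_nonneg _) zero_le_one
      have := (abs_le.1 h1).1
      linarith
    · field_simp; ring
  have e1 : ∀ u, Complex.exp (Complex.I * ((t * u : ℝ) : ℂ)) * (Complex.I * A₁ u + A₂ u) * ballFT (Q u) =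
      ∫ z in (-1 : ℝ)..1, Complex.exp (Complex.I * ((t * u + z * Q u : ℝ) : ℂ)) *
        (Complex.I * A₁ u + A₂ u) * ((Real.pi * (1 - z ^ 2) : ℝ) : ℂ) := fun u => by
    rw [ballFT, ← intervalIntegral.integral_const_mul]
    refine intervalIntegral.integral_congr fun z _ => ?_
    rw [show Complex.exp (Complex.I * ((t * u + z * Q u : ℝ) : ℂ)) =
      Complex.exp (Complex.I * ((t * u : ℝ) : ℂ)) * Complex.exp (Complex.I * ((Q u * z : ℝ) : ℂ)) by
        rw [← Complex.exp_add]; congr 1; push_cast; ring]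
    ring
  refine (congrArg norm (intervalIntegral.integral_congr fun u _ => e1 u)).trans_le ?_
  rw [intervalIntegral_swap hab (by norm_num) (by
    unfold Function.uncurry
    have : Continuous fun p : ℝ × ℝ => ((A₁ p.1 : ℝ) : ℂ) := by fun_prop
    have : Continuous fun p : ℝ × ℝ => ((A₂ p.1 : ℝ) : ℂ) := by fun_prop
    fun_prop)]
  have bound : ∀ z ∈ Set.uIoc (-1 : ℝ) 1, ‖∫ u in ua..ub, Complex.exp (Complex.I * ((t * u + z * Q u : ℝ) : ℂ)) *
        (Complex.I * A₁ u + A₂ u) * ((Real.pi * (1 - z ^ 2) : ℝ) : ℂ)‖ ≤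
        Real.pi * (2 * (C3 * C2 * 8 * ((U * β) * ((t * (β / U)) ^ 2)⁻¹))) := fun z hz => by
    rw [Set.uIoc_of_le (by norm_num)] at hz
    have hz' : z ∈ Set.Icc (-1 : ℝ) 1 := ⟨hz.1.le, hz.2⟩
    rw [intervalIntegral.integral_mul_const, norm_mul, mul_comm]
    have hc1 : Continuous fun u : ℝ => Complex.exp (Complex.I * ((t * u + z * Q u : ℝ) : ℂ)) * (A₁ u : ℂ) := by
      fun_prop
    have hc2 : Continuous fun u : ℝ => Complex.exp (Complex.I * ((t * u + z * Q u : ℝ) : ℂ)) * (A₂ u : ℂ) := by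
      fun_prop
    have e2 : ∫ u in ua..ub, Complex.exp (Complex.I * ((t * u + z * Q u : ℝ) : ℂ)) *
        (Complex.I * A₁ u + A₂ u) = Complex.I * (∫ u in ua..ub,
          Complex.exp (Complex.I * ((t * u + z * Q u : ℝ) : ℂ)) * (A₁ u : ℂ)) + ∫ u in ua..ub,
          Complex.exp (Complex.I * ((t * u + z * Q u : ℝ) : ℂ)) * (A₂ u : ℂ) := by
      have hc1' : Continuous fun u : ℝ => Complex.I *
          (Complex.exp (Complex.I * ((t * u + z * Q u : ℝ) : ℂ)) * (A₁ u : ℂ)) :=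
        continuous_const.mul hc1
      rw [← intervalIntegral.integral_const_mul, ← intervalIntegral.integral_add
        (hc1'.intervalIntegrable _ _) (hc2.intervalIntegrable _ _)]
      refine intervalIntegral.integral_congr fun u _ => ?_
      ring
    have n1 : ‖((Real.pi * (1 - z ^ 2) : ℝ) : ℂ)‖ ≤ Real.pi := by
      have : 0 ≤ 1 - z ^ 2 := by nlinarith [hz'.1, hz'.2]
      rw [Complex.norm_real, Real.norm_eq_abs, abs_of_nonneg (mul_nonneg Real.pi_pos.le this)]
      nlinarith [Real.pi_pos, sq_nonneg z]
    refine mul_le_mul n1 ?_ (norm_nonneg _) Real.pi_pos.le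
    rw [e2]
    refine (norm_add_le _ _).trans ?_
    rw [norm_mul, Complex.norm_I, one_mul]
    linarith [inner z hz' A₁ hA1, inner z hz' A₂ hA2]
  refine (intervalIntegral.norm_integral_le_of_norm_le_const bound).trans (le_of_eq ?_)
  norm_num
  ring

lemma norm_ballFT_le {Q : ℝ} (hQ : 0 < Q) :
    ‖ballFT Q‖ ≤ 4 * Real.pi * ((Q⁻¹) ^ 2 + (Q⁻¹) ^ 3) := by
  have hπ := Real.pi_pos
  have h2 : ‖(-(2 * Real.pi) : ℂ) * (((Q⁻¹) ^ 2 : ℝ) : ℂ)‖ = 2 * Real.pi * (Q⁻¹) ^ 2 := by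
    rw [norm_mul, norm_neg, norm_mul, Complex.norm_real, Complex.norm_real, Real.norm_eq_abs,
      Real.norm_eq_abs, abs_of_pos hπ, abs_of_nonneg (by positivity)]; simp
  have h3 : ‖(2 * Real.pi * Complex.I : ℂ) * (((Q⁻¹) ^ 3 : ℝ) : ℂ)‖ = 2 * Real.pi * (Q⁻¹) ^ 3 := by
    rw [norm_mul, norm_mul, norm_mul, Complex.norm_I, Complex.norm_real, Complex.norm_real, Real.norm_eq_abs,
      Real.norm_eq_abs, abs_of_pos hπ, abs_of_nonneg (by positivity)]; simp
  rw [ballFT_eq hQ.ne']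
  refine (norm_add_le _ _).trans ?_
  rw [norm_mul, norm_mul, norm_cexp_I_mul_ofReal, norm_cexp_I_mul_ofReal]
  have k1 := norm_sub_le ((-(2 * Real.pi) : ℂ) * (((Q⁻¹) ^ 2 : ℝ) : ℂ))
    ((2 * Real.pi * Complex.I : ℂ) * (((Q⁻¹) ^ 3 : ℝ) : ℂ))
  have k2 := norm_add_le ((-(2 * Real.pi) : ℂ) * (((Q⁻¹) ^ 2 : ℝ) : ℂ))
    ((2 * Real.pi * Complex.I : ℂ) * (((Q⁻¹) ^ 3 : ℝ) : ℂ))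
  rw [h2, h3] at k1 k2
  linarith

lemma norm_integral_mul_combination_le {a b X : ℝ} {E : ℝ → ℂ} {a₁ a₂ g₁ g₂ : ℝ → ℝ} (k₁ k₂ : ℂ)
    (h : ∀ A ∈ ({a₁, a₂} : Set (ℝ → ℝ)), ∀ G ∈ ({g₁, g₂} : Set (ℝ → ℝ)),
      IntervalIntegrable (fun u => E u * ((A u * G u : ℝ) : ℂ)) volume a b ∧
      ‖∫ u in a..b, E u * ((A u * G u : ℝ) : ℂ)‖ ≤ X) :
    ‖∫ u in a..b, E u * (Complex.I * a₁ u + a₂ u) * (k₁ * g₁ u + k₂ * g₂ u)‖ ≤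
      2 * (‖k₁‖ + ‖k₂‖) * X := by
  obtain ⟨i11, b11⟩ := h a₁ (by simp) g₁ (by simp)
  obtain ⟨i12, b12⟩ := h a₁ (by simp) g₂ (by simp)
  obtain ⟨i21, b21⟩ := h a₂ (by simp) g₁ (by simp)
  obtain ⟨i22, b22⟩ := h a₂ (by simp) g₂ (by simp)
  have e : ∫ u in a..b, E u * (Complex.I * a₁ u + a₂ u) * (k₁ * g₁ u + k₂ * g₂ u) =
      ((Complex.I * k₁ * ∫ u in a..b, E u * ((a₁ u * g₁ u : ℝ) : ℂ)) +
        Complex.I * k₂ * ∫ u in a..b, E u * ((a₁ u * g₂ u : ℝ) : ℂ)) +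
      ((k₁ * ∫ u in a..b, E u * ((a₂ u * g₁ u : ℝ) : ℂ)) +
        k₂ * ∫ u in a..b, E u * ((a₂ u * g₂ u : ℝ) : ℂ)) := by
    simp only [← intervalIntegral.integral_const_mul]
    rw [← intervalIntegral.integral_add (i11.const_mul _) (i12.const_mul _),
      ← intervalIntegral.integral_add (i21.const_mul _) (i22.const_mul _),
      ← intervalIntegral.integral_add ((i11.const_mul _).add (i12.const_mul _))
        ((i21.const_mul _).add (i22.const_mul _))]
    refine intervalIntegral.integral_congr fun u _ => ?_
    push_cast
    ring
  rw [e]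
  refine (norm_add_le _ _).trans ((add_le_add (norm_add_le _ _) (norm_add_le _ _)).trans ?_)
  simp only [norm_mul, Complex.norm_I, one_mul]
  have h1 := norm_nonneg k₁
  have h2 := norm_nonneg k₂
  have := mul_le_mul_of_nonneg_left b11 h1
  have := mul_le_mul_of_nonneg_left b12 h2
  have := mul_le_mul_of_nonneg_left b21 h1
  have := mul_le_mul_of_nonneg_left b22 h2
  linarith

/-- Size bound for the shell integral when the radial phase is large. -/
theorem norm_shell_integral_far_le {θ : ℝ → ℝ} (hθ : IsShellCutoff θ) : ∃ C > 0, ∀ c β U t a e m : ℝ,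
    0 < c → 0 < β → 0 < U → U ^ 2 = c ^ 2 + β → 0 ≤ a → 0 ≤ e → 0 < t →
    1 / 4 ≤ t * (β / U) → 0 < m → m ^ 2 = a * β + e → t * (β / U) ≤ 12 * m →
    ‖∫ u in (√(c ^ 2 + β / 2))..(√(c ^ 2 + 5 * β)), Complex.exp (Complex.I * ((t * u : ℝ) : ℂ)) *
      (Complex.I * shellAmp₁ θ c β t u + shellAmp₂ θ c β u) *
        ballFT (√(a * (u ^ 2 - c ^ 2) + e))‖ ≤ C * (U ^ 2 / t) := by
  obtain ⟨C2, hC2, H2⟩ := isSymbol_shellAmp hθ 0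
  obtain ⟨C1, hC1, H1⟩ := isSymbol_shell_phase 0
  refine ⟨2 * C2 * (4 * Real.pi * 97 * 576) * 5, by positivity, fun c β U t a e m hc hβ hU hUc ha he ht hT hm hme hTm => ?_⟩
  have hℓ : 0 < β / U := by positivity
  obtain ⟨hA1, hA2⟩ := H2 c β U t hc hβ hU hUc ht hT
  obtain ⟨-, hQ⟩ := H1 c β U a e m hc hβ hU hUc ha he hm hme
  have hab : √(c ^ 2 + β / 2) ≤ √(c ^ 2 + 5 * β) := Real.sqrt_le_sqrt (by linarith)
  have hT0 : 0 < t * (β / U) := by positivity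
  set T := t * (β / U) with hTdef
  have bound : ∀ u ∈ Set.uIoc (√(c ^ 2 + β / 2)) (√(c ^ 2 + 5 * β)),
      ‖Complex.exp (Complex.I * ((t * u : ℝ) : ℂ)) *
      (Complex.I * shellAmp₁ θ c β t u + shellAmp₂ θ c β u) *
        ballFT (√(a * (u ^ 2 - c ^ 2) + e))‖ ≤ 2 * C2 * (t * U * β) * (4 * Real.pi * 97 * 576 * (T⁻¹) ^ 2) := fun u hu => by
    rw [Set.uIoc_of_le hab] at hu
    have hu' := Set.Ioc_subset_Icc_self hu
    rw [norm_mul, norm_mul, norm_cexp_I_mul_ofReal, one_mul]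
    have hq := (hQ u hu').1
    set Q := √(a * (u ^ 2 - c ^ 2) + e)
    have hQT : T / 24 ≤ Q := by linarith
    have hQ0 : 0 < Q := by linarith
    have hQi : Q⁻¹ ≤ 24 * T⁻¹ := by
      rw [inv_le_iff_one_le_mul₀ hQ0]
      have : T⁻¹ * T = 1 := inv_mul_cancel₀ hT0.ne'
      have := mul_le_mul_of_nonneg_left hQT (inv_nonneg.2 hT0.le)
      nlinarith
    have hQ96 : Q⁻¹ ≤ 96 := by
      rw [inv_le_iff_one_le_mul₀ hQ0]; linarith
    have hQi0 : 0 < Q⁻¹ := inv_pos.2 hQ0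
    refine mul_le_mul ?_ ?_ (norm_nonneg _) (by positivity)
    · refine (norm_add_le _ _).trans ?_
      rw [norm_mul, Complex.norm_I, one_mul, Complex.norm_real, Complex.norm_real]
      have := hA1.bound u hu'
      have := hA2.bound u hu'
      simp only [Real.norm_eq_abs]
      linarith
    · refine (norm_ballFT_le hQ0).trans ?_
      have : (Q⁻¹) ^ 2 + (Q⁻¹) ^ 3 ≤ 97 * (Q⁻¹) ^ 2 := by nlinarith [pow_pos hQi0 2]
      calc 4 * Real.pi * ((Q⁻¹) ^ 2 + (Q⁻¹) ^ 3) ≤ 4 * Real.pi * (97 * (24 * T⁻¹) ^ 2) := by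
            gcongr; exact this.trans (by gcongr)
        _ = _ := by ring
  refine (intervalIntegral.norm_integral_le_of_norm_le_const bound).trans ?_
  rw [abs_of_nonneg (sub_nonneg.2 hab)]
  refine (mul_le_mul_of_nonneg_left (shell_length hc hβ hU hUc) (by positivity)).trans (le_of_eq ?_)
  rw [hTdef]
  field_simp

/-- Weighted bound for the shell integral when the radial phase is large, from the curvature of
the radial phase. -/
theorem norm_shell_integral_far_weighted_le {θ : ℝ → ℝ} (hθ : IsShellCutoff θ) :
    ∃ C > 0, ∀ c β U b t a e m w : ℝ,
    0 < c → 0 < β → 0 < U → U ^ 2 = c ^ 2 + β → 0 < b → b ^ 2 = β → 0 < a → 0 ≤ e → 0 < t →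
    1 / 4 ≤ t * (β / U) → 0 < m → m ^ 2 = a * β + e → t * (β / U) ≤ 12 * m →
    0 < w → w ^ 2 = a * c ^ 2 - e →
    w * ‖∫ u in (√(c ^ 2 + β / 2))..(√(c ^ 2 + 5 * β)), Complex.exp (Complex.I * ((t * u : ℝ) : ℂ)) *
      (Complex.I * shellAmp₁ θ c β t u + shellAmp₂ θ c β u) *
        ballFT (√(a * (u ^ 2 - c ^ 2) + e))‖ ≤ C * ((t * U * β) / (√a * √m)) := by
  obtain ⟨C2, hC2, H2⟩ := isSymbol_shellAmp hθ 1
  obtain ⟨C1, hC1, H1⟩ := isSymbol_shell_phase 1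
  set C3 := 2 * C1 ^ 2 + 192 * C1 ^ 3 with hC3
  have hC3p : 0 < C3 := by positivity
  refine ⟨2 * (2 * (2 * Real.pi + 2 * Real.pi) * (10 * 6 * (2 * (C2 * C3)) * √27)), by positivity,
    fun c β U b t a e m w hc hβ hU hUc hb hbβ ha he ht hT hm hme hTm hw hwe => ?_⟩
  have hℓ : 0 < β / U := by positivity
  obtain ⟨hA1, hA2⟩ := H2 c β U t hc hβ hU hUc ht hT
  obtain ⟨hQs, hQ⟩ := H1 c β U a e m hc hβ hU hUc ha.le he hm hme
  have hcA1 := continuous_shellAmp₁ hθ c β t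
  have hcA2 := continuous_shellAmp₂ hθ c β
  have hab : √(c ^ 2 + β / 2) ≤ √(c ^ 2 + 5 * β) := Real.sqrt_le_sqrt (by linarith)
  have hne := shell_nonempty (c := c) hβ
  have hlen := shell_length hc hβ hU hUc
  have hdP : ∀ u ∈ Set.Icc (√(c ^ 2 + β / 2)) (√(c ^ 2 + 5 * β)), _ := fun u hu =>
    hasDerivAt_shell_phase (a := a) (e := e) (c := c) (u := u) ((half_pos hm).trans_le (hQ u hu).1)
  have hdp : ∀ u ∈ Set.Icc (√(c ^ 2 + β / 2)) (√(c ^ 2 + 5 * β)), _ := fun u hu =>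
    hasDerivAt_shell_phase_deriv (a := a) (e := e) (c := c) (u := u) ((half_pos hm).trans_le (hQ u hu).1)
  set ua := √(c ^ 2 + β / 2) with hua
  set ub := √(c ^ 2 + 5 * β) with hub
  set A₁ := shellAmp₁ θ c β t
  set A₂ := shellAmp₂ θ c β
  set Q : ℝ → ℝ := fun u => √(a * (u ^ 2 - c ^ 2) + e) with hQdef
  have hQc : Continuous Q := by fun_prop
  have hQpos : ∀ u ∈ Set.Icc ua ub, 0 < Q u := fun u hu => (half_pos hm).trans_le (hQ u hu).1
  have hm48 : m⁻¹ ≤ 48 := by rw [inv_le_iff_one_le_mul₀ hm]; linarith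
  have hmi : 0 < m⁻¹ := inv_pos.2 hm
  have hG2 : IsSymbol (Set.Icc ua ub) ∅ (β / U) 1 (C3 * (m⁻¹) ^ 2) (fun u => (Q u)⁻¹ * (Q u)⁻¹) := by
    refine IsSymbol.mono hℓ (IsSymbol.mul hne hQs hQs) ?_
    calc 2 ^ 1 * (C1 * m⁻¹ * (C1 * m⁻¹)) = (2 * C1 ^ 2) * (m⁻¹) ^ 2 := by ring
      _ ≤ _ := by gcongr; rw [hC3]; exact le_add_of_nonneg_right (by positivity)
  have hG3 : IsSymbol (Set.Icc ua ub) ∅ (β / U) 1 (C3 * (m⁻¹) ^ 2)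
      (fun u => (Q u)⁻¹ * ((Q u)⁻¹ * (Q u)⁻¹)) := by
    refine IsSymbol.mono hℓ (IsSymbol.mul hne hQs (IsSymbol.mul hne hQs hQs)) ?_
    calc 2 ^ 1 * (C1 * m⁻¹ * (2 ^ 1 * (C1 * m⁻¹ * (C1 * m⁻¹)))) = (4 * C1 ^ 3) * m⁻¹ * (m⁻¹) ^ 2 := by ring
      _ ≤ (4 * C1 ^ 3) * 48 * (m⁻¹) ^ 2 := by gcongr
      _ ≤ _ := by
          gcongr
          have : 0 < C1 ^ 2 := by positivity
          rw [hC3]; linarith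
  set l := a * w ^ 2 / (27 * m ^ 3) with hl
  have hlpos : 0 < l := by positivity
  have hsl : w / √l ≤ √27 * m * √m / √a := by
    have : √l = √a * w / (√27 * m * √m) := by
      rw [hl, Real.sqrt_div (by positivity), Real.sqrt_mul ha.le, Real.sqrt_sq hw.le,
        Real.sqrt_mul (by norm_num), show m ^ 3 = m ^ 2 * m by ring, Real.sqrt_mul (by positivity),
        Real.sqrt_sq hm.le]
      ring
    rw [this]
    have := Real.sqrt_pos.2 ha
    have := Real.sqrt_pos.2 hm
    apply le_of_eq
    field_simp
  have term : ∀ s : ℝ, s = 1 ∨ s = -1 → ∀ A ∈ ({A₁, A₂} : Set (ℝ → ℝ)),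
      ∀ G ∈ ({fun u => (Q u)⁻¹ * (Q u)⁻¹, fun u => (Q u)⁻¹ * ((Q u)⁻¹ * (Q u)⁻¹)} : Set (ℝ → ℝ)),
      IntervalIntegrable (fun u => Complex.exp (Complex.I * ((t * u + s * Q u : ℝ) : ℂ)) *
        ((A u * G u : ℝ) : ℂ)) volume ua ub ∧
      ‖∫ u in ua..ub, Complex.exp (Complex.I * ((t * u + s * Q u : ℝ) : ℂ)) * ((A u * G u : ℝ) : ℂ)‖ ≤
        10 * 6 * (2 * (C2 * C3)) * (t * U * β * (m⁻¹) ^ 2) / √l := fun s hs A hA G hG => by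
    have hA' : IsSymbol (Set.Icc ua ub) {ua, ub} (β / U) 1 (C2 * (t * U * β)) A := by
      rcases hA with rfl | rfl
      · exact hA1
      · exact hA2
    have hG' : IsSymbol (Set.Icc ua ub) ∅ (β / U) 1 (C3 * (m⁻¹) ^ 2) G := by
      rcases hG with rfl | rfl
      · exact hG2
      · exact hG3
    have hAG := IsSymbol.mul hne hA' hG'
    constructor
    · refine ContinuousOn.intervalIntegrable ?_
      rw [Set.uIcc_of_le hab]
      refine ContinuousOn.mul (Continuous.continuousOn (by fun_prop)) ?_
      exact Complex.continuous_ofReal.comp_continuousOn hAG.continuousOn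
    · refine (norm_integral_cexp_mul_le (P := fun u => t * u + s * Q u)
        (p := fun u => t + s * (a * (u * (Q u)⁻¹)))
        (q := fun u => s * (-(a * (a * c ^ 2 - e)) * (Q u)⁻¹ ^ 3)) (B := 5) hab hlpos hℓ hlen
        (fun u hu => ?_) (fun u hu => ?_) ?_ ?_ hAG.weaken).trans (le_of_eq ?_)
      · refine (((hasDerivAt_id u).const_mul t).add ((hdP u hu).const_mul s)).congr_deriv ?_
        simp [hQdef]
      · exact ((hdp u hu).const_mul s).const_add t
      · have : ContinuousOn (fun u => (Q u)⁻¹) (Set.Icc ua ub) :=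
          hQc.continuousOn.inv₀ fun u hu => (hQpos u hu).ne'
        fun_prop
      · have key : ∀ u ∈ Set.Icc ua ub, l ≤ a * (a * c ^ 2 - e) * (Q u)⁻¹ ^ 3 := fun u hu => by
          have hq0 := hQpos u hu
          rw [← hwe, hl, div_eq_mul_inv, inv_pow]
          gcongr
          calc (Q u) ^ 3 ≤ (3 * m) ^ 3 := pow_le_pow_left₀ hq0.le (hQ u hu).2 3
            _ = 27 * m ^ 3 := by ring
        rcases hs with rfl | rfl
        · right; intro u hu
          have := key u hu
          linarith
        · left; intro u hu
          have := key u hu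
          linarith
      · ring
  have hbf : ∀ u ∈ Set.Icc ua ub, Complex.exp (Complex.I * ((t * u : ℝ) : ℂ)) *
      (Complex.I * A₁ u + A₂ u) * ballFT (Q u) =
      Complex.exp (Complex.I * ((t * u + 1 * Q u : ℝ) : ℂ)) * (Complex.I * A₁ u + A₂ u) *
        ((-(2 * Real.pi) : ℂ) * (((Q u)⁻¹ * (Q u)⁻¹ : ℝ) : ℂ) +
          (-(2 * Real.pi * Complex.I) : ℂ) * (((Q u)⁻¹ * ((Q u)⁻¹ * (Q u)⁻¹) : ℝ) : ℂ)) +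
      Complex.exp (Complex.I * ((t * u + (-1) * Q u : ℝ) : ℂ)) * (Complex.I * A₁ u + A₂ u) *
        ((-(2 * Real.pi) : ℂ) * (((Q u)⁻¹ * (Q u)⁻¹ : ℝ) : ℂ) +
          (2 * Real.pi * Complex.I : ℂ) * (((Q u)⁻¹ * ((Q u)⁻¹ * (Q u)⁻¹) : ℝ) : ℂ)) := fun u hu => by
    have h1 : ∀ s : ℝ, Complex.exp (Complex.I * ((t * u + s * Q u : ℝ) : ℂ)) =
      Complex.exp (Complex.I * ((t * u : ℝ) : ℂ)) * Complex.exp (Complex.I * ((s * Q u : ℝ) : ℂ)) :=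
      fun s => by rw [← Complex.exp_add]; congr 1; push_cast; ring
    rw [ballFT_eq (hQpos u hu).ne', h1 1, h1 (-1), one_mul, neg_one_mul]
    push_cast
    ring
  have hAcont : Continuous fun u => Complex.I * (A₁ u : ℂ) + A₂ u := by fun_prop
  have hint : ∀ (s : ℝ) (k₁ k₂ : ℂ), IntervalIntegrable (fun u =>
      Complex.exp (Complex.I * ((t * u + s * Q u : ℝ) : ℂ)) * (Complex.I * A₁ u + A₂ u) *
        (k₁ * (((Q u)⁻¹ * (Q u)⁻¹ : ℝ) : ℂ) + k₂ * (((Q u)⁻¹ * ((Q u)⁻¹ * (Q u)⁻¹) : ℝ) : ℂ)))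
        volume ua ub := fun s k₁ k₂ => by
    refine ContinuousOn.intervalIntegrable ?_
    rw [Set.uIcc_of_le hab]
    refine ContinuousOn.mul (Continuous.continuousOn (by fun_prop)) ?_
    exact (continuousOn_const.mul (Complex.continuous_ofReal.comp_continuousOn hG2.continuousOn)).add
      (continuousOn_const.mul (Complex.continuous_ofReal.comp_continuousOn hG3.continuousOn))
  rw [intervalIntegral.integral_congr (fun u hu => hbf u (by rwa [Set.uIcc_of_le hab] at hu)),
    intervalIntegral.integral_add (hint _ _ _) (hint _ _ _)]
  have n1 : ‖(-(2 * Real.pi) : ℂ)‖ = 2 * Real.pi := by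
    rw [norm_neg, norm_mul, Complex.norm_real, Real.norm_eq_abs, abs_of_pos Real.pi_pos]; simp
  have n2 : ‖(2 * Real.pi * Complex.I : ℂ)‖ = 2 * Real.pi := by
    rw [norm_mul, Complex.norm_I, mul_one, norm_mul, Complex.norm_real, Real.norm_eq_abs,
      abs_of_pos Real.pi_pos]; simp
  have b1 := norm_integral_mul_combination_le (-(2 * Real.pi) : ℂ) (-(2 * Real.pi * Complex.I) : ℂ) (term 1 (Or.inl rfl))
  have b2 := norm_integral_mul_combination_le (-(2 * Real.pi) : ℂ) (2 * Real.pi * Complex.I : ℂ) (term (-1) (Or.inr rfl))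
  rw [norm_neg (2 * Real.pi * Complex.I : ℂ), n1, n2] at b1
  rw [n1, n2] at b2
  refine (mul_le_mul_of_nonneg_left ((norm_add_le _ _).trans (add_le_add b1 b2)) hw.le).trans ?_
  have hsm := Real.sq_sqrt hm.le
  have hsm' := Real.sqrt_pos.2 hm
  have hsa' := Real.sqrt_pos.2 ha
  calc _ = 2 * (2 * (2 * Real.pi + 2 * Real.pi) * (10 * 6 * (2 * (C2 * C3)))) * (t * U * β * (m⁻¹) ^ 2) * (w / √l) := by
        ring
    _ ≤ 2 * (2 * (2 * Real.pi + 2 * Real.pi) * (10 * 6 * (2 * (C2 * C3)))) * (t * U * β * (m⁻¹) ^ 2) *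
        (√27 * m * √m / √a) := by gcongr
    _ = 2 * (2 * (2 * Real.pi + 2 * Real.pi) * (10 * 6 * (2 * (C2 * C3)) * √27)) *
        (t * U * β * (√m * m⁻¹) / √a) := by field_simp
    _ = _ := by
      congr 1
      have : √m * m⁻¹ = (√m)⁻¹ := by
        nth_rewrite 2 [← hsm]; field_simp
      rw [this]; field_simp

set_option maxHeartbeats 800000 in
/-- Size and weighted bounds for the shell integral. -/
theorem norm_shell_integral_le {θ : ℝ → ℝ} (hθ : IsShellCutoff θ) :
    ∃ C > 0, ∀ c β U t a e w : ℝ,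
    0 < c → 0 < β → 0 < U → U ^ 2 = c ^ 2 + β → 0 ≤ a → 0 ≤ e → 0 < t →
    1 / 4 ≤ t * (β / U) → 0 ≤ w → w ^ 2 = a * c ^ 2 - e → ∀ X : ℝ,
    X = ‖∫ u in (√(c ^ 2 + β / 2))..(√(c ^ 2 + 5 * β)), Complex.exp (Complex.I * ((t * u : ℝ) : ℂ)) *
      (Complex.I * shellAmp₁ θ c β t u + shellAmp₂ θ c β u) *
        ballFT (√(a * (u ^ 2 - c ^ 2) + e))‖ →
    X ≤ C * (U ^ 2 / t) ∧ w * X ≤ C * (U ^ 2 * √U / √t) := by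
  obtain ⟨C1, hC1, H1⟩ := norm_shell_integral_near hθ
  obtain ⟨C2, hC2, H2⟩ := norm_shell_integral_far_le hθ
  obtain ⟨C3, hC3, H3⟩ := norm_shell_integral_far_weighted_le hθ
  refine ⟨4 * C1 + C2 + 12 * √12 * C3, by positivity,
    fun c β U t a e w hc hβ hU hUc ha he ht hT hw hwe X hX => ?_⟩
  have hX0 : 0 ≤ X := hX ▸ norm_nonneg _
  have hb := Real.sqrt_pos.2 hβ
  have hbβ := Real.sq_sqrt hβ.le
  set b := √β
  have hsU := Real.sq_sqrt hU.le
  have hsU' := Real.sqrt_pos.2 hU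
  have hst := Real.sq_sqrt ht.le
  have hst' := Real.sqrt_pos.2 ht
  have hsa := Real.sq_sqrt ha
  have hsa0 := Real.sqrt_nonneg a
  have hTU : U ≤ 4 * (t * β) := by
    rw [← mul_div_assoc, le_div_iff₀ hU] at hT; linarith
  have hcU : c ≤ U := by nlinarith
  have hP1 : 0 ≤ U ^ 2 / t := by positivity
  have hP2 : 0 ≤ U ^ 2 * √U / √t := by positivity
  have hwa : w ≤ c * √a := by
    refine abs_le_of_sq_le_sq' (by rw [hwe, mul_pow, hsa]; linarith) (by positivity) |>.2
  rcases le_total (√a * U / b) (t / 12) with hat | hat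
  · have h1 := H1 c β U b t a e hc hβ hU hUc hb hbβ ha he ht hT hat
    rw [← hX] at h1
    have e1 : U * β * ((t * (β / U)) ^ 2)⁻¹ = U ^ 3 / (t ^ 2 * β) := by field_simp
    rw [mul_assoc, e1] at h1
    have h2 : U ^ 3 / (t ^ 2 * β) ≤ 4 * (U ^ 2 / t) := by
      rw [← mul_div_assoc, div_le_div_iff₀ (by positivity) ht]
      have : 0 < U ^ 2 * t := by positivity
      nlinarith
    refine ⟨?_, ?_⟩
    · calc X ≤ C1 * (4 * (U ^ 2 / t)) := h1.trans (by gcongr)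
        _ ≤ _ := by
          have : 0 ≤ (C2 + 12 * √12 * C3) * (U ^ 2 / t) := by positivity
          linarith
    · have h3 : w ≤ U * (b * t / (12 * U)) := by
        refine hwa.trans (mul_le_mul hcU ?_ hsa0 hU.le)
        rw [div_le_div_iff₀ hb (by norm_num)] at hat
        rw [le_div_iff₀ (by positivity)]; linarith
      have h4 : √U ≤ 2 * (√t * b) := by
        refine abs_le_of_sq_le_sq' ?_ (by positivity) |>.2
        rw [hsU, mul_pow, mul_pow, hst, hbβ]; linarith
      have h5 : U * (b * t / (12 * U)) * (U ^ 3 / (t ^ 2 * β)) ≤ U ^ 2 * √U / √t := by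
        have k : ∀ τ : ℝ, 0 < τ → τ ^ 2 = t → U * (b * t / (12 * U)) * (U ^ 3 / (t ^ 2 * β)) =
            U ^ 2 * (U / (12 * τ * b)) / τ := fun τ hτ hτt => by
          rw [← hτt, ← hbβ]; field_simp
        rw [k _ hst' hst]
        refine div_le_div_of_nonneg_right (mul_le_mul_of_nonneg_left ?_ (by positivity)) hst'.le
        rw [div_le_iff₀ (by positivity)]
        nlinarith [mul_pos hst' hb]
      calc w * X ≤ (U * (b * t / (12 * U))) * (C1 * (U ^ 3 / (t ^ 2 * β))) := by gcongr
        _ = C1 * (U * (b * t / (12 * U)) * (U ^ 3 / (t ^ 2 * β))) := by ring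
        _ ≤ C1 * (U ^ 2 * √U / √t) := by gcongr
        _ ≤ _ := by
          have : 0 ≤ (3 * C1 + C2 + 12 * √12 * C3) * (U ^ 2 * √U / √t) := by positivity
          linarith
  · have ha' : 0 < √a := by
      by_contra h
      have : √a = 0 := le_antisymm (not_lt.1 h) hsa0
      rw [this, zero_mul, zero_div] at hat
      linarith
    have ha0 : 0 < a := Real.sqrt_pos.1 ha'
    have hmp : 0 < a * β + e := by positivity
    have hm := Real.sqrt_pos.2 hmp
    have hme := Real.sq_sqrt hmp.le
    set m := √(a * β + e) with hmdef
    have hmb : √a * b ≤ m := Real.le_sqrt_of_sq_le (by rw [mul_pow, hsa, hbβ]; linarith)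
    have hat' : t * b ≤ 12 * (√a * U) := by
      rw [div_le_div_iff₀ (by norm_num) hb] at hat; linarith
    have hTm : t * (β / U) ≤ 12 * m := by
      rw [← mul_div_assoc, div_le_iff₀ hU, ← hbβ]
      nlinarith
    have h1 := H2 c β U t a e m hc hβ hU hUc ha he ht hT hm hme hTm
    rw [← hX] at h1
    refine ⟨?_, ?_⟩
    · refine h1.trans ?_
      have : 0 ≤ (4 * C1 + 12 * √12 * C3) * (U ^ 2 / t) := by positivity
      linarith
    · rcases hw.eq_or_lt with rfl | hw'
      · rw [zero_mul]; positivity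
      have h2 := H3 c β U b t a e m w hc hβ hU hUc hb hbβ ha0 he ht hT hm hme hTm hw' hwe
      rw [← hX] at h2
      have h3 : t * U * β / (√a * √m) ≤ 12 * √12 * (U ^ 2 * √U / √t) := by
        have hsm := Real.sqrt_pos.2 hm
        have k1 : √t * b ≤ √12 * √U * √m := by
          refine abs_le_of_sq_le_sq' ?_ (by positivity) |>.2
          rw [mul_pow, mul_pow, mul_pow, hst, hbβ, hsU, Real.sq_sqrt hm.le, Real.sq_sqrt (by norm_num)]
          rw [← mul_div_assoc, div_le_iff₀ hU] at hTm
          linarith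
        rw [← mul_div_assoc, div_le_div_iff₀ (by positivity) (by positivity)]
        calc t * U * β * √t = U * (t * b) * (√t * b) := by rw [← hbβ]; ring
          _ ≤ U * (12 * (√a * U)) * (√12 * √U * √m) := by gcongr
          _ = _ := by ring
      calc w * X ≤ C3 * (12 * √12 * (U ^ 2 * √U / √t)) := h2.trans (by gcongr)
        _ ≤ _ := by
          have : 0 ≤ (4 * C1 + C2) * (U ^ 2 * √U / √t) := by positivity
          linarith

/-- Pointwise and horizontally weighted decay of the kernel localised to a dyadic shell of
`minorSq`. -/
theorem norm_shellKernel_le {θ : ℝ → ℝ} (hθ : IsShellCutoff θ) : ∃ C > 0, ∀ c β U t : ℝ,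
    0 < c → 0 < β → 0 < U → U ^ 2 = c ^ 2 + β → 0 < t → 1 / 4 ≤ t * (β / U) → ∀ (x : E3) (X : ℝ),
    X = ‖∫ ξ : E3, Complex.exp (Complex.I *
      ((t * halfSum c (ξ 0 ^ 2 + ξ 1 ^ 2) (ξ 2) + dot3 x ξ : ℝ) : ℂ)) *
        (θ (minorSq c (ξ 0 ^ 2 + ξ 1 ^ 2) (ξ 2) / β) : ℂ)‖ →
    X ≤ C * (U ^ 2 / t) ∧ nrmh x * X ≤ C * (U ^ 2 * √U / (c * √t)) := by
  obtain ⟨C, hC, H⟩ := norm_shell_integral_le hθ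
  refine ⟨C, hC, fun c β U t hc hβ hU hUc ht hT x X hX => ?_⟩
  have hθd := (contDiff_infty_iff_deriv.1 hθ.contDiff)
  have hn := norm_sq_eq x
  have hw : (c * nrmh x) ^ 2 = ‖x‖ ^ 2 * c ^ 2 - c ^ 2 * x 2 ^ 2 := by
    rw [mul_pow, nrmh, Real.sq_sqrt (by positivity), hn]; ring
  have key := integral_shell_eq (t := t) (Θ := fun u => θ ((u ^ 2 - c ^ 2) / β))
    (Θ' := fun u => deriv θ ((u ^ 2 - c ^ 2) / β) * (2 * u / β)) (ua := √(c ^ 2 + β / 2))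
    (ub := √(c ^ 2 + 5 * β)) hc.le ?_ (Real.sqrt_le_sqrt (by linarith)) (fun u => ?_) ?_
    (fun u hu hu' => ?_) (fun u hu => ?_) x
  · have e : ∫ u in (√(c ^ 2 + β / 2))..(√(c ^ 2 + 5 * β)), Complex.exp (Complex.I * ((t * u : ℝ) : ℂ)) *
        (Complex.I * t * ((θ ((u ^ 2 - c ^ 2) / β) : ℝ) : ℂ) +
          ((deriv θ ((u ^ 2 - c ^ 2) / β) * (2 * u / β) : ℝ) : ℂ)) *
        ((u * (u ^ 2 - c ^ 2) : ℝ) * ballFT (√(‖x‖ ^ 2 * u ^ 2 - c ^ 2 * (x 0 ^ 2 + x 1 ^ 2)))) =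
        ∫ u in (√(c ^ 2 + β / 2))..(√(c ^ 2 + 5 * β)), Complex.exp (Complex.I * ((t * u : ℝ) : ℂ)) *
          (Complex.I * shellAmp₁ θ c β t u + shellAmp₂ θ c β u) *
        ballFT (√(‖x‖ ^ 2 * (u ^ 2 - c ^ 2) + c ^ 2 * x 2 ^ 2)) := by
      refine intervalIntegral.integral_congr fun u _ => ?_
      rw [show ‖x‖ ^ 2 * u ^ 2 - c ^ 2 * (x 0 ^ 2 + x 1 ^ 2) =
        ‖x‖ ^ 2 * (u ^ 2 - c ^ 2) + c ^ 2 * x 2 ^ 2 by rw [hn]; ring]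
      simp only [shellAmp₁, shellAmp₂]
      push_cast
      ring
    have hX' : X = _ := hX.trans ((congrArg norm (key.trans (congrArg Neg.neg e))).trans (norm_neg _))
    obtain ⟨h1, h2⟩ := H c β U t (‖x‖ ^ 2) (c ^ 2 * x 2 ^ 2) (c * nrmh x) hc hβ hU hUc (by positivity)
      (by positivity) ht hT (mul_nonneg hc.le (Real.sqrt_nonneg _)) hw X hX'
    refine ⟨h1, ?_⟩
    have hst := Real.sqrt_pos.2 ht
    rw [← div_div, div_right_comm, ← mul_div_assoc, le_div_iff₀ hc]
    linarith
  · exact Real.lt_sqrt_of_sq_lt (by linarith)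
  · have h1 : HasDerivAt (fun u : ℝ => (u ^ 2 - c ^ 2) / β) (2 * u / β) u := by
      refine ((((hasDerivAt_id u).pow 2).sub_const (c ^ 2)).div_const β).congr_deriv ?_
      simp
    exact (hθd.1 _).hasDerivAt.comp u h1
  · have := hθd.2.continuous
    fun_prop
  · have h0 : 0 ≤ u := hc.le.trans hu
    have h2 := (Real.le_sqrt h0 (by positivity)).1 hu'
    refine hθ.zero_of_lt _ ?_ ?_
    · rw [div_lt_one hβ]; linarith
    · rw [lt_div_iff₀ hβ]; nlinarith
  · have h2 := (Real.sqrt_le_left ((Real.sqrt_nonneg _).trans hu)).1 hu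
    refine hθ.zero_of_gt _ ?_
    rw [lt_div_iff₀ hβ]; linarith

section Cutoffs

variable {θ : ℝ → ℝ}

lemma IsShellCutoff.contDiff_comp_sqrt (hθ : IsShellCutoff θ) :
    ContDiff ℝ (⊤ : ℕ∞) (fun y => θ (√y)) := by
  refine contDiff_iff_contDiffAt.2 fun y => ?_
  rcases lt_or_ge y 1 with h | h
  · refine (contDiffAt_const (c := (0 : ℝ))).congr_of_eventuallyEq ?_
    filter_upwards [Iio_mem_nhds h] with z hz
    refine hθ.zero_of_lt _ ?_ (by linarith [Real.sqrt_nonneg z])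
    rw [Real.sqrt_lt' one_pos]; simpa using hz
  · exact hθ.contDiff.contDiffAt.comp y (Real.contDiffAt_sqrt (by linarith))

lemma IsShellCutoff.hasCompactSupport_comp_sqrt (hθ : IsShellCutoff θ) :
    HasCompactSupport (fun y => θ (√y)) := by
  refine HasCompactSupport.intro (isCompact_Icc (a := (0 : ℝ)) (b := 16)) fun y hy => ?_
  rw [Set.mem_Icc, not_and_or, not_le, not_le] at hy
  rcases hy with h | h
  · rw [Real.sqrt_eq_zero_of_nonpos h.le]
    exact hθ.zero_of_lt _ (by norm_num) (by norm_num)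
  · refine hθ.zero_of_gt _ (Real.lt_sqrt_of_sq_lt ?_)
    linarith

lemma IsCutoff.isShellCutoff {ψ : ℝ → ℝ} (hψ : IsCutoff ψ) : IsShellCutoff (lpBump ψ) := by
  obtain ⟨h1, h2, h3, h4⟩ := hψ
  refine ⟨?_, fun y hy hy' => ?_, fun y hy => ?_, ?_⟩
  · exact (h1.comp (contDiff_id.div_const 2)).sub h1
  · rw [lpBump, h4 y (abs_le.2 ⟨hy'.le, hy.le⟩), h4 _ (abs_le.2 ⟨by linarith, by linarith⟩), sub_self]
  · have : ψ y = 0 := h3 y (lt_abs.2 (Or.inl (by linarith)))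
    rw [lpBump, this, h3 _ (lt_abs.2 (Or.inl (by linarith))), sub_self]
  · refine HasCompactSupport.intro (isCompact_Icc (a := (-4 : ℝ)) (b := 4)) fun y hy => ?_
    rw [Set.mem_Icc, ← abs_le, not_le] at hy
    have : ψ y = 0 := h3 y (by linarith)
    rw [lpBump, this, h3, sub_self]
    rw [abs_div, abs_two]; linarith

lemma IsShellCutoff.exists_kernel {V : Type*} [NormedAddCommGroup V] [InnerProductSpace ℝ V]
    [FiniteDimensional ℝ V] [MeasurableSpace V] [BorelSpace V] (hθ : IsShellCutoff θ) :
    ∃ k : V → ℂ, Integrable k ∧ Integrable (fun y => ‖y‖ * ‖k y‖) ∧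
      ∀ v : V, (θ ‖v‖ : ℂ) =
        ∫ y, k y * Complex.exp (Complex.I * ((-(2 * Real.pi) * inner ℝ y v : ℝ) : ℂ)) := by
  have e : ∀ v : V, θ ‖v‖ = θ (√(‖v‖ ^ 2)) := fun v => by rw [Real.sqrt_sq (norm_nonneg _)]
  have h1 : ContDiff ℝ (⊤ : ℕ∞) (fun v : V => (θ ‖v‖ : ℂ)) := by
    simp only [e]
    exact Complex.ofRealCLM.contDiff.comp (hθ.contDiff_comp_sqrt.comp (contDiff_norm_sq ℝ))
  have h2 : HasCompactSupport (fun v : V => (θ ‖v‖ : ℂ)) := by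
    refine HasCompactSupport.intro (isCompact_closedBall (0 : V) 4) fun v hv => ?_
    rw [mem_closedBall_zero_iff, not_le] at hv
    rw [hθ.zero_of_gt _ hv, Complex.ofReal_zero]
  set f := h2.toSchwartzMap h1 with hf
  set k := FourierTransform.fourierInv f with hk
  refine ⟨k, k.integrable, by simpa using k.integrable_pow_mul volume 1, fun v => ?_⟩
  have h3 : FourierTransform.fourier k = f := FourierTransform.fourier_fourierInv_eq f
  have h4 : f v = (θ ‖v‖ : ℂ) := rfl
  rw [← h4, ← h3, SchwartzMap.fourier_coe, Real.fourier_eq']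
  congr 1
  ext y
  rw [smul_eq_mul, mul_comm, mul_comm Complex.I]
  push_cast
  ring_nf

end Cutoffs

lemma nrmh_add_le (x y : E3) : nrmh (x + y) ≤ nrmh x + nrmh y := by
  have h : ∀ x : E3, nrmh x = ‖(⟨x 0, x 1⟩ : ℂ)‖ := fun x => by
    rw [Complex.norm_eq_sqrt_sq_add_sq, nrmh]
  rw [h, h, h]
  exact norm_add_le (⟨x 0, x 1⟩ : ℂ) ⟨y 0, y 1⟩

/-- The oscillatory integral with linear phase and amplitude `g`. -/
def oscInt (g : E3 → ℂ) (x : E3) : ℂ := ∫ ξ, Complex.exp (Complex.I * (dot3 x ξ : ℂ)) * g ξ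

section Multiplier

variable {V : Type*} [NormedAddCommGroup V] [MeasurableSpace V] [BorelSpace V]
  [SecondCountableTopology V] {m : Measure V} [SFinite m]

lemma oscInt_mul_eq {k : V → ℂ} {L : V → E3} {g μ : E3 → ℂ} (hk : Integrable k m)
    (hL : Continuous L) (hg : Integrable g)
    (hμ : ∀ ξ, μ ξ = ∫ y, k y * Complex.exp (Complex.I * (dot3 (L y) ξ : ℂ)) ∂m) (x : E3) :
    oscInt (fun ξ => g ξ * μ ξ) x = ∫ y, k y * oscInt g (x + L y) ∂m := by
  have hd : ∀ y ξ, dot3 (x + L y) ξ = dot3 x ξ + dot3 (L y) ξ := fun y ξ => by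
    simp only [dot3, PiLp.add_apply]; ring
  have hc : Continuous fun p : E3 × V => dot3 (x + L p.2) p.1 := by
    unfold dot3; fun_prop
  have hint : Integrable (fun p : E3 × V =>
      Complex.exp (Complex.I * (dot3 (x + L p.2) p.1 : ℂ)) * (g p.1 * k p.2)) (volume.prod m) := by
    refine (hg.mul_prod hk).bdd_mul (c := 1) ?_ (Filter.Eventually.of_forall fun p => ?_)
    · exact Continuous.aestronglyMeasurable (by fun_prop)
    · exact (norm_cexp_I_mul_ofReal _).le
  have e1 : oscInt (fun ξ => g ξ * μ ξ) x = ∫ ξ, ∫ y,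
      Complex.exp (Complex.I * (dot3 (x + L y) ξ : ℂ)) * (g ξ * k y) ∂m := by
    unfold oscInt
    congr 1
    ext ξ
    simp only
    rw [hμ, ← mul_assoc, ← integral_const_mul]
    congr 1
    ext y
    rw [hd, Complex.ofReal_add, mul_add, Complex.exp_add]
    ring
  rw [e1, integral_integral_swap hint]
  congr 1
  ext y
  unfold oscInt
  rw [← integral_const_mul]
  congr 1
  ext ξ
  ring

/-- Fourier multipliers with rapidly decaying kernel preserve horizontally weighted decay. -/
theorem norm_oscInt_mul_le {k : V → ℂ} {L : V → E3} {g μ : E3 → ℂ} {B₀ B₁ l : ℝ}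
    (hk : Integrable k m) (hk' : Integrable (fun y => ‖y‖ * ‖k y‖) m)
    (hL : Continuous L) (hLl : ∀ y, nrmh (L y) ≤ l * ‖y‖) (hg : Integrable g)
    (hμ : ∀ ξ, μ ξ = ∫ y, k y * Complex.exp (Complex.I * (dot3 (L y) ξ : ℂ)) ∂m)
    (h₀ : ∀ x, ‖oscInt g x‖ ≤ B₀) (h₁ : ∀ x, nrmh x * ‖oscInt g x‖ ≤ B₁) (x : E3) :
    ‖oscInt (fun ξ => g ξ * μ ξ) x‖ ≤ (∫ y, ‖k y‖ ∂m) * B₀ ∧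
      nrmh x * ‖oscInt (fun ξ => g ξ * μ ξ) x‖ ≤
        (∫ y, ‖k y‖ ∂m) * B₁ + l * (∫ y, ‖y‖ * ‖k y‖ ∂m) * B₀ := by
  have hx : 0 ≤ nrmh x := Real.sqrt_nonneg _
  rw [oscInt_mul_eq hk hL hg hμ]
  constructor
  · rw [← integral_mul_const]
    refine norm_integral_le_of_norm_le (hk.norm.mul_const _) (Filter.Eventually.of_forall fun y => ?_)
    rw [norm_mul]
    exact mul_le_mul_of_nonneg_left (h₀ _) (norm_nonneg _)
  · have e : nrmh x * ‖∫ y, k y * oscInt g (x + L y) ∂m‖ =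
        ‖∫ y, (nrmh x : ℂ) * (k y * oscInt g (x + L y)) ∂m‖ := by
      rw [integral_const_mul, norm_mul, Complex.norm_real, Real.norm_eq_abs, abs_of_nonneg hx]
    rw [e, mul_right_comm, ← integral_mul_const, ← integral_const_mul,
      ← integral_add (hk.norm.mul_const _) (hk'.const_mul _)]
    refine norm_integral_le_of_norm_le ((hk.norm.mul_const _).add (hk'.const_mul _))
      (Filter.Eventually.of_forall fun y => ?_)
    rw [norm_mul, norm_mul, Complex.norm_real, Real.norm_eq_abs, abs_of_nonneg hx]
    have hneg : nrmh (-L y) = nrmh (L y) := by simp [nrmh]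
    have h2 : nrmh x ≤ nrmh (x + L y) + l * ‖y‖ := by
      have := nrmh_add_le (x + L y) (-L y)
      rw [add_neg_cancel_right, hneg] at this
      linarith [hLl y]
    have hk0 := norm_nonneg (k y)
    have ho := norm_nonneg (oscInt g (x + L y))
    have hl0 : 0 ≤ l * ‖y‖ := (Real.sqrt_nonneg _).trans (hLl y)
    calc nrmh x * (‖k y‖ * ‖oscInt g (x + L y)‖)
        ≤ (nrmh (x + L y) + l * ‖y‖) * (‖k y‖ * ‖oscInt g (x + L y)‖) := by gcongr
      _ = ‖k y‖ * (nrmh (x + L y) * ‖oscInt g (x + L y)‖) +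
          l * ‖y‖ * ‖k y‖ * ‖oscInt g (x + L y)‖ := by ring
      _ ≤ ‖k y‖ * B₁ + l * ‖y‖ * ‖k y‖ * B₀ := by
          gcongr
          · exact h₁ _
          · exact h₀ _
      _ = _ := by ring

end Multiplier

section Pieces

/-- The half-wave amplitude localised to a dyadic shell of `minorSq`. -/
def shellSymbol (θ : ℝ → ℝ) (c β t : ℝ) (ξ : E3) : ℂ :=
  Complex.exp (Complex.I * ((t * halfSum c (ξ 0 ^ 2 + ξ 1 ^ 2) (ξ 2) : ℝ) : ℂ)) *
    (θ (minorSq c (ξ 0 ^ 2 + ξ 1 ^ 2) (ξ 2) / β) : ℂ)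

variable {θ : ℝ → ℝ}

lemma continuous_shellSymbol (hθ : IsShellCutoff θ) (c β t : ℝ) : Continuous (shellSymbol θ c β t) := by
  have h1 := continuous_halfSum_apply c
  have h2 := hθ.contDiff.continuous
  unfold shellSymbol minorSq
  fun_prop

lemma shellSymbol_eq_zero (hθ : IsShellCutoff θ) {c β : ℝ} (hβ : 0 < β) (t : ℝ) {ξ : E3}
    (h : 4 * β + c ^ 2 < ‖ξ‖ ^ 2) : shellSymbol θ c β t ξ = 0 := by
  rw [shellSymbol, hθ.zero_of_gt, Complex.ofReal_zero, mul_zero]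
  have h1 := le_minorSq (c := c) (s := ξ 0 ^ 2 + ξ 1 ^ 2) (z := ξ 2) (by positivity)
  rw [norm_sq_eq] at h
  rw [lt_div_iff₀ hβ]; linarith

lemma integrable_shellSymbol (hθ : IsShellCutoff θ) {c β : ℝ} (hβ : 0 < β) (t : ℝ) :
    Integrable (shellSymbol θ c β t) := by
  refine (continuous_shellSymbol hθ c β t).integrable_of_hasCompactSupport ?_
  refine HasCompactSupport.intro (isCompact_closedBall (0 : E3) (√(4 * β + c ^ 2))) fun ξ hξ => ?_
  rw [mem_closedBall_zero_iff, not_le] at hξ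
  exact shellSymbol_eq_zero hθ hβ t ((Real.sqrt_lt' ((Real.sqrt_nonneg _).trans_lt hξ)).1 hξ)

lemma oscInt_shellSymbol (θ : ℝ → ℝ) (c β t : ℝ) (x : E3) : oscInt (shellSymbol θ c β t) x =
    ∫ ξ : E3, Complex.exp (Complex.I *
      ((t * halfSum c (ξ 0 ^ 2 + ξ 1 ^ 2) (ξ 2) + dot3 x ξ : ℝ) : ℂ)) *
        (θ (minorSq c (ξ 0 ^ 2 + ξ 1 ^ 2) (ξ 2) / β) : ℂ) := by
  unfold oscInt shellSymbol
  congr 1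
  ext ξ
  rw [Complex.ofReal_add, mul_add, Complex.exp_add]
  ring

lemma dot3_smul (a : ℝ) (x ξ : E3) : dot3 (a • x) ξ = a * dot3 x ξ := by
  simp only [dot3, PiLp.smul_apply, smul_eq_mul]; ring

lemma nrmh_le_norm (x : E3) : nrmh x ≤ ‖x‖ := by
  rw [nrmh, ← Real.sqrt_sq (norm_nonneg x), norm_sq_eq]
  exact Real.sqrt_le_sqrt (by linarith [sq_nonneg (x 2)])

lemma nrmh_smul (a : ℝ) (x : E3) : nrmh (a • x) = |a| * nrmh x := by
  simp only [nrmh, PiLp.smul_apply, smul_eq_mul]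
  rw [← Real.sqrt_sq_eq_abs, ← Real.sqrt_mul (sq_nonneg a)]
  congr 1; ring

lemma continuous_nrmh : Continuous nrmh := by unfold nrmh; fun_prop

/-- The full piece: shell, radial and horizontal localisation. -/
def pieceSymbol (θ : ℝ → ℝ) (c β t σ : ℝ) (ξ : E3) : ℂ :=
  shellSymbol θ c β t ξ * (θ ‖ξ‖ : ℂ) * (θ (σ * nrmh ξ) : ℂ)

/-- Horizontally weighted decay for a piece. -/
theorem nrmh_mul_norm_piece_le (hθ : IsShellCutoff θ) : ∃ C > 0, ∀ c β U t σ : ℝ,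
    0 < c → 0 < β → 0 < U → U ^ 2 = c ^ 2 + β → 0 < t → 1 / 4 ≤ t * (β / U) → 1 ≤ σ → ∀ x : E3,
    nrmh x * ‖oscInt (pieceSymbol θ c β t σ) x‖ ≤
      C * (U ^ 2 * √U / (c * √t) + σ * (U ^ 2 / t)) := by
  obtain ⟨C, hC, H⟩ := norm_shellKernel_le hθ
  obtain ⟨k₁, ki₁, ki₁', hk₁⟩ := hθ.exists_kernel (V := E3)
  obtain ⟨k₂, ki₂, ki₂', hk₂⟩ := hθ.exists_kernel (V := EuclideanSpace ℝ (Fin 2))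
  set K₁ := ∫ y, ‖k₁ y‖ with hK₁
  set K₁' := ∫ y, ‖y‖ * ‖k₁ y‖ with hK₁'
  set K₂ := ∫ y, ‖k₂ y‖ with hK₂
  set K₂' := ∫ y, ‖y‖ * ‖k₂ y‖ with hK₂'
  have n1 : 0 ≤ K₁ := integral_nonneg fun y => norm_nonneg _
  have n1' : 0 ≤ K₁' := integral_nonneg fun y => by positivity
  have n2 : 0 ≤ K₂ := integral_nonneg fun y => norm_nonneg _
  have n2' : 0 ≤ K₂' := integral_nonneg fun y => by positivity
  have hπ := Real.pi_pos
  refine ⟨K₂ * (K₁ * C) + K₂ * (2 * Real.pi * K₁' * C) + 2 * Real.pi * K₂' * (K₁ * C) + 1, by positivity,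
    fun c β U t σ hc hβ hU hUc ht hT hσ x => ?_⟩
  set M := U ^ 2 * √U / (c * √t) with hM
  have hM0 : 0 ≤ M := by positivity
  have hB0 : 0 ≤ U ^ 2 / t := by positivity
  set N := U ^ 2 / t with hN
  have s0 := fun x => (H c β U t hc hβ hU hUc ht hT x _ (congrArg norm (oscInt_shellSymbol θ c β t x)))
  have hi := integrable_shellSymbol hθ (c := c) hβ t
  have s1 := norm_oscInt_mul_le (L := fun y : E3 => (-(2 * Real.pi)) • y) (l := 2 * Real.pi)
    (μ := fun ξ => (θ ‖ξ‖ : ℂ)) ki₁ ki₁' (by fun_prop)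
    (fun y => by
      rw [nrmh_smul, abs_neg, abs_of_pos (by positivity)]
      exact mul_le_mul_of_nonneg_left (nrmh_le_norm y) (by positivity))
    hi (fun ξ => by rw [hk₁]; simp only [dot3_smul]; simp only [dot3_eq_inner]) (fun x => (s0 x).1) (fun x => (s0 x).2)
  obtain ⟨Cθ, hCθ⟩ := hθ.contDiff.continuous.bounded_above_of_compact_support hθ.hasCompactSupport
  have hθc := hθ.contDiff.continuous
  have hi' : Integrable fun ξ => shellSymbol θ c β t ξ * (θ ‖ξ‖ : ℂ) := by
    refine hi.mul_bdd (c := Cθ) (Continuous.aestronglyMeasurable (by fun_prop))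
      (Filter.Eventually.of_forall fun ξ => ?_)
    rw [Complex.norm_real]; exact hCθ _
  have s2 := norm_oscInt_mul_le
    (L := fun y : EuclideanSpace ℝ (Fin 2) => (-(2 * Real.pi * σ)) • (!₂[y 0, y 1, 0] : E3))
    (l := 2 * Real.pi * σ)
    (μ := fun ξ => (θ (σ * nrmh ξ) : ℂ)) ki₂ ki₂' (by fun_prop)
    (fun y => by
      rw [nrmh_smul, abs_neg, abs_of_pos (by positivity)]
      refine mul_le_mul_of_nonneg_left ?_ (by positivity)
      rw [EuclideanSpace.norm_eq, Fin.sum_univ_two, nrmh]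
      simp)
    hi' (fun ξ => by
      have e1 : σ * nrmh ξ = ‖(!₂[σ * ξ 0, σ * ξ 1] : EuclideanSpace ℝ (Fin 2))‖ := by
        rw [EuclideanSpace.norm_eq, Fin.sum_univ_two, nrmh]
        simp only [Real.norm_eq_abs, sq_abs, Matrix.cons_val_zero, Matrix.cons_val_one]
        rw [show (σ * ξ 0) ^ 2 + (σ * ξ 1) ^ 2 = σ ^ 2 * (ξ 0 ^ 2 + ξ 1 ^ 2) by ring,
          Real.sqrt_mul (sq_nonneg _), Real.sqrt_sq (by linarith)]
      rw [e1, hk₂]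
      congr 1
      ext y
      rw [dot3_smul, PiLp.inner_apply, Fin.sum_univ_two]
      simp only [dot3, RCLike.inner_apply, conj_trivial, Matrix.cons_val_zero,
        Matrix.cons_val_one, Matrix.cons_val]
      congr 4
      ring) (fun x => (s1 x).1) (fun x => (s1 x).2) x
  refine s2.2.trans ?_
  rw [← hK₁, ← hK₁', ← hK₂, ← hK₂']
  have hσN : N ≤ σ * N := le_mul_of_one_le_left hB0 hσ
  have a1 : 0 ≤ K₂ * (2 * Real.pi * K₁' * C) := by positivity
  have a2 : 0 ≤ 2 * Real.pi * K₂' * (K₁ * C) := by positivity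
  have a3 : 0 ≤ K₂ * (K₁ * C) := by positivity
  have a4 : 0 ≤ σ * N := by positivity
  calc K₂ * (K₁ * (C * M) + 2 * Real.pi * K₁' * (C * N)) + 2 * Real.pi * σ * K₂' * (K₁ * (C * N))
      = K₂ * (K₁ * C) * M + K₂ * (2 * Real.pi * K₁' * C) * N +
        2 * Real.pi * K₂' * (K₁ * C) * (σ * N) := by ring
    _ ≤ K₂ * (K₁ * C) * (M + σ * N) + K₂ * (2 * Real.pi * K₁' * C) * (M + σ * N) +
        2 * Real.pi * K₂' * (K₁ * C) * (M + σ * N) + 1 * (M + σ * N) := by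
        have := mul_nonneg a3 a4
        have := mul_le_mul_of_nonneg_left (show N ≤ M + σ * N by linarith) a1
        have := mul_le_mul_of_nonneg_left (show σ * N ≤ M + σ * N by linarith) a2
        linarith
    _ = _ := by ring

end Pieces

section Radial

lemma hasDerivAt_sqrt_sq_add (w : ℝ) {r : ℝ} (hr : 0 < r) :
    HasDerivAt (fun r => √(r ^ 2 + w ^ 2)) (r * (√(r ^ 2 + w ^ 2))⁻¹) r := by
  have h := ((hasDerivAt_pow 2 r).add_const (w ^ 2)).sqrt (by positivity)
  refine h.congr_deriv ?_
  simp only [Nat.cast_ofNat, Nat.add_one_sub_one, pow_one]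
  field_simp

/-- On a dyadic interval all distances to a fixed point of the axis are comparable. -/
lemma sqrt_sq_add_comparable {ε r₀ w r : ℝ} (hε : 0 < ε) (hr₀ : r₀ ∈ Set.Icc ε (4 * ε))
    (hr : r ∈ Set.Icc (ε / 2) (8 * ε)) :
    √(r₀ ^ 2 + w ^ 2) / 8 ≤ √(r ^ 2 + w ^ 2) ∧ √(r ^ 2 + w ^ 2) ≤ 8 * √(r₀ ^ 2 + w ^ 2) := by
  obtain ⟨h1, h2⟩ := hr₀
  obtain ⟨h3, h4⟩ := hr
  have k0 := Real.sq_sqrt (show 0 ≤ r₀ ^ 2 + w ^ 2 by positivity)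
  constructor
  · refine Real.le_sqrt_of_sq_le ?_
    rw [div_pow, k0]
    nlinarith [sq_nonneg w]
  · refine Real.sqrt_le_iff.2 ⟨by positivity, ?_⟩
    rw [mul_pow, k0]
    nlinarith [sq_nonneg w]

lemma isSymbol_sqrt_sq_add (n : ℕ) : ∃ C > 0, ∀ ε r₀ w : ℝ, 0 < ε → r₀ ∈ Set.Icc ε (4 * ε) →
    IsSymbol (Set.Icc (ε / 2) (8 * ε)) ∅ ε n (C * √(r₀ ^ 2 + w ^ 2)) (fun r => √(r ^ 2 + w ^ 2)) ∧
    IsSymbol (Set.Icc (ε / 2) (8 * ε)) ∅ ε n (C * (√(r₀ ^ 2 + w ^ 2))⁻¹)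
      (fun r => (√(r ^ 2 + w ^ 2))⁻¹) := by
  obtain ⟨C₁, hC₁, H₁⟩ := IsSymbol.sqrt n ((2 ^ n * 64 + 1) * 64) (by positivity)
  obtain ⟨C₂, hC₂, H₂⟩ := IsSymbol.inv n C₁
  refine ⟨max C₁ (C₂ * 8), by positivity, fun ε r₀ w hε hr₀ => ?_⟩
  set s := Set.Icc (ε / 2) (8 * ε) with hs
  have hne : s.Nonempty := ⟨ε, by constructor <;> linarith⟩
  have hd : 0 < √(r₀ ^ 2 + w ^ 2) := Real.sqrt_pos.2 (by have := hε.trans_le hr₀.1; positivity)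
  set d := √(r₀ ^ 2 + w ^ 2) with hdd
  have hd2 : d ^ 2 = r₀ ^ 2 + w ^ 2 := Real.sq_sqrt (by positivity)
  have hid : IsSymbol s ∅ ε n (8 * ε) (fun r => r) :=
    IsSymbol.id hε (fun r hr => by rw [abs_of_pos (by linarith [hr.1])]; exact hr.2) (by linarith)
  have hsq : IsSymbol s ∅ ε n (((2 ^ n * 64 + 1) * 64) * (d / 8) ^ 2) (fun r => r ^ 2 + w ^ 2) := by
    have h := (hid.mul hne hid).add (IsSymbol.const hε (w ^ 2))
    simp only [← pow_two] at h
    refine h.mono hε ?_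
    rw [abs_of_nonneg (sq_nonneg w)]
    have h1 : ε ^ 2 ≤ d ^ 2 := by rw [hd2]; nlinarith [hr₀.1, sq_nonneg w]
    have h2 : w ^ 2 ≤ d ^ 2 := by rw [hd2]; nlinarith [sq_nonneg r₀]
    have h3 : (0 : ℝ) ≤ 2 ^ n * 64 := by positivity
    nlinarith [mul_le_mul_of_nonneg_left h1 h3]
  have h1 := H₁ s ε (d / 8) _ hne hε (by positivity) (fun r hr => by
    have := (sqrt_sq_add_comparable (w := w) hε hr₀ hr).1
    rw [← hdd] at this
    calc (d / 8) ^ 2 ≤ √(r ^ 2 + w ^ 2) ^ 2 := by gcongr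
      _ = _ := Real.sq_sqrt (by positivity)) hsq
  have h2 := H₂ s ε (d / 8) _ hne hε (by positivity)
    (fun r hr => (sqrt_sq_add_comparable (w := w) hε hr₀ hr).1) h1
  refine ⟨h1.mono hε ?_, h2.mono hε ?_⟩
  · have := le_max_left C₁ (C₂ * 8)
    nlinarith
  · calc C₂ * (d / 8)⁻¹ = C₂ * 8 * d⁻¹ := by rw [inv_div]; field_simp
      _ ≤ _ := by gcongr; exact le_max_right _ _

variable {θ : ℝ → ℝ}

lemma sq_mul_halfSum_sq_le {c s z : ℝ} (hs : 0 ≤ s) (hc : 0 ≤ c) :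
    s * halfSum c s z ^ 2 ≤ minorSq c s z * focalProd c s z := by
  have h1 := minorSq_mul_focalProd_sub (c := c) (z := z) hs
  have h2 := minorSq_ge_radial (c := c) (z := z) hs hc
  have h3 := minorSq_add_sq (c := c) (s := s) (z := z)
  have h4 := minorSq_nonneg (c := c) (z := z) hc hs
  rw [← h3]
  nlinarith

/-- The shell localisation is a symbol on horizontal dyadic intervals which meet the shell. -/
lemma isSymbol_minorSq (n : ℕ) : ∃ C > 0, ∀ c ε r₀ z β : ℝ, 0 < c → 0 < ε →
    r₀ ∈ Set.Icc ε (4 * ε) → minorSq c (r₀ ^ 2) z ≤ 4 * β →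
    IsSymbol (Set.Icc (ε / 2) (8 * ε)) ∅ ε (n + 1) (C * β) (fun r => minorSq c (r ^ 2) z) := by
  obtain ⟨C, hC, H⟩ := isSymbol_sqrt_sq_add n
  set K := 2 ^ n * (8 * (1 + 2 ^ n * C ^ 2)) * 8 with hK
  have hK0 : 0 < K := by positivity
  refine ⟨4 + 8 * K, by positivity, fun c ε r₀ z β hc hε hr₀ hS => ?_⟩
  set s := Set.Icc (ε / 2) (8 * ε) with hs
  have hne : s.Nonempty := ⟨ε, by constructor <;> linarith⟩
  have hr₀0 : 0 < r₀ := hε.trans_le hr₀.1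
  have hr₀s : r₀ ∈ s := ⟨by linarith [hr₀.1], by linarith [hr₀.2]⟩
  obtain ⟨a1, b1⟩ := H ε r₀ (z + c) hε hr₀
  obtain ⟨a2, b2⟩ := H ε r₀ (z - c) hε hr₀
  have hd1 : 0 < √(r₀ ^ 2 + (z + c) ^ 2) := Real.sqrt_pos.2 (by positivity)
  have hd2 : 0 < √(r₀ ^ 2 + (z - c) ^ 2) := Real.sqrt_pos.2 (by positivity)
  have key := sq_mul_halfSum_sq_le (c := c) (z := z) (sq_nonneg r₀) hc.le
  have hS0 := minorSq_nonneg (c := c) (z := z) hc.le (sq_nonneg r₀)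
  have hβ : 0 ≤ β := by linarith
  unfold halfSum focalProd at key
  set d₁ := √(r₀ ^ 2 + (z + c) ^ 2) with hdd1
  set d₂ := √(r₀ ^ 2 + (z - c) ^ 2) with hdd2
  have hid : IsSymbol s ∅ ε n (8 * ε) (fun r => r) :=
    IsSymbol.id hε (fun r hr => by rw [abs_of_pos (by linarith [hr.1])]; exact hr.2) (by linarith)
  have hratio : 1 + 2⁻¹ * (d₁ * d₂⁻¹ + d₂ * d₁⁻¹) ≤ 8 * β / ε ^ 2 := by
    have e : 1 + 2⁻¹ * (d₁ * d₂⁻¹ + d₂ * d₁⁻¹) = (d₁ + d₂) ^ 2 / (2 * (d₁ * d₂)) := by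
      field_simp; ring
    rw [e, div_le_div_iff₀ (by positivity) (by positivity)]
    have h1 : ε ^ 2 ≤ r₀ ^ 2 := by nlinarith [hr₀.1]
    calc (d₁ + d₂) ^ 2 * ε ^ 2 ≤ (d₁ + d₂) ^ 2 * r₀ ^ 2 := by gcongr
      _ ≤ 4 * (minorSq c (r₀ ^ 2) z * (d₁ * d₂)) := by linarith
      _ ≤ 4 * (4 * β * (d₁ * d₂)) := by gcongr
      _ = _ := by ring
  have hder : IsSymbol s ∅ ε n (K * β / ε) (fun r => r * (1 + 2⁻¹ *
      (√(r ^ 2 + (z + c) ^ 2) * (√(r ^ 2 + (z - c) ^ 2))⁻¹ +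
        √(r ^ 2 + (z - c) ^ 2) * (√(r ^ 2 + (z + c) ^ 2))⁻¹))) := by
    refine (hid.mul hne ((IsSymbol.const hε 1).add
      (((a1.mul hne b2).add (a2.mul hne b1)).const_mul 2⁻¹))).mono hε ?_
    rw [abs_one, abs_of_pos (by norm_num)]
    calc 2 ^ n * (8 * ε * (1 + 2⁻¹ * (2 ^ n * (C * d₁ * (C * d₂⁻¹)) + 2 ^ n * (C * d₂ * (C * d₁⁻¹)))))
        = 2 ^ n * 8 * ε * (1 + 2 ^ n * C ^ 2 * (2⁻¹ * (d₁ * d₂⁻¹ + d₂ * d₁⁻¹))) := by ring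
      _ ≤ 2 ^ n * 8 * ε * ((1 + 2 ^ n * C ^ 2) * (8 * β / ε ^ 2)) := by
        gcongr
        have : 0 ≤ 2⁻¹ * (d₁ * d₂⁻¹ + d₂ * d₁⁻¹) := by positivity
        have : 0 < 2 ^ n * C ^ 2 := by positivity
        nlinarith
      _ = _ := by rw [hK]; field_simp
  have hD : ∀ r ∈ s, HasDerivAt (fun r => minorSq c (r ^ 2) z) (r * (1 + 2⁻¹ *
      (√(r ^ 2 + (z + c) ^ 2) * (√(r ^ 2 + (z - c) ^ 2))⁻¹ +
        √(r ^ 2 + (z - c) ^ 2) * (√(r ^ 2 + (z + c) ^ 2))⁻¹))) r := by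
    intro r hr
    have hr0 : 0 < r := by linarith [hr.1]
    have k1 := hasDerivAt_sqrt_sq_add (z + c) hr0
    have k2 := hasDerivAt_sqrt_sq_add (z - c) hr0
    have p1 : 0 < √(r ^ 2 + (z + c) ^ 2) := Real.sqrt_pos.2 (by positivity)
    have p2 : 0 < √(r ^ 2 + (z - c) ^ 2) := Real.sqrt_pos.2 (by positivity)
    have := (((k1.add k2).div_const 2).fun_pow 2).sub_const (c ^ 2)
    refine this.congr_deriv ?_
    simp only [Nat.cast_ofNat, Nat.add_one_sub_one, pow_one, Pi.add_apply]
    field_simp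
    ring
  refine ⟨fun r hr => ?_, by simp, _, hD, hder.mono hε ?_⟩
  · have := (convex_Icc (ε / 2) (8 * ε)).norm_image_sub_le_of_norm_hasDerivWithin_le
      (fun r hr => (hD r hr).hasDerivWithinAt) (fun r hr => hder.bound r hr) hr₀s hr
    have h2 : ‖r - r₀‖ ≤ 8 * ε := by
      rw [Real.norm_eq_abs, abs_le]
      constructor <;> linarith [hr.1, hr.2, hr₀s.1, hr₀s.2]
    have h3 : K * β / ε * ‖r - r₀‖ ≤ 8 * K * β := by
      calc K * β / ε * ‖r - r₀‖ ≤ K * β / ε * (8 * ε) := by gcongr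
        _ = _ := by field_simp
    rw [Real.norm_eq_abs] at this
    have h4 := abs_add_le (minorSq c (r ^ 2) z - minorSq c (r₀ ^ 2) z) (minorSq c (r₀ ^ 2) z)
    rw [sub_add_cancel, abs_of_nonneg hS0] at h4
    linarith
  · gcongr; linarith

end Radial

section Radial

variable {θ : ℝ → ℝ}

/-- The amplitude of a piece restricted to a horizontal ray. -/
def radialAmp (θ : ℝ → ℝ) (c ε β z r : ℝ) : ℝ :=
  r * θ (√(r ^ 2 + z ^ 2)) * θ (r / ε) * θ (minorSq c (r ^ 2) z / β)

lemma isSymbol_radialAmp (n : ℕ) (hθ : IsShellCutoff θ) : ∃ C > 0, ∀ c ε r₀ z β : ℝ, 0 < c → 0 < ε →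
    ε ≤ 1 → 0 < β → r₀ ∈ Set.Icc ε (4 * ε) → z ^ 2 ≤ 16 → minorSq c (r₀ ^ 2) z ≤ 4 * β →
    IsSymbol (Set.Icc (ε / 2) (8 * ε)) {ε / 2, 8 * ε} ε (n + 1) (C * ε) (radialAmp θ c ε β z) := by
  obtain ⟨C₁, hC₁, H₁⟩ := isSymbol_minorSq n
  obtain ⟨C₂, hC₂, H₂⟩ := IsSymbol.comp (n + 1) C₁ θ hθ.contDiff hθ.hasCompactSupport
  obtain ⟨C₃, hC₃, H₃⟩ := IsSymbol.comp (n + 1) 8 θ hθ.contDiff hθ.hasCompactSupport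
  obtain ⟨C₄, hC₄, H₄⟩ := IsSymbol.comp (n + 1) (2 ^ (n + 1) * 64 + 16) (fun y => θ (√y))
    hθ.contDiff_comp_sqrt hθ.hasCompactSupport_comp_sqrt
  refine ⟨2 ^ (n + 1) * (2 ^ (n + 1) * (2 ^ (n + 1) * (C₃ * 8) * C₄) * C₂), by positivity, ?_⟩
  intro c ε r₀ z β hc hε hε1 hβ hr₀ hz hS
  set s := Set.Icc (ε / 2) (8 * ε) with hs
  have hne : s.Nonempty := ⟨ε, by constructor <;> linarith⟩
  have hid : IsSymbol s ∅ ε (n + 1) (8 * ε) (fun r => r) :=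
    IsSymbol.id hε (fun r hr => by rw [abs_of_pos (by linarith [hr.1])]; exact hr.2) (by linarith)
  have h1 : IsSymbol s ∅ ε (n + 1) C₂ (fun r => θ (minorSq c (r ^ 2) z / β)) := by
    refine H₂ s ∅ ε _ hne hε (by simp) ?_
    have := (H₁ c ε r₀ z β hc hε hr₀ hS).const_mul β⁻¹
    simp only [inv_mul_eq_div] at this
    refine this.mono hε (le_of_eq ?_)
    rw [abs_of_pos (by positivity)]; field_simp
  have h2 : IsSymbol s {ε / 2, 8 * ε} ε (n + 1) C₃ (fun r => θ (r / ε)) := by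
    refine H₃ s _ ε _ hne hε ?_ ?_
    · rintro r (rfl | rfl)
      · have e : ε / 2 / ε ∈ Set.Ioo (-1 : ℝ) 1 := by
          rw [show ε / 2 / ε = 1 / 2 by field_simp]; norm_num
        filter_upwards [isOpen_Ioo.mem_nhds e] with y hy
        exact hθ.zero_of_lt y hy.2 hy.1
      · have e : 8 * ε / ε ∈ Set.Ioi (4 : ℝ) := by
          rw [show 8 * ε / ε = 8 by field_simp]; norm_num
        filter_upwards [isOpen_Ioi.mem_nhds e] with y hy
        exact hθ.zero_of_gt y hy
    · have := hid.const_mul ε⁻¹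
      simp only [inv_mul_eq_div] at this
      refine this.mono hε (le_of_eq ?_)
      rw [abs_of_pos (by positivity)]; field_simp
  have h3 : IsSymbol s ∅ ε (n + 1) C₄ (fun r => θ (√(r ^ 2 + z ^ 2))) := by
    refine H₄ s ∅ ε _ hne hε (by simp) ?_
    have h := (hid.mul hne hid).add (IsSymbol.const hε (z ^ 2))
    simp only [← pow_two] at h
    refine h.mono hε ?_
    rw [abs_of_nonneg (sq_nonneg z)]
    refine add_le_add (mul_le_mul_of_nonneg_left ?_ (by positivity)) hz
    nlinarith
  have h := ((h2.mul hne hid).mul hne h3).mul hne h1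
  convert h using 1
  · ring
  · ext r
    rw [radialAmp]; ring

lemma radialAmp_eq_zero (hθ : IsShellCutoff θ) {c ε β z : ℝ} (hc : 0 < c) (hε : 0 < ε) (hβ : 0 < β)
    (h : ¬ ∃ r₀ ∈ Set.Icc ε (4 * ε), z ^ 2 ≤ 16 ∧ β ≤ minorSq c (r₀ ^ 2) z ∧
      minorSq c (r₀ ^ 2) z ≤ 4 * β) {r : ℝ} (hr : 0 < r) : radialAmp θ c ε β z r = 0 := by
  have hS := minorSq_nonneg (z := z) hc.le (sq_nonneg r)
  by_contra h1
  refine h ⟨r, ?_, ?_, ?_⟩ <;> simp only [radialAmp, mul_eq_zero, not_or] at h1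
  · constructor
    · by_contra! h2
      exact h1.1.2 (hθ.zero_of_lt _ ((div_lt_one hε).2 h2) (by linarith [div_pos hr hε]))
    · by_contra! h2
      exact h1.1.2 (hθ.zero_of_gt _ ((lt_div_iff₀ hε).2 h2))
  · by_contra! h2
    refine h1.1.1.2 (hθ.zero_of_gt _ (Real.lt_sqrt_of_sq_lt ?_))
    nlinarith
  · constructor
    · by_contra! h2
      exact h1.2 (hθ.zero_of_lt _ ((div_lt_one hβ).2 h2) (by linarith [div_nonneg hS hβ.le]))
    · by_contra! h2
      exact h1.2 (hθ.zero_of_gt _ ((lt_div_iff₀ hβ).2 h2))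

lemma norm_radial_integral_le_sq (hθ : IsShellCutoff θ) : ∃ C > 0, ∀ c ε β z : ℝ, 0 < c → 0 < ε →
    ε ≤ 1 → 0 < β → ∀ P : ℝ → ℝ,
    ‖∫ r in (ε / 2)..(8 * ε), Complex.exp (Complex.I * (P r : ℂ)) * (radialAmp θ c ε β z r : ℂ)‖ ≤
      C * ε ^ 2 := by
  obtain ⟨C, hC, H⟩ := isSymbol_radialAmp 0 hθ
  refine ⟨8 * C, by positivity, fun c ε β z hc hε hε1 hβ P => ?_⟩
  by_cases h : ∃ r₀ ∈ Set.Icc ε (4 * ε), z ^ 2 ≤ 16 ∧ β ≤ minorSq c (r₀ ^ 2) z ∧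
      minorSq c (r₀ ^ 2) z ≤ 4 * β
  · obtain ⟨r₀, hr₀, hz, -, hS⟩ := h
    have hs := H c ε r₀ z β hc hε hε1 hβ hr₀ hz hS
    refine (intervalIntegral.norm_integral_le_of_norm_le_const (C := C * ε) fun r hr => ?_).trans ?_
    · rw [Set.uIoc_of_le (by linarith)] at hr
      rw [norm_mul, norm_cexp_I_mul_ofReal, one_mul, Complex.norm_real]
      exact hs.bound r ⟨hr.1.le, hr.2⟩
    · rw [abs_of_pos (by linarith)]
      have : 0 < C * ε := by positivity
      nlinarith
  · rw [intervalIntegral.integral_congr (g := fun _ => (0 : ℂ)) fun r hr => ?_]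
    · simp; positivity
    · rw [Set.uIcc_of_le (by linarith)] at hr
      rw [radialAmp_eq_zero hθ hc hε hβ h (by linarith [hr.1])]; simp

/-- Nonstationary phase along a horizontal ray. -/
theorem norm_radial_integral_le (hθ : IsShellCutoff θ) : ∃ C > 0, ∀ c ε β U t z y : ℝ, 0 < c → 0 < ε →
    ε ≤ 1 → 0 < β → 0 < U → U ^ 2 = c ^ 2 + β → 0 < t →
    512 * |y| * (β + c ^ 2 * ε ^ 2 / β) ≤ t * ε * U →
    ‖∫ r in (ε / 2)..(8 * ε), Complex.exp (Complex.I * ((t * halfSum c (r ^ 2) z + y * r : ℝ) : ℂ)) *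
      (radialAmp θ c ε β z r : ℂ)‖ ≤
      C * ε ^ 2 * ((t * ε ^ 2 * U / (β + c ^ 2 * ε ^ 2 / β)) ^ 2)⁻¹ := by
  obtain ⟨C₁, hC₁, H₁⟩ := isSymbol_radialAmp 1 hθ
  obtain ⟨C₂, hC₂, H₂⟩ := isSymbol_sqrt_sq_add 2
  set B := 16 + (2 ^ 2 * 8 * 2⁻¹ * C₂ * 64 + 1) with hB
  obtain ⟨C₃, hC₃, H₃⟩ := norm_integral_nonstationary_le 2 B
  refine ⟨C₃ * C₁ * 512 ^ 2, by positivity, fun c ε β U t z y hc hε hε1 hβ hU hUc ht hy => ?_⟩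
  have hE : 0 < β + c ^ 2 * ε ^ 2 / β := by positivity
  set E := β + c ^ 2 * ε ^ 2 / β with hEd
  by_cases h : ∃ r₀ ∈ Set.Icc ε (4 * ε), z ^ 2 ≤ 16 ∧ β ≤ minorSq c (r₀ ^ 2) z ∧
      minorSq c (r₀ ^ 2) z ≤ 4 * β
  swap
  · rw [intervalIntegral.integral_congr (g := fun _ => (0 : ℂ)) fun r hr => ?_]
    · simp; positivity
    · rw [Set.uIcc_of_le (by linarith)] at hr
      rw [radialAmp_eq_zero hθ hc hε hβ h (by linarith [hr.1])]; simp
  obtain ⟨r₀, hr₀, hz, hS, hS'⟩ := h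
  have hamp := H₁ c ε r₀ z β hc hε hε1 hβ hr₀ hz hS'
  obtain ⟨-, b1⟩ := H₂ ε r₀ (z + c) hε hr₀
  obtain ⟨-, b2⟩ := H₂ ε r₀ (z - c) hε hr₀
  set s := Set.Icc (ε / 2) (8 * ε) with hs
  have hne : s.Nonempty := ⟨ε, by constructor <;> linarith⟩
  have hr₀0 : 0 < r₀ := hε.trans_le hr₀.1
  have hd1 : 0 < √(r₀ ^ 2 + (z + c) ^ 2) := Real.sqrt_pos.2 (by positivity)
  have hd2 : 0 < √(r₀ ^ 2 + (z - c) ^ 2) := Real.sqrt_pos.2 (by positivity)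
  have hid : IsSymbol s ∅ ε 2 (8 * ε) (fun r => r) :=
    IsSymbol.id hε (fun r hr => by rw [abs_of_pos (by linarith [hr.1])]; exact hr.2) (by linarith)
  have hcomp := fun w r hr => sqrt_sq_add_comparable (ε := ε) (r₀ := r₀) (w := w) (r := r) hε hr₀ hr
  have c1 := hcomp (z + c)
  have c2 := hcomp (z - c)
  -- lower bound for the sum of the inverse distances
  have hsum : U / (8 * E) ≤ (√(r₀ ^ 2 + (z + c) ^ 2))⁻¹ + (√(r₀ ^ 2 + (z - c) ^ 2))⁻¹ := by
    have k1 := minorSq_mul_focalProd_sub (c := c) (z := z) (sq_nonneg r₀)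
    have k2 := minorSq_add_sq (c := c) (s := r₀ ^ 2) (z := z)
    have hsg : U ≤ halfSum c (r₀ ^ 2) z := by
      refine (sq_le_sq₀ hU.le halfSum_nonneg).1 ?_
      linarith
    have hr16 : r₀ ^ 2 ≤ 16 * ε ^ 2 := by nlinarith [hr₀.1, hr₀.2]
    have hfp : focalProd c (r₀ ^ 2) z ≤ 16 * E := by
      have h1 : focalProd c (r₀ ^ 2) z - minorSq c (r₀ ^ 2) z ≤ 16 * (c ^ 2 * ε ^ 2 / β) := by
        rw [← mul_div_assoc, le_div_iff₀ hβ]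
        have h0 := minorSq_le_focalProd (c := c) (z := z) (sq_nonneg r₀)
        nlinarith [mul_le_mul_of_nonneg_left hr16 (sq_nonneg c)]
      rw [hEd]; linarith
    unfold halfSum at hsg
    unfold focalProd at hfp
    set d₁ := √(r₀ ^ 2 + (z + c) ^ 2)
    set d₂ := √(r₀ ^ 2 + (z - c) ^ 2)
    have e : d₁⁻¹ + d₂⁻¹ = (d₁ + d₂) / (d₁ * d₂) := by field_simp; ring
    rw [e, div_le_div_iff₀ (by positivity) (by positivity)]
    calc U * (d₁ * d₂) ≤ ((d₁ + d₂) / 2) * (16 * E) := by gcongr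
      _ = _ := by ring
  set d₁ := √(r₀ ^ 2 + (z + c) ^ 2)
  set d₂ := √(r₀ ^ 2 + (z - c) ^ 2)
  set e := d₁⁻¹ + d₂⁻¹ with he
  have he0 : 0 < e := by positivity
  set l := t * ε * e / 64 with hl
  have hl0 : 0 < l := by positivity
  have hle : t * ε * U / (512 * E) ≤ l := by
    calc t * ε * U / (512 * E) = t * ε * (U / (8 * E)) / 64 := by field_simp; norm_num
      _ ≤ _ := by rw [hl]; gcongr
  have hyl : |y| ≤ l := by
    refine le_trans ?_ hle
    rw [le_div_iff₀ (by positivity)]; linarith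
  have hder : ∀ r ∈ s, HasDerivAt (fun r => t * halfSum c (r ^ 2) z + y * r)
      (t * (r * (2⁻¹ * ((√(r ^ 2 + (z + c) ^ 2))⁻¹ + (√(r ^ 2 + (z - c) ^ 2))⁻¹))) + y) r := by
    intro r hr
    have hr0 : 0 < r := by linarith [hr.1]
    have k1 := hasDerivAt_sqrt_sq_add (z + c) hr0
    have k2 := hasDerivAt_sqrt_sq_add (z - c) hr0
    refine ((((k1.add k2).div_const 2).const_mul t).add ((hasDerivAt_id r).const_mul y)).congr_deriv ?_
    ring
  have hsym : IsSymbol s ∅ ε 2 (B * l) (fun r =>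
      t * (r * (2⁻¹ * ((√(r ^ 2 + (z + c) ^ 2))⁻¹ + (√(r ^ 2 + (z - c) ^ 2))⁻¹))) + y) := by
    refine (((hid.mul hne ((b1.add b2).const_mul 2⁻¹)).const_mul t).add (IsSymbol.const hε y)).mono hε ?_
    rw [abs_of_pos ht, abs_of_pos (by norm_num : (0 : ℝ) < 2⁻¹)]
    have e1 : t * (2 ^ 2 * (8 * ε * (2⁻¹ * (C₂ * d₁⁻¹ + C₂ * d₂⁻¹)))) =
        2 ^ 2 * 8 * 2⁻¹ * C₂ * 64 * l := by rw [hl, he]; ring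
    rw [e1, hB]
    linarith
  have hlow : ∀ r ∈ s, l ≤
      t * (r * (2⁻¹ * ((√(r ^ 2 + (z + c) ^ 2))⁻¹ + (√(r ^ 2 + (z - c) ^ 2))⁻¹))) + y := by
    intro r hr
    have hr0 : 0 < r := by linarith [hr.1]
    have i1 : d₁⁻¹ / 8 ≤ (√(r ^ 2 + (z + c) ^ 2))⁻¹ := by
      calc d₁⁻¹ / 8 = (8 * d₁)⁻¹ := by rw [mul_inv]; ring
        _ ≤ _ := inv_anti₀ (Real.sqrt_pos.2 (by positivity)) (c1 r hr).2
    have i2 : d₂⁻¹ / 8 ≤ (√(r ^ 2 + (z - c) ^ 2))⁻¹ := by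
      calc d₂⁻¹ / 8 = (8 * d₂)⁻¹ := by rw [mul_inv]; ring
        _ ≤ _ := inv_anti₀ (Real.sqrt_pos.2 (by positivity)) (c2 r hr).2
    have h1 : 2 * l ≤
        t * (r * (2⁻¹ * ((√(r ^ 2 + (z + c) ^ 2))⁻¹ + (√(r ^ 2 + (z - c) ^ 2))⁻¹))) := by
      calc 2 * l = t * (ε / 2 * (2⁻¹ * (d₁⁻¹ / 8 + d₂⁻¹ / 8))) := by rw [hl, he]; ring
        _ ≤ _ := by
          gcongr
          exact hr.1
    linarith [neg_abs_le y]
  have := H₃ (ε / 2) (8 * ε) ε l (C₁ * ε) _ _ _ (by linarith) (by rw [hB]; nlinarith) hε hl0 hder hsym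
    hlow hamp
  refine this.trans ?_
  have h5 : (t * ε ^ 2 * U / E) ^ 2 ≤ 512 ^ 2 * (l * ε) ^ 2 := by
    rw [← mul_pow]
    gcongr
    calc t * ε ^ 2 * U / E = 512 * (t * ε * U / (512 * E) * ε) := by field_simp
      _ ≤ _ := by gcongr
  have h6 : 0 < t * ε ^ 2 * U / E := by positivity
  calc C₃ * (C₁ * ε) * ε * ((l * ε) ^ 2)⁻¹ = C₃ * C₁ * ε ^ 2 * (512 ^ 2 * (512 ^ 2 * (l * ε) ^ 2)⁻¹) := by
        rw [mul_inv]; ring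
    _ ≤ C₃ * C₁ * ε ^ 2 * (512 ^ 2 * ((t * ε ^ 2 * U / E) ^ 2)⁻¹) := by gcongr
    _ = _ := by ring

end Radial

section Cylindrical

lemma radialAmp_eq_zero_of_notMem {θ : ℝ → ℝ} (hθ : IsShellCutoff θ) {c ε β z r : ℝ} (hε : 0 < ε)
    (hr : 0 < r) (h : r ∉ Set.Icc ε (4 * ε)) : radialAmp θ c ε β z r = 0 := by
  have : θ (r / ε) = 0 := by
    by_contra h1
    refine h ⟨?_, ?_⟩
    · by_contra! h2
      exact h1 (hθ.zero_of_lt _ ((div_lt_one hε).2 h2) (by linarith [div_pos hr hε]))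
    · by_contra! h2
      exact h1 (hθ.zero_of_gt _ ((lt_div_iff₀ hε).2 h2))
  simp [radialAmp, this]

lemma norm_setIntegral_le_of_subset {f : ℝ → ℂ} {M a b : ℝ} (hab : a ≤ b) (h0 : ∀ z ∉ Set.Icc a b, f z = 0)
    (hM : ∀ z, ‖f z‖ ≤ M) (s : Set ℝ) (hs : MeasurableSet s) : ‖∫ z in s, f z‖ ≤ M * (b - a) := by
  have hM0 : 0 ≤ M := (norm_nonneg _).trans (hM 0)
  have e : ∫ z in s, f z = ∫ z in s ∩ Set.Icc a b, f z := by
    refine (setIntegral_eq_of_subset_of_forall_sdiff_eq_zero hs Set.inter_subset_left ?_)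
    exact fun z hz => h0 z fun h => hz.2 ⟨hz.1, h⟩
  rw [e]
  have hv : volume (s ∩ Set.Icc a b) ≤ ENNReal.ofReal (b - a) :=
    (measure_mono Set.inter_subset_right).trans (Real.volume_Icc (a := a) (b := b)).le
  refine (norm_setIntegral_le_of_norm_le_const (hv.trans_lt ENNReal.ofReal_lt_top)
    (fun z _ => hM z)).trans ?_
  gcongr
  rw [measureReal_def]
  exact ENNReal.toReal_le_of_le_ofReal (by linarith) hv

/-- An integral over `ℝ³` is controlled by its integrals along horizontal rays. -/
lemma norm_integral_le_of_radial {G : E3 → ℂ} {M R : ℝ} (hR : 0 ≤ R)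
    (h0 : ∀ ξ : E3, ξ 2 ∉ Set.Icc (-R) R → G ξ = 0)
    (h : ∀ z a : ℝ, ‖∫ r in Set.Ioi (0 : ℝ), (r : ℂ) *
      G (ofCoords ((r * Real.cos a, r * Real.sin a), z))‖ ≤ M) :
    ‖∫ ξ, G ξ‖ ≤ 4 * Real.pi * R * M := by
  have hM0 : 0 ≤ M := (norm_nonneg _).trans (h 0 0)
  have hπ := Real.pi_pos
  rw [← integral_ofCoords]
  by_cases hi : Integrable fun q => G (ofCoords q)
  swap
  · rw [integral_undef hi, norm_zero]; positivity
  have hplane : ∀ z, ‖∫ p : ℝ × ℝ, G (ofCoords (p, z))‖ ≤ M * (2 * Real.pi) := by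
    intro z
    rw [← integral_comp_polarCoord_symm]
    by_cases hj : IntegrableOn (fun p : ℝ × ℝ => p.1 • G (ofCoords (polarCoord.symm p, z)))
      polarCoord.target
    swap
    · rw [integral_undef hj, norm_zero]; positivity
    rw [polarCoord_target] at hj ⊢
    rw [IntegrableOn, Measure.volume_eq_prod, ← Measure.prod_restrict] at hj
    rw [Measure.volume_eq_prod, ← Measure.prod_restrict]
    rw [integral_prod_symm _ hj]
    refine (norm_setIntegral_le_of_norm_le_const (C := M) (by simp) fun a _ => ?_).trans (le_of_eq ?_)
    · refine le_of_eq_of_le ?_ (h z a)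
      congr 1
    · rw [Real.volume_real_Ioo_of_le (by linarith)]; ring
  rw [Measure.volume_eq_prod] at hi ⊢
  rw [integral_prod_symm _ hi]
  have := norm_setIntegral_le_of_subset (f := fun z => ∫ p : ℝ × ℝ, G (ofCoords (p, z)))
    (a := -R) (b := R) (by linarith)
    (fun z hz => by simp [fun p => h0 (ofCoords (p, z)) hz]) hplane Set.univ MeasurableSet.univ
  rw [setIntegral_univ] at this
  refine this.trans (le_of_eq (by ring))

variable {θ : ℝ → ℝ}

lemma norm_oscInt_piece_le_of_radial (hθ : IsShellCutoff θ) {c ε β t M : ℝ} (hε : 0 < ε)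
    (x : E3)
    (h : ∀ z y : ℝ, |y| ≤ nrmh x → ‖∫ r in (ε / 2)..(8 * ε),
      Complex.exp (Complex.I * ((t * halfSum c (r ^ 2) z + y * r : ℝ) : ℂ)) *
      (radialAmp θ c ε β z r : ℂ)‖ ≤ M) :
    ‖oscInt (pieceSymbol θ c β t ε⁻¹) x‖ ≤ 16 * Real.pi * M := by
  have := norm_integral_le_of_radial (M := M) (R := 4)
    (G := fun ξ => Complex.exp (Complex.I * (dot3 x ξ : ℂ)) * pieceSymbol θ c β t ε⁻¹ ξ) (by norm_num)
    (fun ξ hξ => ?_) (fun z a => ?_)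
  · refine this.trans (le_of_eq (by ring))
  · rw [pieceSymbol, hθ.zero_of_gt ‖ξ‖]
    · simp
    · rw [Set.mem_Icc, ← abs_le, not_le] at hξ
      refine hξ.trans_le ?_
      simpa using PiLp.norm_apply_le ξ 2
  set y := x 0 * Real.cos a + x 1 * Real.sin a with hy
  have hyx : |y| ≤ nrmh x := by
    refine Real.abs_le_sqrt ?_
    have e : x 0 ^ 2 + x 1 ^ 2 - y ^ 2 = (x 0 * Real.sin a - x 1 * Real.cos a) ^ 2 := by
      rw [hy]
      linear_combination (-(x 0 ^ 2 + x 1 ^ 2)) * Real.sin_sq_add_cos_sq a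
    nlinarith [sq_nonneg (x 0 * Real.sin a - x 1 * Real.cos a)]
  have key : ∀ r ∈ Set.Ioi (0 : ℝ), (r : ℂ) *
      (Complex.exp (Complex.I * (dot3 x (ofCoords ((r * Real.cos a, r * Real.sin a), z)) : ℂ)) *
        pieceSymbol θ c β t ε⁻¹ (ofCoords ((r * Real.cos a, r * Real.sin a), z))) =
      Complex.exp (Complex.I * ((x 2 * z : ℝ) : ℂ)) *
        (Complex.exp (Complex.I * ((t * halfSum c (r ^ 2) z + y * r : ℝ) : ℂ)) *
          (radialAmp θ c ε β z r : ℂ)) := by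
    intro r hr
    have e0 : (r * Real.cos a) ^ 2 + (r * Real.sin a) ^ 2 = r ^ 2 := by
      linear_combination r ^ 2 * Real.sin_sq_add_cos_sq a
    have e1 : nrmh (ofCoords ((r * Real.cos a, r * Real.sin a), z)) = r := by
      rw [nrmh, ofCoords_zero, ofCoords_one]
      simp only [e0]
      exact Real.sqrt_sq (le_of_lt hr)
    have e2 : ‖ofCoords ((r * Real.cos a, r * Real.sin a), z)‖ = √(r ^ 2 + z ^ 2) := by
      rw [← Real.sqrt_sq (norm_nonneg _), norm_sq_eq, ofCoords_zero, ofCoords_one, ofCoords_two]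
      simp only [e0]
    have e3 : dot3 x (ofCoords ((r * Real.cos a, r * Real.sin a), z)) = x 2 * z + y * r := by
      simp only [dot3, ofCoords_zero, ofCoords_one, ofCoords_two]; ring
    rw [pieceSymbol, shellSymbol, e1, e2, e3, ofCoords_zero, ofCoords_one, ofCoords_two]
    simp only [e0]
    rw [radialAmp, inv_mul_eq_div, Complex.ofReal_add, mul_add, Complex.exp_add,
      Complex.ofReal_add (t * _), mul_add, Complex.exp_add]
    push_cast
    ring
  rw [setIntegral_congr_fun measurableSet_Ioi key, integral_const_mul, norm_mul,
    norm_cexp_I_mul_ofReal, one_mul]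
  refine le_of_eq_of_le ?_ (h z y hyx)
  rw [intervalIntegral.integral_of_le (by linarith)]
  congr 1
  refine setIntegral_eq_of_subset_of_forall_sdiff_eq_zero measurableSet_Ioi
    (fun r hr => lt_trans (by linarith) hr.1) fun r hr => ?_
  rw [radialAmp_eq_zero_of_notMem hθ hε hr.1 fun h => hr.2 ⟨?_, ?_⟩]
  · simp
  · linarith [h.1]
  · linarith [h.2]

end Cylindrical

section PieceBound

variable {θ : ℝ → ℝ}

set_option maxHeartbeats 1600000 in
/-- Dispersive decay of a single piece. -/
theorem norm_oscInt_piece_le (hθ : IsShellCutoff θ) : ∃ C > 0, ∀ c β U t ε D : ℝ, 0 < c → 0 < β →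
    0 < U → U ^ 2 = c ^ 2 + β → 0 < t → 0 < ε → ε ≤ 1 → ε ^ 2 ≤ 4 * β →
    D = (β + c ^ 2 * ε ^ 2 / β) / U → ∀ x : E3,
    ‖oscInt (pieceSymbol θ c β t ε⁻¹) x‖ ≤
      C * (t * √t * ε)⁻¹ * (D * √D + D * (U ^ 2 * √U) / c + √D * U ^ 2) := by
  obtain ⟨C₁, hC₁, H₁⟩ := norm_radial_integral_le_sq hθ
  obtain ⟨C₂, hC₂, H₂⟩ := norm_radial_integral_le hθ
  obtain ⟨C₃, hC₃, H₃⟩ := nrmh_mul_norm_piece_le hθ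
  have hπ := Real.pi_pos
  set C := 128 * Real.pi * C₁ + 16 * Real.pi * C₂ + 512 * C₃ with hC
  refine ⟨C, by positivity, fun c β U t ε D hc hβ hU hUc ht hε hε1 hεβ hD x => ?_⟩
  have hE : 0 < β + c ^ 2 * ε ^ 2 / β := by positivity
  have hD0 : 0 < D := by rw [hD]; positivity
  have hEU : β + c ^ 2 * ε ^ 2 / β = D * U := by rw [hD]; field_simp
  set q := √D with hq
  set s := √t with hs
  have hq0 : 0 < q := Real.sqrt_pos.2 hD0
  have hs0 : 0 < s := Real.sqrt_pos.2 ht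
  have hDq : D = q ^ 2 := (Real.sq_sqrt hD0.le).symm
  have hts : t = s ^ 2 := (Real.sq_sqrt ht.le).symm
  set X := ‖oscInt (pieceSymbol θ c β t ε⁻¹) x‖ with hX
  have hX0 : 0 ≤ X := norm_nonneg _
  set W := U ^ 2 * √U with hW
  have hW0 : 0 < W := by positivity
  have i0 : 0 < (t * s * ε)⁻¹ := by positivity
  have p1 : 0 < D * q := by positivity
  have p2 : 0 < D * W / c := by positivity
  have p3 : 0 < q * U ^ 2 := by positivity
  set F := D * q + D * W / c + q * U ^ 2 with hF
  have hF0 : 0 < F := by positivity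
  rcases le_or_gt (ε * s) (2 * q) with hτ | hτ
  · have h1 : X ≤ 16 * Real.pi * (C₁ * ε ^ 2) :=
      norm_oscInt_piece_le_of_radial hθ hε x fun z y _ => H₁ c ε β z hc hε hε1 hβ _
    have h2 : ε ^ 2 ≤ 8 * ((t * s * ε)⁻¹ * (D * q)) := by
      rw [inv_mul_eq_div, ← mul_div_assoc, le_div_iff₀ (by positivity)]
      calc ε ^ 2 * (t * s * ε) = (ε * s) ^ 3 := by rw [hts]; ring
        _ ≤ (2 * q) ^ 3 := by gcongr
        _ = _ := by rw [hDq]; ring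
    calc X ≤ 16 * Real.pi * (C₁ * ε ^ 2) := h1
      _ ≤ 16 * Real.pi * (C₁ * (8 * ((t * s * ε)⁻¹ * (D * q)))) := by gcongr
      _ = 128 * Real.pi * C₁ * (t * s * ε)⁻¹ * (D * q) := by ring
      _ ≤ C * (t * s * ε)⁻¹ * F := by
        gcongr
        · rw [hC]
          have : 0 < 16 * Real.pi * C₂ := by positivity
          linarith
        · rw [hF]; linarith
  rcases le_or_gt (512 * nrmh x * (β + c ^ 2 * ε ^ 2 / β)) (t * ε * U) with hh | hh
  · have h1 := norm_oscInt_piece_le_of_radial hθ hε x fun z y hy => H₂ c ε β U t z y hc hε hε1 hβ hU hUc ht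
      (le_trans (by gcongr) hh)
    rw [← hX] at h1
    have h2 : ε ^ 2 * ((t * ε ^ 2 * U / (β + c ^ 2 * ε ^ 2 / β)) ^ 2)⁻¹ ≤ (t * s * ε)⁻¹ * (D * q) := by
      rw [hEU, hDq, hts]
      have e : ε ^ 2 * ((s ^ 2 * ε ^ 2 * U / (q ^ 2 * U)) ^ 2)⁻¹ =
          (s ^ 2 * s * ε)⁻¹ * (q ^ 2 * q) * (q / (ε * s)) := by
        field_simp
      rw [e]
      refine mul_le_of_le_one_right (by positivity) ?_
      rw [div_le_one (by positivity)]; linarith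
    calc X ≤ 16 * Real.pi * C₂ * (ε ^ 2 * ((t * ε ^ 2 * U / (β + c ^ 2 * ε ^ 2 / β)) ^ 2)⁻¹) :=
          h1.trans (le_of_eq (by ring))
      _ ≤ 16 * Real.pi * C₂ * ((t * s * ε)⁻¹ * (D * q)) := by gcongr
      _ = 16 * Real.pi * C₂ * (t * s * ε)⁻¹ * (D * q) := by ring
      _ ≤ C * (t * s * ε)⁻¹ * F := by
        gcongr
        · rw [hC]
          have : 0 < 128 * Real.pi * C₁ := by positivity
          linarith
        · rw [hF]; linarith
  · have hT : 1 / 4 ≤ t * (β / U) := by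
      have h1 : 4 * D ≤ t * ε ^ 2 := by
        rw [hDq, hts]
        nlinarith
      have h2 : β * (β + c ^ 2 * ε ^ 2 / β) = β ^ 2 + c ^ 2 * ε ^ 2 := by field_simp
      rw [← mul_div_assoc, le_div_iff₀ hU]
      have h3 : ε ^ 2 * U * U ≤ 4 * (t * β) * (ε ^ 2 * U) := by
        calc ε ^ 2 * U * U = ε ^ 2 * c ^ 2 + ε ^ 2 * β := by rw [mul_assoc, ← sq, hUc]; ring
          _ ≤ 4 * (4 * (β ^ 2 + c ^ 2 * ε ^ 2)) := by nlinarith [mul_pos (sq_pos_of_pos hε) (sq_pos_of_pos hc)]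
          _ = 4 * (4 * D * (U * β)) := by rw [← h2, hEU]; ring
          _ ≤ 4 * (t * ε ^ 2 * (U * β)) := by gcongr
          _ = _ := by ring
      have h4 : 0 < ε ^ 2 * U := by positivity
      nlinarith
    have h1 := H₃ c β U t ε⁻¹ hc hβ hU hUc ht hT (by rw [one_le_inv₀ hε]; exact hε1) x
    rw [← hX, ← hW, ← hs] at h1
    rw [hEU] at hh
    have h2 : t * ε * X ≤ 512 * D * (C₃ * (W / (c * s) + ε⁻¹ * (U ^ 2 / t))) := by
      have : t * ε * U * X ≤ 512 * D * U * (nrmh x * X) := by nlinarith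
      have h3 : t * ε * U * X ≤ 512 * D * U * (C₃ * (W / (c * s) + ε⁻¹ * (U ^ 2 / t))) :=
        this.trans (by gcongr)
      have h4 : U * (t * ε * X) ≤ U * (512 * D * (C₃ * (W / (c * s) + ε⁻¹ * (U ^ 2 / t)))) := by linarith
      exact le_of_mul_le_mul_left h4 hU
    have h3 : X ≤ (t * ε)⁻¹ * (512 * D * (C₃ * (W / (c * s) + ε⁻¹ * (U ^ 2 / t)))) := by
      rw [inv_mul_eq_div, le_div_iff₀ (by positivity)]; linarith
    have h4 : (t * ε)⁻¹ * (D * (ε⁻¹ * (U ^ 2 / t))) ≤ (t * s * ε)⁻¹ * (q * U ^ 2) := by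
      rw [hDq, hts]
      have e : (s ^ 2 * ε)⁻¹ * (q ^ 2 * (ε⁻¹ * (U ^ 2 / s ^ 2))) =
          (s ^ 2 * s * ε)⁻¹ * (q * U ^ 2) * (q / (ε * s)) := by
        field_simp
      rw [e]
      refine mul_le_of_le_one_right (by positivity) ?_
      rw [div_le_one (by positivity)]; linarith
    have e5 : (t * ε)⁻¹ * (D * (W / (c * s))) = (t * s * ε)⁻¹ * (D * W / c) := by
      field_simp
    calc X ≤ 512 * C₃ * ((t * ε)⁻¹ * (D * (W / (c * s))) + (t * ε)⁻¹ * (D * (ε⁻¹ * (U ^ 2 / t)))) :=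
          h3.trans (le_of_eq (by ring))
      _ ≤ 512 * C₃ * ((t * s * ε)⁻¹ * (D * W / c) + (t * s * ε)⁻¹ * (q * U ^ 2)) := by
        rw [e5]; gcongr
      _ = 512 * C₃ * (t * s * ε)⁻¹ * (D * W / c + q * U ^ 2) := by ring
      _ ≤ C * (t * s * ε)⁻¹ * F := by
        gcongr
        · rw [hC]
          have : 0 < 128 * Real.pi * C₁ := by positivity
          have : 0 < 16 * Real.pi * C₂ := by positivity
          linarith
        · rw [hF]; linarith

end PieceBound

/-- The half-wave amplitude with radial and horizontal localisation. -/
def waveSymbol (θ : ℝ → ℝ) (c t σ : ℝ) (ξ : E3) : ℂ :=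
  Complex.exp (Complex.I * ((t * halfSum c (ξ 0 ^ 2 + ξ 1 ^ 2) (ξ 2) : ℝ) : ℂ)) *
    (θ ‖ξ‖ : ℂ) * (θ (σ * nrmh ξ) : ℂ)

lemma sum_lpBump_div {ψ : ℝ → ℝ} (hψ : IsCutoff ψ) {b y : ℝ} (hb : 0 < b) {n : ℕ} (h1 : 2 * b < y)
    (h2 : y ≤ b * 2 ^ n) : ∑ i ∈ Finset.range n, lpBump ψ (y / (b * 2 ^ i)) = 1 := by
  have e : ∀ i : ℕ, lpBump ψ (y / (b * 2 ^ i)) =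
      (fun i : ℕ => ψ (y / (b * 2 ^ i))) (i + 1) - (fun i : ℕ => ψ (y / (b * 2 ^ i))) i := fun i => by
    simp only [lpBump, pow_succ]
    rw [div_div]; congr 3; ring
  rw [Finset.sum_congr rfl fun i _ => e i, Finset.sum_range_sub (fun i : ℕ => ψ (y / (b * 2 ^ i))) n]
  have hy : 0 < y := by linarith
  rw [hψ.2.2.2, hψ.2.2.1, sub_zero]
  · rw [pow_zero, mul_one, abs_of_pos (by positivity), lt_div_iff₀ hb]; exact h1
  · rw [abs_of_pos (by positivity), div_le_one (by positivity)]; exact h2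

lemma waveSymbol_eq_sum {ψ : ℝ → ℝ} (hψ : IsCutoff ψ) {b c t σ : ℝ} {n : ℕ} (hb : 0 < b) {ξ : E3}
    (h : lpBump ψ ‖ξ‖ ≠ 0 → lpBump ψ (σ * nrmh ξ) ≠ 0 →
      2 * b < minorSq c (ξ 0 ^ 2 + ξ 1 ^ 2) (ξ 2) ∧ minorSq c (ξ 0 ^ 2 + ξ 1 ^ 2) (ξ 2) ≤ b * 2 ^ n) :
    waveSymbol (lpBump ψ) c t σ ξ =
      ∑ i ∈ Finset.range n, pieceSymbol (lpBump ψ) c (b * 2 ^ i) t σ ξ := by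
  by_cases h1 : lpBump ψ ‖ξ‖ = 0
  · simp [waveSymbol, pieceSymbol, h1]
  by_cases h2 : lpBump ψ (σ * nrmh ξ) = 0
  · simp [waveSymbol, pieceSymbol, h2]
  obtain ⟨h3, h4⟩ := h h1 h2
  simp only [waveSymbol, pieceSymbol, shellSymbol]
  rw [← Finset.sum_mul, ← Finset.sum_mul, ← Finset.mul_sum, ← Complex.ofReal_sum,
    sum_lpBump_div hψ hb h3 h4, Complex.ofReal_one, mul_one]

lemma integrable_cexp_mul_pieceSymbol {θ : ℝ → ℝ} (hθ : IsShellCutoff θ)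
    (c β t σ : ℝ) (x : E3) :
    Integrable fun ξ : E3 => Complex.exp (Complex.I * (dot3 x ξ : ℂ)) * pieceSymbol θ c β t σ ξ := by
  have h1 := continuous_shellSymbol hθ c β t
  have h2 := hθ.contDiff.continuous
  have h3 := continuous_nrmh
  have h4 := continuous_dot3 x
  refine Continuous.integrable_of_hasCompactSupport (by unfold pieceSymbol; fun_prop) ?_
  refine HasCompactSupport.intro (isCompact_closedBall (0 : E3) 4) fun ξ hξ => ?_
  rw [mem_closedBall_zero_iff, not_le] at hξ
  simp [pieceSymbol, hθ.zero_of_gt _ hξ]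

/-- Bound of a localised wave by its dyadic shells. -/
lemma norm_oscInt_waveSymbol_le_sum {ψ : ℝ → ℝ} (hψ : IsCutoff ψ) {b c t σ : ℝ} {n : ℕ} (hb : 0 < b)
    (h : ∀ ξ : E3, lpBump ψ ‖ξ‖ ≠ 0 → lpBump ψ (σ * nrmh ξ) ≠ 0 →
      2 * b < minorSq c (ξ 0 ^ 2 + ξ 1 ^ 2) (ξ 2) ∧ minorSq c (ξ 0 ^ 2 + ξ 1 ^ 2) (ξ 2) ≤ b * 2 ^ n)
    (x : E3) :
    ‖oscInt (waveSymbol (lpBump ψ) c t σ) x‖ ≤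
      ∑ i ∈ Finset.range n, ‖oscInt (pieceSymbol (lpBump ψ) c (b * 2 ^ i) t σ) x‖ := by
  have e : oscInt (waveSymbol (lpBump ψ) c t σ) x =
      ∑ i ∈ Finset.range n, oscInt (pieceSymbol (lpBump ψ) c (b * 2 ^ i) t σ) x := by
    unfold oscInt
    rw [← integral_finsetSum]
    · congr 1; ext ξ
      rw [waveSymbol_eq_sum hψ hb (h ξ), Finset.mul_sum]
    · exact fun i _ => integrable_cexp_mul_pieceSymbol hψ.isShellCutoff c _ t σ x
  rw [e]; exact norm_sum_le _ _

lemma IsShellCutoff.mem_Icc {θ : ℝ → ℝ} (hθ : IsShellCutoff θ) {y : ℝ} (hy : 0 ≤ y) (h : θ y ≠ 0) :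
    1 ≤ y ∧ y ≤ 4 := by
  constructor
  · by_contra! h1; exact h (hθ.zero_of_lt y h1 (by linarith))
  · by_contra! h1; exact h (hθ.zero_of_gt y h1)

lemma localised_bounds {θ : ℝ → ℝ} (hθ : IsShellCutoff θ) {ε : ℝ} (hε : 0 < ε) {ξ : E3}
    (h1 : θ ‖ξ‖ ≠ 0) (h2 : θ (ε⁻¹ * nrmh ξ) ≠ 0) :
    1 ≤ ξ 0 ^ 2 + ξ 1 ^ 2 + ξ 2 ^ 2 ∧ ξ 0 ^ 2 + ξ 1 ^ 2 + ξ 2 ^ 2 ≤ 16 ∧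
      ε ^ 2 ≤ ξ 0 ^ 2 + ξ 1 ^ 2 ∧ ξ 0 ^ 2 + ξ 1 ^ 2 ≤ 16 * ε ^ 2 := by
  have h3 := hθ.mem_Icc (norm_nonneg _) h1
  have hn : 0 ≤ nrmh ξ := Real.sqrt_nonneg _
  have h4 := hθ.mem_Icc (by positivity) h2
  rw [inv_mul_eq_div, le_div_iff₀ hε, div_le_iff₀ hε, one_mul] at h4
  have h5 : nrmh ξ ^ 2 = ξ 0 ^ 2 + ξ 1 ^ 2 := Real.sq_sqrt (by positivity)
  rw [← norm_sq_eq, ← h5]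
  exact ⟨by nlinarith, by nlinarith, by nlinarith, by nlinarith⟩

/-- Decay of the localised wave for a short focal distance. -/
theorem norm_oscInt_waveSymbol_le_of_le {ψ : ℝ → ℝ} (hψ : IsCutoff ψ) : ∃ C > 0, ∀ c t ε : ℝ,
    0 < c → c ≤ 1 / 16 → 0 < t → 0 < ε → ε ≤ 1 → ∀ x : E3,
      ‖oscInt (waveSymbol (lpBump ψ) c t ε⁻¹) x‖ ≤ C * (t * √t * ε)⁻¹ * c⁻¹ := by
  obtain ⟨C, hC, H⟩ := norm_oscInt_piece_le hψ.isShellCutoff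
  refine ⟨6 * C * 1000, by positivity, fun c t ε hc hc1 ht hε hε1 x => ?_⟩
  have h := norm_oscInt_waveSymbol_le_sum hψ (b := 1 / 4) (n := 6) (c := c) (t := t) (σ := ε⁻¹)
    (by norm_num) (fun ξ k1 k2 => by
      obtain ⟨a1, a2, a3, a4⟩ := localised_bounds hψ.isShellCutoff hε k1 k2
      have h0 : 0 ≤ ξ 0 ^ 2 + ξ 1 ^ 2 := by positivity
      have b1 := minorSq_le (z := ξ 2) h0 hc.le
      have b2 := le_minorSq (c := c) (z := ξ 2) h0
      constructor
      · nlinarith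
      · norm_num; linarith) x
  refine h.trans ((Finset.sum_le_card_nsmul _ _ (C * (t * √t * ε)⁻¹ * (1000 * c⁻¹)) fun i hi => ?_).trans
    (le_of_eq ?_))
  swap
  · rw [Finset.card_range, nsmul_eq_mul]; push_cast; ring
  have hi' : i ≤ 5 := by have := Finset.mem_range.1 hi; omega
  set β : ℝ := 1 / 4 * 2 ^ i with hβ
  have k1 : (1 : ℝ) ≤ 2 ^ i := one_le_pow₀ (by norm_num)
  have k2 : (2 : ℝ) ^ i ≤ 2 ^ 5 := pow_le_pow_right₀ (by norm_num) hi'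
  have k3 : 1 / 4 ≤ β := by rw [hβ]; linarith
  have k4 : β ≤ 8 := by rw [hβ]; norm_num at k2; linarith
  have hβ0 : 0 < β := by linarith
  set U := √(c ^ 2 + β) with hU
  have hU2 : U ^ 2 = c ^ 2 + β := Real.sq_sqrt (by positivity)
  have hU0 : 0 < U := Real.sqrt_pos.2 (by positivity)
  have hUl : 1 / 2 ≤ U := Real.le_sqrt_of_sq_le (by nlinarith)
  have hUu : U ≤ 3 := Real.sqrt_le_iff.2 ⟨by norm_num, by nlinarith⟩
  have hε2 : ε ^ 2 ≤ 1 := by nlinarith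
  refine (H c β U t ε _ hc hβ0 hU0 hU2 ht hε hε1 (by linarith) rfl x).trans ?_
  set D := (β + c ^ 2 * ε ^ 2 / β) / U with hD
  have hD0 : 0 < D := by positivity
  have hDu : D ≤ 25 := by
    rw [hD, div_le_iff₀ hU0]
    have : c ^ 2 * ε ^ 2 / β ≤ 1 := by
      rw [div_le_one hβ0]
      have : c ^ 2 ≤ 1 / 4 := by nlinarith
      nlinarith [sq_nonneg ε, sq_nonneg c]
    linarith
  have hDs : √D ≤ 5 := Real.sqrt_le_iff.2 ⟨by norm_num, by linarith⟩
  have hUs : √U ≤ 2 := Real.sqrt_le_iff.2 ⟨by norm_num, by linarith⟩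
  have hc' : 1 ≤ c⁻¹ := (one_le_inv₀ hc).2 (by linarith)
  gcongr
  calc D * √D + D * (U ^ 2 * √U) / c + √D * U ^ 2
      ≤ 25 * 5 + 25 * (3 ^ 2 * 2) / c + 5 * 3 ^ 2 := by gcongr
    _ = 170 + 450 * c⁻¹ := by ring
    _ ≤ 1000 * c⁻¹ := by linarith

/-- Decay of the localised wave for a long focal distance. -/
theorem norm_oscInt_waveSymbol_le_of_ge {ψ : ℝ → ℝ} (hψ : IsCutoff ψ) : ∃ C > 0, ∀ c t ε : ℝ,
    16 ≤ c → 0 < t → 0 < ε → ε ≤ 1 → ∀ x : E3,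
      ‖oscInt (waveSymbol (lpBump ψ) c t ε⁻¹) x‖ ≤ C * (t * √t * ε)⁻¹ * (c ^ 2 * √c) := by
  obtain ⟨C, hC, H⟩ := norm_oscInt_piece_le hψ.isShellCutoff
  refine ⟨7 * C * 67, by positivity, fun c t ε hc1 ht hε hε1 x => ?_⟩
  have hc : 0 < c := by linarith
  have hε2 : ε ^ 2 ≤ 1 := by nlinarith
  have h := norm_oscInt_waveSymbol_le_sum hψ (b := ε ^ 2 / 4) (n := 7) (c := c) (t := t) (σ := ε⁻¹)
    (by positivity) (fun ξ k1 k2 => by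
      obtain ⟨a1, a2, a3, a4⟩ := localised_bounds hψ.isShellCutoff hε k1 k2
      have h0 : 0 ≤ ξ 0 ^ 2 + ξ 1 ^ 2 := by positivity
      have b1 := minorSq_ge_radial (z := ξ 2) h0 hc.le
      have b2 := minorSq_mul_focalProd_sub (c := c) (z := ξ 2) h0
      have b3 := focalProd_eq (c := c) (z := ξ 2) h0
      have b4 := minorSq_nonneg (z := ξ 2) hc.le h0
      constructor
      · have := sq_pos_of_pos hε
        linarith
      · set S := minorSq c (ξ 0 ^ 2 + ξ 1 ^ 2) (ξ 2)
        have b5 : c ^ 2 / 2 ≤ focalProd c (ξ 0 ^ 2 + ξ 1 ^ 2) (ξ 2) - S := by nlinarith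
        have b6 : c ^ 2 * S ≤ c ^ 2 * (32 * ε ^ 2) := by nlinarith [mul_le_mul_of_nonneg_left b5 b4]
        have b7 := le_of_mul_le_mul_left b6 (by positivity)
        linarith) x
  refine h.trans ((Finset.sum_le_card_nsmul _ _ (C * (t * √t * ε)⁻¹ * (67 * (c ^ 2 * √c)))
    fun i hi => ?_).trans (le_of_eq ?_))
  swap
  · rw [Finset.card_range, nsmul_eq_mul]; push_cast; ring
  have hi' : i ≤ 6 := by have := Finset.mem_range.1 hi; omega
  set β : ℝ := ε ^ 2 / 4 * 2 ^ i with hβ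
  have k1 : (1 : ℝ) ≤ 2 ^ i := one_le_pow₀ (by norm_num)
  have k2 : (2 : ℝ) ^ i ≤ 2 ^ 6 := pow_le_pow_right₀ (by norm_num) hi'
  have hβ0 : 0 < β := by positivity
  have k3 : ε ^ 2 / 4 ≤ β := le_mul_of_one_le_right (by positivity) k1
  have k4 : β ≤ 16 := by
    calc β ≤ 1 / 4 * 2 ^ 6 := by rw [hβ]; gcongr
      _ = 16 := by norm_num
  set U := √(c ^ 2 + β) with hU
  have hU2 : U ^ 2 = c ^ 2 + β := Real.sq_sqrt (by positivity)
  have hU0 : 0 < U := Real.sqrt_pos.2 (by positivity)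
  have hUl : c ≤ U := Real.le_sqrt_of_sq_le (by linarith)
  have hUu : U ≤ 2 * c := Real.sqrt_le_iff.2 ⟨by linarith, by nlinarith⟩
  refine (H c β U t ε _ hc hβ0 hU0 hU2 ht hε hε1 (by linarith) rfl x).trans ?_
  set D := (β + c ^ 2 * ε ^ 2 / β) / U with hD
  have hD0 : 0 < D := by positivity
  have hDu : D ≤ 5 * c := by
    rw [hD, div_le_iff₀ hU0]
    have : c ^ 2 * ε ^ 2 / β ≤ 4 * c ^ 2 := by
      rw [div_le_iff₀ hβ0]
      nlinarith [sq_nonneg c]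
    nlinarith
  set w := √c with hw
  have hw0 : 0 < w := Real.sqrt_pos.2 hc
  have hcw : w ^ 2 = c := Real.sq_sqrt hc.le
  have hDs : √D ≤ 3 * w := Real.sqrt_le_iff.2 ⟨by positivity, by rw [mul_pow, hcw]; linarith⟩
  have hUs : √U ≤ 2 * w := Real.sqrt_le_iff.2 ⟨by positivity, by rw [mul_pow, hcw]; linarith⟩
  gcongr
  calc D * √D + D * (U ^ 2 * √U) / c + √D * U ^ 2
      ≤ 5 * c * (3 * w) + 5 * c * ((2 * c) ^ 2 * (2 * w)) / c + 3 * w * (2 * c) ^ 2 := by gcongr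
    _ = 15 * c * w + 52 * (c ^ 2 * w) := by field_simp; ring
    _ ≤ 67 * (c ^ 2 * w) := by nlinarith [mul_pos hc hw0]

/-- Decay of the localised wave for a focal distance of order one. -/
theorem norm_oscInt_waveSymbol_le_of_mem_Icc {ψ : ℝ → ℝ} (hψ : IsCutoff ψ) : ∃ C > 0, ∀ c t ε : ℝ,
    1 / 16 ≤ c → c ≤ 16 → 0 < t → 0 < ε → ε ≤ 1 → ∀ n : ℕ, ε ^ 2 * 2 ^ n = 64 → ∀ x : E3,
      ‖oscInt (waveSymbol (lpBump ψ) c t ε⁻¹) x‖ ≤ C * (t * √t * ε)⁻¹ := by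
  obtain ⟨C, hC, H⟩ := norm_oscInt_piece_le hψ.isShellCutoff
  set r := √(2 : ℝ) with hr
  have hr0 : 0 < r := by positivity
  have hr2 : r ^ 2 = 2 := Real.sq_sqrt (by norm_num)
  have hr1 : 1.4 < r := Real.lt_sqrt_of_sq_lt (by norm_num)
  refine ⟨C * 4000000 * 1000, by positivity, fun c t ε hc1 hc2 ht hε hε1 n hn x => ?_⟩
  have hc : 0 < c := by linarith
  have hε2 : ε ^ 2 ≤ 1 := by nlinarith
  have h := norm_oscInt_waveSymbol_le_sum hψ (b := ε ^ 2 / 4) (n := n) (c := c) (t := t) (σ := ε⁻¹)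
    (by positivity) (fun ξ k1 k2 => by
      obtain ⟨a1, a2, a3, a4⟩ := localised_bounds hψ.isShellCutoff hε k1 k2
      have h0 : 0 ≤ ξ 0 ^ 2 + ξ 1 ^ 2 := by positivity
      have b1 := minorSq_ge_radial (z := ξ 2) h0 hc.le
      have b2 := minorSq_le (z := ξ 2) h0 hc.le
      constructor
      · have := sq_pos_of_pos hε
        linarith
      · linarith) x
  have hp : ∀ i ∈ Finset.range n, ‖oscInt (pieceSymbol (lpBump ψ) c (ε ^ 2 / 4 * 2 ^ i) t ε⁻¹) x‖ ≤
      C * (t * √t * ε)⁻¹ * (4000000 * (2 * (ε * r ^ i) + 128 * (r⁻¹) ^ i)) := fun i hi => by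
    have hi' : i + 1 ≤ n := Finset.mem_range.1 hi
    set β : ℝ := ε ^ 2 / 4 * 2 ^ i with hβ
    have k1 : (1 : ℝ) ≤ 2 ^ i := one_le_pow₀ (by norm_num)
    have k2 : (2 : ℝ) ^ (i + 1) ≤ 2 ^ n := pow_le_pow_right₀ (by norm_num) hi'
    have hβ0 : 0 < β := by positivity
    have k3 : ε ^ 2 / 4 ≤ β := le_mul_of_one_le_right (by positivity) k1
    have k4 : β ≤ 8 := by
      calc β = ε ^ 2 * 2 ^ (i + 1) / 8 := by rw [hβ, pow_succ]; ring
        _ ≤ ε ^ 2 * 2 ^ n / 8 := by gcongr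
        _ = 8 := by rw [hn]; norm_num
    set U := √(c ^ 2 + β) with hU
    have hU2 : U ^ 2 = c ^ 2 + β := Real.sq_sqrt (by positivity)
    have hU0 : 0 < U := Real.sqrt_pos.2 (by positivity)
    have hUl : c ≤ U := Real.le_sqrt_of_sq_le (by linarith)
    have hUu : U ≤ 17 := Real.sqrt_le_iff.2 ⟨by linarith, by nlinarith⟩
    refine (H c β U t ε _ hc hβ0 hU0 hU2 ht hε hε1 (by linarith) rfl x).trans ?_
    set D := (β + c ^ 2 * ε ^ 2 / β) / U with hD
    have hD0 : 0 < D := by positivity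
    have hD1 : D ≤ 16 * (β + 256 * (ε ^ 2 / β)) := by
      rw [hD, div_le_iff₀ hU0, mul_div_assoc]
      have h1 : c ^ 2 ≤ 256 := by nlinarith
      have h2 : 0 < ε ^ 2 / β := by positivity
      have h3 : β + c ^ 2 * (ε ^ 2 / β) ≤ β + 256 * (ε ^ 2 / β) := by gcongr
      nlinarith
    have hb : ε ^ 2 / β ≤ 4 := by rw [div_le_iff₀ hβ0]; linarith
    have hDs : √D ≤ 129 := Real.sqrt_le_iff.2 ⟨by norm_num, by linarith⟩
    have hUs : √U ≤ 5 := Real.sqrt_le_iff.2 ⟨by norm_num, by linarith⟩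
    have hDr : √D ≤ 2 * (ε * r ^ i) + 128 * (r⁻¹) ^ i := by
      refine Real.sqrt_le_iff.2 ⟨by positivity, ?_⟩
      have e1 : (ε * r ^ i) ^ 2 = 4 * β := by
        rw [hβ, mul_pow, ← pow_mul, mul_comm i, pow_mul, hr2]; ring
      have e2 : ((r⁻¹) ^ i) ^ 2 = ε ^ 2 / β / 4 := by
        rw [hβ, ← pow_mul, mul_comm i, pow_mul, inv_pow, hr2]; field_simp
        rw [← mul_pow]; norm_num
      have e3 : 0 < ε * r ^ i * (r⁻¹) ^ i := by positivity
      nlinarith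
    have hq : D = √D * √D := (Real.mul_self_sqrt hD0.le).symm
    have hq0 : 0 < √D := Real.sqrt_pos.2 hD0
    gcongr
    calc D * √D + D * (U ^ 2 * √U) / c + √D * U ^ 2
        = √D * (√D * √D + √D * (U ^ 2 * √U) / c + U ^ 2) := by
          rw [Real.mul_self_sqrt hD0.le]
          nth_rewrite 3 [hq]
          ring
      _ ≤ √D * (129 * 129 + 129 * (17 ^ 2 * 5) / (1 / 16) + 17 ^ 2) := by gcongr
      _ ≤ √D * 4000000 := by gcongr; norm_num
      _ = 4000000 * √D := by ring
      _ ≤ _ := by gcongr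
  refine (h.trans (Finset.sum_le_sum hp)).trans ?_
  rw [← Finset.mul_sum, ← Finset.mul_sum, Finset.sum_add_distrib, ← Finset.mul_sum, ← Finset.mul_sum,
    ← Finset.mul_sum]
  have g1 : ε * ∑ i ∈ Finset.range n, r ^ i ≤ 20 := by
    have a := mul_geom_sum r n
    have b : ε * r ^ n = 8 := by
      rw [← sq_eq_sq₀ (by positivity) (by norm_num), mul_pow, ← pow_mul, mul_comm n, pow_mul, hr2, hn]
      norm_num
    have c1 : (r - 1) * (ε * ∑ i ∈ Finset.range n, r ^ i) ≤ 8 := by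
      calc _ = ε * ((r - 1) * ∑ i ∈ Finset.range n, r ^ i) := by ring
        _ = 8 - ε := by rw [a, mul_sub, b, mul_one]
        _ ≤ 8 := by linarith
    by_contra! hcon
    nlinarith
  have g2 : ∑ i ∈ Finset.range n, (r⁻¹) ^ i ≤ 7 := by
    have a := mul_neg_geom_sum r⁻¹ n
    have a1 : r⁻¹ ≤ 5 / 7 := by rw [inv_le_comm₀ hr0 (by norm_num)]; norm_num at hr1 ⊢; linarith
    have a2 : 0 < (r⁻¹) ^ n := by positivity
    by_contra! hcon
    nlinarith
  calc C * (t * √t * ε)⁻¹ * (4000000 * (2 * (ε * ∑ i ∈ Finset.range n, r ^ i) +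
        128 * ∑ i ∈ Finset.range n, (r⁻¹) ^ i))
      ≤ C * (t * √t * ε)⁻¹ * (4000000 * (2 * 20 + 128 * 7)) := by gcongr
    _ ≤ C * (t * √t * ε)⁻¹ * (4000000 * 1000) := by gcongr; norm_num
    _ = _ := by ring

lemma Sig_smul {κ a : ℝ} (ha : 0 < a) (ξ : E3) :
    Sig κ (a • ξ) = a * halfSum (κ * a)⁻¹ (ξ 0 ^ 2 + ξ 1 ^ 2) (ξ 2) := by
  have e : ∀ y : ℝ, √(a ^ 2 * y) = a * √y := fun y => by
    rw [Real.sqrt_mul (sq_nonneg a), Real.sqrt_sq ha.le]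
  have hk : κ⁻¹ = a * (κ * a)⁻¹ := by
    rw [mul_inv]; field_simp
  simp only [Sig, d1, d2, halfSum, PiLp.smul_apply, smul_eq_mul]
  rw [hk, mul_div_assoc', mul_add, ← e, ← e]
  congr 3 <;> ring

/-- The localised half-wave kernel in rescaled variables. -/
lemma integral_Sig_eq (θ : ℝ → ℝ) {κ : ℝ} (t : ℝ) (x : E3) (k p : ℤ) :
    ∫ ξ : E3, Complex.exp (Complex.I * ((t * Sig κ ξ + dot3 x ξ : ℝ) : ℂ)) *
        ((θ ((2 : ℝ) ^ (-k) * ‖ξ‖) * θ ((2 : ℝ) ^ (-(k + p)) * nrmh ξ) : ℝ) : ℂ) =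
      (((2 : ℝ) ^ k) ^ 3 : ℝ) • oscInt (waveSymbol θ (κ * 2 ^ k)⁻¹ (t * 2 ^ k) ((2 : ℝ) ^ p)⁻¹)
        ((2 : ℝ) ^ k • x) := by
  have ha : (0 : ℝ) < 2 ^ k := by positivity
  set f : E3 → ℂ := fun ξ => Complex.exp (Complex.I * ((t * Sig κ ξ + dot3 x ξ : ℝ) : ℂ)) *
        ((θ ((2 : ℝ) ^ (-k) * ‖ξ‖) * θ ((2 : ℝ) ^ (-(k + p)) * nrmh ξ) : ℝ) : ℂ) with hf
  have h := Measure.integral_comp_smul (volume : Measure E3) f ((2 : ℝ) ^ k)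
  rw [finrank_euclideanSpace, Fintype.card_fin, abs_of_pos (by positivity)] at h
  rw [eq_comm, inv_smul_eq_iff₀ (by positivity)] at h
  rw [h]
  congr 1
  refine integral_congr_ae (Filter.Eventually.of_forall fun ξ => ?_)
  simp only [hf, waveSymbol]
  rw [Sig_smul ha, norm_smul, nrmh_smul, Real.norm_eq_abs, abs_of_pos ha, neg_add,
    zpow_add₀ two_ne_zero, zpow_neg, zpow_neg, inv_mul_cancel_left₀ ha.ne',
    show ((2 : ℝ) ^ k)⁻¹ * ((2 : ℝ) ^ p)⁻¹ * (2 ^ k * nrmh ξ) = ((2 : ℝ) ^ p)⁻¹ * nrmh ξ by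
      field_simp,
    show t * (2 ^ k * halfSum (κ * 2 ^ k)⁻¹ (ξ 0 ^ 2 + ξ 1 ^ 2) (ξ 2)) + dot3 x ((2 : ℝ) ^ k • ξ) =
      t * 2 ^ k * halfSum (κ * 2 ^ k)⁻¹ (ξ 0 ^ 2 + ξ 1 ^ 2) (ξ 2) + dot3 ((2 : ℝ) ^ k • x) ξ by
      rw [dot3_smul]; simp only [dot3, PiLp.smul_apply, smul_eq_mul]; ring]
  push_cast
  rw [mul_add, Complex.exp_add]
  ring

/-- Convolution-kernel form of the `t^{-3/2}` dispersive decay estimate for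
the `Σ` half-wave `e^{itΣ_κ}P_{k,p}`, in the three regimes `κ2ᵏ ≫ 1`, `κ2ᵏ ∼ 1`, `κ2ᵏ ≪ 1`. -/
theorem Sigma_kernel_decay (ψ : ℝ → ℝ) (hψ : IsCutoff ψ) :
    ∃ C > 0, ∃ K : ℝ, 2 ≤ K ∧
      ∀ (κ t : ℝ) (x : E3) (k p : ℤ), 0 < κ → 0 < t → p ≤ 0 →
        (K ≤ κ * 2 ^ k →
          ‖∫ ξ : E3, Complex.exp (Complex.I * ((t * Sig κ ξ + dot3 x ξ : ℝ) : ℂ)) *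
              ((lpBump ψ ((2 : ℝ) ^ (-k) * ‖ξ‖) * lpBump ψ ((2 : ℝ) ^ (-(k + p)) * nrmh ξ) : ℝ) : ℂ)‖
            ≤ C * t ^ (-(3 / 2) : ℝ) * κ * (2 : ℝ) ^ ((5 / 2) * (k : ℝ) - (p : ℝ))) ∧
        (K⁻¹ ≤ κ * 2 ^ k → κ * 2 ^ k ≤ K →
          ‖∫ ξ : E3, Complex.exp (Complex.I * ((t * Sig κ ξ + dot3 x ξ : ℝ) : ℂ)) *
              ((lpBump ψ ((2 : ℝ) ^ (-k) * ‖ξ‖) * lpBump ψ ((2 : ℝ) ^ (-(k + p)) * nrmh ξ) : ℝ) : ℂ)‖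
            ≤ C * t ^ (-(3 / 2) : ℝ) * (2 : ℝ) ^ ((3 / 2) * (k : ℝ) - (p : ℝ))) ∧
        (κ * 2 ^ k ≤ K⁻¹ →
          ‖∫ ξ : E3, Complex.exp (Complex.I * ((t * Sig κ ξ + dot3 x ξ : ℝ) : ℂ)) *
              ((lpBump ψ ((2 : ℝ) ^ (-k) * ‖ξ‖) * lpBump ψ ((2 : ℝ) ^ (-(k + p)) * nrmh ξ) : ℝ) : ℂ)‖
            ≤ C * t ^ (-(3 / 2) : ℝ) * κ ^ (-(5 / 2) : ℝ)
              * (2 : ℝ) ^ (-(k : ℝ) - (p : ℝ))) := by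
  obtain ⟨C₁, hC₁, H₁⟩ := norm_oscInt_waveSymbol_le_of_le hψ
  obtain ⟨C₂, hC₂, H₂⟩ := norm_oscInt_waveSymbol_le_of_mem_Icc hψ
  obtain ⟨C₃, hC₃, H₃⟩ := norm_oscInt_waveSymbol_le_of_ge hψ
  refine ⟨C₁ + C₂ + C₃, by positivity, 16, by norm_num, fun κ t x k p hκ ht hp => ?_⟩
  simp only [integral_Sig_eq, norm_smul, Real.norm_eq_abs]
  set a : ℝ := 2 ^ k with ha
  set ε : ℝ := 2 ^ p with hε
  have ha0 : 0 < a := by positivity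
  have hε0 : 0 < ε := by positivity
  have hε1 : ε ≤ 1 := zpow_le_one_of_nonpos₀ (by norm_num) hp
  have two_rpow : ∀ y : ℝ, (2 : ℝ) ^ (y * (k : ℝ) - (p : ℝ)) = a ^ y * ε⁻¹ := fun y => by
    rw [Real.rpow_sub two_pos, mul_comm y, Real.rpow_mul two_pos.le, Real.rpow_intCast,
      Real.rpow_intCast, div_eq_mul_inv]
  have hthreeHalf : ∀ y : ℝ, 0 < y → y * √y = y ^ (3 / 2 : ℝ) := fun y hy => by
    rw [Real.sqrt_eq_rpow, ← Real.rpow_one_add' hy.le (by norm_num)]; norm_num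
  have hfactor : a ^ 3 * (t * a * √(t * a) * ε)⁻¹ = t ^ (-(3 / 2) : ℝ) * a ^ (3 / 2 : ℝ) * ε⁻¹ := by
    rw [hthreeHalf _ (by positivity), Real.mul_rpow ht.le ha0.le, mul_inv, mul_inv,
      ← Real.rpow_neg ht.le, ← Real.rpow_neg ha0.le]
    calc _ = t ^ (-(3 / 2) : ℝ) * (a ^ (3 : ℕ) * a ^ (-(3 / 2) : ℝ)) * ε⁻¹ := by ring
      _ = _ := by
        rw [← Real.rpow_natCast, ← Real.rpow_add ha0]; norm_num
  have hta : 0 < t * a := by positivity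
  rw [abs_of_pos (by positivity)]
  refine ⟨fun h => ?_, fun h1 h2 => ?_, fun h => ?_⟩
  · have h1 := H₁ (κ * a)⁻¹ (t * a) ε (by positivity)
      (by rw [inv_le_comm₀ (by positivity) (by norm_num)]; linarith) hta hε0 hε1 (a • x)
    calc _ ≤ a ^ 3 * (C₁ * (t * a * √(t * a) * ε)⁻¹ * (κ * a)⁻¹⁻¹) := by gcongr
      _ = C₁ * (a ^ 3 * (t * a * √(t * a) * ε)⁻¹) * κ * a := by rw [inv_inv]; ring
      _ = C₁ * t ^ (-(3 / 2) : ℝ) * κ * (a ^ (3 / 2 + 1 : ℝ) * ε⁻¹) := by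
        rw [hfactor, Real.rpow_add_one ha0.ne']; ring
      _ ≤ (C₁ + C₂ + C₃) * t ^ (-(3 / 2) : ℝ) * κ * (a ^ (3 / 2 + 1 : ℝ) * ε⁻¹) := by
        gcongr; linarith
      _ = _ := by rw [two_rpow]; norm_num
  · obtain ⟨m, rfl⟩ : ∃ m : ℕ, p = -m := ⟨p.natAbs, by omega⟩
    have h3 := H₂ (κ * a)⁻¹ (t * a) ε
      (by rw [le_inv_comm₀ (by norm_num) (by positivity)]; linarith)
      (by rw [inv_le_comm₀ (by positivity) (by norm_num)]; linarith) hta hε0 hε1 (2 * m + 6)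
      (by rw [hε, zpow_neg, zpow_natCast, pow_add, pow_mul']; field_simp; norm_num) (a • x)
    calc _ ≤ a ^ 3 * (C₂ * (t * a * √(t * a) * ε)⁻¹) := by gcongr
      _ = C₂ * (a ^ 3 * (t * a * √(t * a) * ε)⁻¹) := by ring
      _ = C₂ * t ^ (-(3 / 2) : ℝ) * (a ^ (3 / 2 : ℝ) * ε⁻¹) := by
        rw [hfactor]; ring
      _ ≤ (C₁ + C₂ + C₃) * t ^ (-(3 / 2) : ℝ) * (a ^ (3 / 2 : ℝ) * ε⁻¹) := by
        gcongr; linarith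
      _ = _ := by rw [two_rpow]
  · have h1 := H₃ (κ * a)⁻¹ (t * a) ε
      (by rw [le_inv_comm₀ (by norm_num) (by positivity)]; linarith) hta hε0 hε1 (a • x)
    have h2 : (κ * a)⁻¹ ^ 2 * √(κ * a)⁻¹ = κ ^ (-(5 / 2) : ℝ) * a ^ (-(5 / 2) : ℝ) := by
      rw [← Real.mul_rpow hκ.le ha0.le, Real.rpow_neg (by positivity), ← Real.inv_rpow (by positivity),
        Real.sqrt_eq_rpow, ← Real.rpow_natCast, ← Real.rpow_add (by positivity)]
      norm_num
    calc _ ≤ a ^ 3 * (C₃ * (t * a * √(t * a) * ε)⁻¹ * ((κ * a)⁻¹ ^ 2 * √(κ * a)⁻¹)) := by gcongr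
      _ = C₃ * (a ^ 3 * (t * a * √(t * a) * ε)⁻¹) * (κ ^ (-(5 / 2) : ℝ) * a ^ (-(5 / 2) : ℝ)) := by
        rw [h2]; ring
      _ = C₃ * t ^ (-(3 / 2) : ℝ) * κ ^ (-(5 / 2) : ℝ) * (a ^ (3 / 2 + -(5 / 2) : ℝ) * ε⁻¹) := by
        rw [hfactor, Real.rpow_add ha0]; ring
      _ ≤ (C₁ + C₂ + C₃) * t ^ (-(3 / 2) : ℝ) * κ ^ (-(5 / 2) : ℝ) *
          (a ^ (3 / 2 + -(5 / 2) : ℝ) * ε⁻¹) := by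
        gcongr; linarith
      _ = _ := by rw [← neg_one_mul (k : ℝ), two_rpow]; norm_num
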